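/- Let n ≥ 2 and b > 0. Let f : ℝⁿ₊ → ℝ be bounded and measurable with support contained in B₁(0), and let u = T_b f. Then there exists a constant C, depending only on n and b, such that for every α > 0 and every 1 ≤ i, j ≤ n: μ_b{ x ∈ ℝⁿ₊ : |∂_{ij}u(x)| > α } ≤ C α⁻¹ ‖f‖_{L¹_{μ_b}(ℝⁿ₊)}, and μ_b{ x ∈ ℝⁿ₊ : |(∂_n u(x))/x_n| > α } ≤ C α⁻¹ ‖f‖_{L¹_{μ_b}(ℝⁿ₊)}. -/

import Mathlib

open MeasureTheory
open scoped ENNReal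

noncomputable section

/-- Euclidean n-space. -/
abbrev Eu (n : ℕ) := EuclideanSpace ℝ (Fin n)

/-- Partial derivative ∂ψ/∂xᵢ. -/
def pd {n : ℕ} (ψ : Eu n → ℝ) (i : Fin n) (x : Eu n) : ℝ :=
  fderiv ℝ ψ x (EuclideanSpace.single i 1)

/-- Second partial derivative ∂²ψ/∂xᵢ∂xⱼ. -/
def pd2 {n : ℕ} (ψ : Eu n → ℝ) (i j : Fin n) (x : Eu n) : ℝ :=
  pd (pd ψ j) i x


/-- The constant `D_b = 2^{b-2} π^{-n/2} Γ((n+b-2)/2)/Γ(b/2)`. -/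
def Db (n : ℕ) (b : ℝ) : ℝ :=
  2 ^ (b - 2) * Real.pi ^ (-(n : ℝ) / 2) *
    Real.Gamma (((n : ℝ) + b - 2) / 2) / Real.Gamma (b / 2)

/-- Reflection `y* = (y₁,…,y_{n-1},−y_n)` across the hyperplane `{y_n = 0}`. -/
def reflLn {n : ℕ} (ln : Fin n) (y : Eu n) : Eu n :=
  (EuclideanSpace.equiv (Fin n) ℝ).symm (fun i => if i = ln then -(y i) else y i)

/-- Horiuchi's Green function `K_b(x,y)`. -/
def Kb (n : ℕ) (ln : Fin n) (b : ℝ) (x y : Eu n) : ℝ :=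
  Db n b * ∫ τ in (0 : ℝ)..1,
    (‖x - y‖ ^ 2 * (1 - τ) + ‖x - reflLn ln y‖ ^ 2 * τ) ^ (-(((n : ℝ) - 2 + b) / 2)) *
      (τ * (1 - τ)) ^ (b / 2 - 1)

/-- The solution operator `T_b f(x) = ∫_{ℝⁿ₊} K_b(x,y) yₙ^b f(y) dy`. -/
def Tb (n : ℕ) (ln : Fin n) (b : ℝ) (f : Eu n → ℝ) (x : Eu n) : ℝ :=
  ∫ y in {y : Eu n | 0 < y ln}, Kb n ln b x y * (y ln) ^ b * f y

/-- The measure `μ_b` on `ℝⁿ₊` with density `xₙ^b` w.r.t. Lebesgue measure. -/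
def mub (n : ℕ) (ln : Fin n) (b : ℝ) : Measure (Eu n) :=
  (volume.restrict {x : Eu n | 0 < x ln}).withDensity
    fun x => ENNReal.ofReal ((x ln) ^ b)

namespace Horiuchi
open ProbabilityTheory

/-- The symmetric beta distribution on `(0, 1)` that appears in the kernel `Kb`. -/
def betaM (b : ℝ) : Measure ℝ := betaMeasure (b / 2) (b / 2)

lemma isProbabilityMeasure_betaM {b : ℝ} (hb : 0 < b) : IsProbabilityMeasure (betaM b) :=
  isProbabilityMeasureBeta (by positivity) (by positivity)

instance sFinite_betaM (b : ℝ) : SFinite (betaM b) := by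
  unfold betaM betaMeasure; infer_instance

lemma betaM_eq (b : ℝ) : betaM b = (volume.restrict (Set.Ioo 0 1)).withDensity
    (fun τ : ℝ => ENNReal.ofReal (1 / beta (b / 2) (b / 2) * (τ * (1 - τ)) ^ (b / 2 - 1))) := by
  unfold betaM betaMeasure
  rw [← withDensity_indicator measurableSet_Ioo]
  congr 1
  ext τ
  by_cases h : τ ∈ Set.Ioo (0 : ℝ) 1
  · rw [Set.indicator_of_mem h, betaPDF_of_pos_lt_one h.1 h.2,
      Real.mul_rpow h.1.le (by linarith [h.2]), mul_assoc]
  · rw [Set.indicator_of_notMem h, betaPDF_eq, if_neg (by simpa using h)]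
    simp

lemma betaM_ae (b : ℝ) : ∀ᵐ τ ∂(betaM b), 0 < τ ∧ τ < 1 := by
  rw [betaM_eq]
  apply (withDensity_absolutelyContinuous _ _).ae_le
  filter_upwards [ae_restrict_mem measurableSet_Ioo] with τ h using h

lemma integral_betaM (b : ℝ) (hb : 0 < b) (φ : ℝ → ℝ) : ∫ τ, φ τ ∂(betaM b) =
    1 / beta (b / 2) (b / 2) * ∫ τ in (0 : ℝ)..1, φ τ * (τ * (1 - τ)) ^ (b / 2 - 1) := by
  have hB : 0 < beta (b / 2) (b / 2) := beta_pos (by positivity) (by positivity)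
  rw [betaM_eq, integral_withDensity_eq_integral_toReal_smul (by fun_prop) (by simp),
    intervalIntegral.integral_of_le zero_le_one, integral_Ioc_eq_integral_Ioo,
    ← integral_const_mul]
  apply setIntegral_congr_fun measurableSet_Ioo
  intro τ h
  have : 0 ≤ τ * (1 - τ) := mul_nonneg h.1.le (by linarith [h.2])
  simp only [smul_eq_mul]
  rw [ENNReal.toReal_ofReal (by positivity)]
  ring

lemma intervalIntegrable_beta_weight {b : ℝ} (hb : 0 < b) :
    IntervalIntegrable (fun τ : ℝ => (τ * (1 - τ)) ^ (b / 2 - 1)) volume 0 1 := by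
  have hB : 0 < beta (b / 2) (b / 2) := beta_pos (by positivity) (by positivity)
  have := isProbabilityMeasure_betaM hb
  by_contra h
  have h1 := integral_betaM b hb (fun _ => 1)
  simp only [one_mul] at h1
  rw [intervalIntegral.integral_undef h] at h1
  simp at h1

lemma rpow_mul_exp_neg_le {p c z : ℝ} (hp : 0 < p) (hc : 0 < c) (hz : 0 ≤ z) :
    z ^ p * Real.exp (-(c * z)) ≤ (p / c) ^ p := by
  have h1 : c * z / p ≤ Real.exp (c * z / p) := by linarith [Real.add_one_le_exp (c * z / p)]
  have h2 : (c * z / p) ^ p ≤ Real.exp (c * z) := by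
    calc (c * z / p) ^ p ≤ (Real.exp (c * z / p)) ^ p :=
          Real.rpow_le_rpow (by positivity) h1 hp.le
      _ = Real.exp (c * z) := by rw [← Real.exp_mul]; congr 1; field_simp
  have h3 : z ^ p = (p / c) ^ p * (c * z / p) ^ p := by
    rw [← Real.mul_rpow (by positivity) (by positivity)]; congr 1; field_simp
  rw [h3, Real.exp_neg, mul_assoc]
  have : (c * z / p) ^ p * (Real.exp (c * z))⁻¹ ≤ 1 := by
    rw [← div_eq_mul_inv]; exact (div_le_one (Real.exp_pos _)).2 h2
  exact mul_le_of_le_one_right (by positivity) this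

lemma exists_rpow_mul_integral_exp_betaM_le {b : ℝ} (hb : 0 < b) : ∃ C : ℝ, 0 < C ∧ ∀ z : ℝ, 0 ≤ z →
    z ^ (b / 2) * ∫ τ, Real.exp (-(z * τ)) ∂(betaM b) ≤ C := by
  set a := b / 2 with ha
  have ha0 : 0 < a := by positivity
  have hB : 0 < beta a a := beta_pos ha0 ha0
  set I0 := ∫ τ in (0 : ℝ)..1, (τ * (1 - τ)) ^ (a - 1) with hI0
  have hI0n : 0 ≤ I0 := by
    apply intervalIntegral.integral_nonneg zero_le_one
    intro τ h
    exact Real.rpow_nonneg (mul_nonneg h.1 (by linarith [h.2])) _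
  set K : ℝ := max 1 ((1 / 2) ^ (a - 1)) with hK
  have hK1 : 1 ≤ K := le_max_left _ _
  refine ⟨1 / beta a a * (K * Real.Gamma a + (a / (1 / 2)) ^ a * I0) , ?_, ?_⟩
  · have := Real.Gamma_pos_of_pos ha0
    positivity
  intro z hz
  rcases hz.eq_or_lt with rfl | hz
  · rw [Real.zero_rpow ha0.ne', zero_mul]
    have := Real.Gamma_pos_of_pos ha0
    positivity
  rw [integral_betaM b hb, ← mul_assoc, mul_comm (z ^ a), mul_assoc]
  apply mul_le_mul_of_nonneg_left _ (by positivity)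
  have hw := intervalIntegrable_beta_weight hb
  have hG : IntegrableOn (fun t : ℝ => t ^ (a - 1) * Real.exp (-(z * t))) (Set.Ioi 0) := by
    by_contra h
    have h1 := Real.integral_rpow_mul_exp_neg_mul_Ioi ha0 hz
    rw [integral_undef h] at h1
    have := Real.Gamma_pos_of_pos ha0
    have : 0 < (1 / z) ^ a * Real.Gamma a := by positivity
    linarith
  have hG1 : IntervalIntegrable (fun t : ℝ => t ^ (a - 1) * Real.exp (-(z * t))) volume 0 1 := by
    rw [intervalIntegrable_iff_integrableOn_Ioc_of_le zero_le_one]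
    exact hG.mono_set (fun t h => h.1)
  have hG2 : ∫ t in (0 : ℝ)..1, t ^ (a - 1) * Real.exp (-(z * t)) ≤
      (1 / z) ^ a * Real.Gamma a := by
    rw [← Real.integral_rpow_mul_exp_neg_mul_Ioi ha0 hz,
      intervalIntegral.integral_of_le zero_le_one]
    apply setIntegral_mono_set hG
    · filter_upwards [ae_restrict_mem measurableSet_Ioi] with t ht
      have : (0 : ℝ) < t := ht
      simp only [Pi.zero_apply]; positivity
    · exact Filter.Eventually.of_forall (fun t h => h.1)
  have key : ∫ τ in (0 : ℝ)..1, Real.exp (-(z * τ)) * (τ * (1 - τ)) ^ (a - 1) ≤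
      ∫ τ in (0 : ℝ)..1, (K * (τ ^ (a - 1) * Real.exp (-(z * τ))) +
        Real.exp (-(1 / 2 * z)) * (τ * (1 - τ)) ^ (a - 1)) := by
    apply intervalIntegral.integral_mono_on_of_le_Ioo zero_le_one
    · apply hw.continuousOn_mul
      fun_prop
    · exact (hG1.const_mul _).add (hw.const_mul _)
    intro τ h
    have h0 : 0 < τ := h.1
    have h1 : 0 < 1 - τ := by linarith [h.2]
    have hp : 0 ≤ τ ^ (a - 1) * Real.exp (-(z * τ)) := by positivity
    have hp' : 0 ≤ (τ * (1 - τ)) ^ (a - 1) := by positivity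
    rcases le_total τ (1 / 2) with h2 | h2
    · have h3 : (1 - τ) ^ (a - 1) ≤ K := by
        rcases le_total 0 (a - 1) with h4 | h4
        · exact (Real.rpow_le_one h1.le (by linarith) h4).trans hK1
        · exact (Real.rpow_le_rpow_of_nonpos (by norm_num) (by linarith) h4).trans
            (le_max_right _ _)
      have h5 : 0 ≤ Real.exp (-(1 / 2 * z)) * (τ * (1 - τ)) ^ (a - 1) := by positivity
      calc _ = (1 - τ) ^ (a - 1) * (τ ^ (a - 1) * Real.exp (-(z * τ))) := by
            rw [Real.mul_rpow h0.le h1.le]; ring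
        _ ≤ K * (τ ^ (a - 1) * Real.exp (-(z * τ))) := mul_le_mul_of_nonneg_right h3 hp
        _ ≤ _ := by linarith
    · have h3 : Real.exp (-(z * τ)) ≤ Real.exp (-(1 / 2 * z)) := by
        apply Real.exp_le_exp.2; nlinarith
      have h4 : 0 ≤ K * (τ ^ (a - 1) * Real.exp (-(z * τ))) := by positivity
      have := mul_le_mul_of_nonneg_right h3 hp'
      linarith
  rw [intervalIntegral.integral_add (hG1.const_mul _) (hw.const_mul _),
    intervalIntegral.integral_const_mul, intervalIntegral.integral_const_mul] at key
  have hza : 0 < z ^ a := by positivity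
  have e1 : z ^ a * (1 / z) ^ a = 1 := by
    rw [← Real.mul_rpow hz.le (by positivity)]; simp [hz.ne']
  have e2 := rpow_mul_exp_neg_le (c := 1 / 2) ha0 (by norm_num) hz.le
  calc _ ≤ z ^ a * (K * ((1 / z) ^ a * Real.Gamma a) + Real.exp (-(1 / 2 * z)) * I0) := by
        apply mul_le_mul_of_nonneg_left _ hza.le
        refine key.trans ?_
        gcongr
    _ = K * Real.Gamma a * (z ^ a * (1 / z) ^ a) + (z ^ a * Real.exp (-(1 / 2 * z))) * I0 := by
        ring
    _ ≤ _ := by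
        rw [e1, mul_one]
        gcongr

lemma betaM_integral_by_parts {b : ℝ} (hb : 0 < b) (z : ℝ) :
    b / 2 * ∫ τ, (1 - 2 * τ) * Real.exp (-(z * τ)) ∂(betaM b) =
      z * ∫ τ, τ * (1 - τ) * Real.exp (-(z * τ)) ∂(betaM b) := by
  set a := b / 2 with ha
  have ha0 : 0 < a := by positivity
  have hw := intervalIntegrable_beta_weight hb
  rw [← ha] at hw
  have i1 : IntervalIntegrable (fun τ : ℝ => (1 - 2 * τ) * Real.exp (-(z * τ)) *
      (τ * (1 - τ)) ^ (a - 1)) volume 0 1 := by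
    apply hw.continuousOn_mul; fun_prop
  have i2 : IntervalIntegrable (fun τ : ℝ => τ * (1 - τ) * Real.exp (-(z * τ)) *
      (τ * (1 - τ)) ^ (a - 1)) volume 0 1 := by
    apply hw.continuousOn_mul; fun_prop
  have h := intervalIntegral.integral_eq_sub_of_hasDerivAt_of_le (a := 0) (b := 1)
    (f := fun τ : ℝ => (τ * (1 - τ)) ^ a * Real.exp (-(z * τ)))
    (f' := fun τ : ℝ => a * ((1 - 2 * τ) * Real.exp (-(z * τ)) * (τ * (1 - τ)) ^ (a - 1)) -
      z * (τ * (1 - τ) * Real.exp (-(z * τ)) * (τ * (1 - τ)) ^ (a - 1))) zero_le_one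
    (by
      apply ContinuousOn.mul
      · apply ContinuousOn.rpow_const (by fun_prop)
        intro x _; right; exact ha0.le
      · fun_prop)
    (by
      intro τ h
      have h0 : 0 < τ * (1 - τ) := mul_pos h.1 (by linarith [h.2])
      have d1 : HasDerivAt (fun τ : ℝ => τ * (1 - τ)) (1 - 2 * τ) τ := by
        exact ((hasDerivAt_id' τ).mul ((hasDerivAt_id' τ).const_sub 1)).congr_deriv (by ring)
      have d2 : HasDerivAt (fun τ : ℝ => Real.exp (-(z * τ)))
          (Real.exp (-(z * τ)) * (-(z * 1))) τ :=
        (((hasDerivAt_id' τ).const_mul z).neg).exp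
      refine ((d1.rpow_const (p := a) (Or.inl h0.ne')).mul d2).congr_deriv ?_
      have : (τ * (1 - τ)) ^ a = (τ * (1 - τ)) ^ (a - 1) * (τ * (1 - τ)) := by
        rw [← Real.rpow_add_one h0.ne']; simp
      rw [this]; ring)
    ((i1.const_mul a).sub (i2.const_mul z))
  rw [intervalIntegral.integral_sub (i1.const_mul a) (i2.const_mul z),
    intervalIntegral.integral_const_mul, intervalIntegral.integral_const_mul] at h
  simp only [mul_zero, zero_mul, sub_self, mul_one, Real.zero_rpow ha0.ne'] at h
  rw [integral_betaM b hb, integral_betaM b hb, ← ha]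
  linear_combination (1 / beta a a) * h

end Horiuchi

namespace Horiuchi

variable {n : ℕ}

/-- The open upper half-space. -/
def upper (ln : Fin n) : Set (Eu n) := {x | 0 < x ln}

lemma isOpen_upper (ln : Fin n) : IsOpen (upper ln) :=
  isOpen_lt continuous_const (by fun_prop)

lemma measurableSet_upper (ln : Fin n) : MeasurableSet (upper ln) :=
  (isOpen_upper ln).measurableSet

lemma mub_eq (ln : Fin n) (b : ℝ) : mub n ln b =
    (volume.restrict (upper ln)).withDensity fun x => ENNReal.ofReal ((x ln) ^ b) := rfl

lemma measurable_weight (ln : Fin n) (b : ℝ) :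
    Measurable (fun x : Eu n => ENNReal.ofReal ((x ln) ^ b)) := by fun_prop

instance sigmaFinite_mub (ln : Fin n) (b : ℝ) : SigmaFinite (mub n ln b) := by
  rw [mub_eq]
  exact SigmaFinite.withDensity_ofReal _

lemma mub_ae_upper (ln : Fin n) (b : ℝ) : ∀ᵐ x ∂(mub n ln b), 0 < x ln := by
  rw [mub_eq]
  apply (withDensity_absolutelyContinuous _ _).ae_le
  exact ae_restrict_mem (measurableSet_upper ln)

lemma lintegral_mub (ln : Fin n) (b : ℝ) (φ : Eu n → ℝ≥0∞) :
    ∫⁻ x, φ x ∂(mub n ln b) = ∫⁻ x in upper ln, ENNReal.ofReal ((x ln) ^ b) * φ x := by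
  rw [mub_eq, lintegral_withDensity_eq_lintegral_mul_non_measurable _ (measurable_weight ln b)
    (by simp)]
  rfl

lemma integral_mub (ln : Fin n) (b : ℝ) (φ : Eu n → ℝ) :
    ∫ x, φ x ∂(mub n ln b) = ∫ x in upper ln, (x ln) ^ b * φ x := by
  rw [mub_eq, integral_withDensity_eq_integral_toReal_smul (measurable_weight ln b) (by simp)]
  apply setIntegral_congr_fun (measurableSet_upper ln)
  intro x hx
  have : 0 < x ln := hx
  simp only [smul_eq_mul]
  rw [ENNReal.toReal_ofReal (by positivity)]

lemma mub_apply (ln : Fin n) (b : ℝ) {s : Set (Eu n)} (hs : MeasurableSet s) :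
    mub n ln b s = ∫⁻ x in s ∩ upper ln, ENNReal.ofReal ((x ln) ^ b) := by
  rw [mub_eq, withDensity_apply _ hs, Measure.restrict_restrict hs]

/-- The quadratic form interpolating between `‖x - y‖ ^ 2` and `‖x - y*‖ ^ 2`. -/
def Aq (ln : Fin n) (x y : Eu n) (τ : ℝ) : ℝ := ‖x - y‖ ^ 2 + 4 * (x ln * y ln) * τ

/-- The displacement from `x` to the lift of `y`; its squared norm is `Aq ln x y τ`. -/
def disp (ln : Fin n) (x y : Eu n) (τ : ℝ) : EuclideanSpace ℝ (Option (Fin n)) :=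
  WithLp.toLp 2 fun o => o.elim (2 * √(τ * (1 - τ)) * y ln)
    fun i => x i - (if i = ln then 1 - 2 * τ else 1) * y i

lemma disp_none (ln : Fin n) (x y : Eu n) (τ : ℝ) :
    disp ln x y τ none = 2 * √(τ * (1 - τ)) * y ln := rfl

lemma disp_some (ln : Fin n) (x y : Eu n) (τ : ℝ) (i : Fin n) :
    disp ln x y τ (some i) = x i - (if i = ln then 1 - 2 * τ else 1) * y i := rfl

lemma norm_sq_sub_eq_sum (x y : Eu n) : ‖x - y‖ ^ 2 = ∑ i, (x i - y i) ^ 2 := by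
  rw [EuclideanSpace.norm_sq_eq]
  simp

lemma sum_sq_disp_some (ln : Fin n) (x y : Eu n) (τ : ℝ) :
    ∑ i, (disp ln x y τ (some i)) ^ 2 = Aq ln x y τ - 4 * (τ * (1 - τ)) * y ln ^ 2 := by
  have h : ∀ i, (disp ln x y τ (some i)) ^ 2 = (x i - y i) ^ 2 +
      if i = ln then 4 * (x ln * y ln) * τ - 4 * (τ * (1 - τ)) * y ln ^ 2 else 0 := by
    intro i
    rw [disp_some]
    split_ifs with hi
    · subst hi; ring
    · ring
  simp_rw [h, Finset.sum_add_distrib, Aq, norm_sq_sub_eq_sum]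
  simp
  ring

lemma norm_disp_sq (ln : Fin n) (x y : Eu n) {τ : ℝ} (h0 : 0 ≤ τ) (h1 : τ ≤ 1) :
    ‖disp ln x y τ‖ ^ 2 = Aq ln x y τ := by
  have : 0 ≤ τ * (1 - τ) := mul_nonneg h0 (by linarith)
  rw [EuclideanSpace.norm_sq_eq, Fintype.sum_option]
  simp only [Real.norm_eq_abs, sq_abs]
  rw [sum_sq_disp_some, disp_none, mul_pow, mul_pow, Real.sq_sqrt this]
  ring

lemma disp_sub (ln : Fin n) (x y y' : Eu n) (τ : ℝ) :
    disp ln x y τ - disp ln x y' τ = disp ln 0 (y - y') τ := by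
  ext o
  rcases o with _ | i
  · rw [PiLp.sub_apply, disp_none, disp_none, disp_none, PiLp.sub_apply]; ring
  · rw [PiLp.sub_apply, disp_some, disp_some, disp_some, PiLp.sub_apply, PiLp.zero_apply]
    split_ifs <;> ring

lemma norm_disp_sub (ln : Fin n) (x y y' : Eu n) {τ : ℝ} (h0 : 0 ≤ τ) (h1 : τ ≤ 1) :
    ‖disp ln x y τ - disp ln x y' τ‖ = ‖y - y'‖ := by
  rw [disp_sub, ← sq_eq_sq₀ (norm_nonneg _) (norm_nonneg _), norm_disp_sq _ _ _ h0 h1]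
  simp [Aq, norm_sub_rev]

lemma Aq_comm (ln : Fin n) (x y : Eu n) (τ : ℝ) : Aq ln x y τ = Aq ln y x τ := by
  simp only [Aq]; rw [norm_sub_rev]; ring

lemma abs_disp_le (ln : Fin n) (x y : Eu n) (τ : ℝ) (o : Option (Fin n)) :
    |disp ln x y τ o| ≤ ‖disp ln x y τ‖ := by
  simpa using PiLp.norm_apply_le (disp ln x y τ) o

lemma norm_sub_sq_le_Aq {ln : Fin n} {x y : Eu n} (hx : 0 ≤ x ln) (hy : 0 ≤ y ln) {τ : ℝ}
    (h0 : 0 ≤ τ) : ‖x - y‖ ^ 2 ≤ Aq ln x y τ := by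
  have : 0 ≤ 4 * (x ln * y ln) * τ := by positivity
  simp only [Aq]; linarith

lemma measurable_disp (ln : Fin n) (o : Option (Fin n)) :
    Measurable (fun p : (Eu n × Eu n) × ℝ => disp ln p.1.1 p.1.2 p.2 o) := by
  rcases o with _ | i
  · simp only [disp_none]; fun_prop
  · simp only [disp_some]; split_ifs <;> fun_prop

lemma measurable_Aq (ln : Fin n) :
    Measurable (fun p : (Eu n × Eu n) × ℝ => Aq ln p.1.1 p.1.2 p.2) := by
  unfold Aq; fun_prop

/-- The integrand of the heat-type kernels: a quadratic polynomial in the displacement times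
a Gaussian. -/
def ker (ln : Fin n) (b κ c : ℝ) (i j : Option (Fin n)) (x y : Eu n) (τ t : ℝ) : ℝ :=
  t ^ (-((n + b) / 2)) * (κ * (disp ln x y τ i * disp ln x y τ j) / t ^ 2 + c / t) *
    Real.exp (-(Aq ln x y τ / (4 * t)))

lemma measurable_ker (ln : Fin n) (b κ c : ℝ) (i j : Option (Fin n)) :
    Measurable (fun p : ((Eu n × Eu n) × ℝ) × ℝ => ker ln b κ c i j p.1.1.1 p.1.1.2 p.1.2 p.2) := by
  unfold ker
  have h1 : Measurable (fun p : ((Eu n × Eu n) × ℝ) × ℝ => disp ln p.1.1.1 p.1.1.2 p.1.2 i) :=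
    (measurable_disp ln i).comp measurable_fst
  have h2 : Measurable (fun p : ((Eu n × Eu n) × ℝ) × ℝ => disp ln p.1.1.1 p.1.1.2 p.1.2 j) :=
    (measurable_disp ln j).comp measurable_fst
  have h3 : Measurable (fun p : ((Eu n × Eu n) × ℝ) × ℝ => Aq ln p.1.1.1 p.1.1.2 p.1.2) :=
    (measurable_Aq ln).comp measurable_fst
  fun_prop

lemma abs_ker_le (ln : Fin n) (b κ c : ℝ) (i j : Option (Fin n)) (x y : Eu n) {τ t : ℝ}
    (h0 : 0 ≤ τ) (h1 : τ ≤ 1) (ht : 0 < t) :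
    |ker ln b κ c i j x y τ t| ≤ t ^ (-((n + b) / 2)) * ((4 * |κ| + |c|) / t) := by
  have hA := norm_disp_sq ln x y h0 h1
  have hi := abs_disp_le ln x y τ i
  have hj := abs_disp_le ln x y τ j
  set ρ := ‖disp ln x y τ‖
  have hρ : 0 ≤ ρ := norm_nonneg _
  have hexp : ρ ^ 2 / (4 * t) * Real.exp (-(ρ ^ 2 / (4 * t))) ≤ 1 := by
    have := Real.add_one_le_exp (ρ ^ 2 / (4 * t))
    rw [Real.exp_neg, ← div_eq_mul_inv, div_le_one (Real.exp_pos _)]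
    linarith
  have he1 : Real.exp (-(ρ ^ 2 / (4 * t))) ≤ 1 := Real.exp_le_one_iff.2 (by
    have : 0 ≤ ρ ^ 2 / (4 * t) := by positivity
    linarith)
  have hp : 0 < t ^ (-((n + b) / 2)) := by positivity
  unfold ker
  rw [abs_mul, abs_mul, abs_of_pos hp, mul_assoc, ← hA, abs_of_pos (Real.exp_pos _)]
  apply mul_le_mul_of_nonneg_left _ hp.le
  have hij : |disp ln x y τ i * disp ln x y τ j| ≤ ρ ^ 2 := by
    rw [abs_mul, sq]; exact mul_le_mul hi hj (abs_nonneg _) hρ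
  have h2 : |κ * (disp ln x y τ i * disp ln x y τ j) / t ^ 2 + c / t| ≤
      |κ| * ρ ^ 2 / t ^ 2 + |c| / t := by
    refine (abs_add_le _ _).trans ?_
    rw [abs_div, abs_div, abs_mul κ, abs_of_pos ht, abs_of_pos (show 0 < t ^ 2 by positivity)]
    gcongr
  calc _ ≤ (|κ| * ρ ^ 2 / t ^ 2 + |c| / t) * Real.exp (-(ρ ^ 2 / (4 * t))) := by gcongr
    _ = 4 * |κ| / t * (ρ ^ 2 / (4 * t) * Real.exp (-(ρ ^ 2 / (4 * t)))) +
        |c| / t * Real.exp (-(ρ ^ 2 / (4 * t))) := by field_simp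
    _ ≤ 4 * |κ| / t * 1 + |c| / t * 1 := by gcongr
    _ = _ := by ring

set_option maxHeartbeats 1000000 in
/-- Local Lipschitz bound for a quadratic polynomial times a Gaussian. -/
lemma abs_quadratic_gaussian_sub_le (κ c : ℝ) {p q p' q' ρ ρ' d : ℝ} (hρ : 0 ≤ ρ) (hρ' : 0 ≤ ρ')
    (hp : |p| ≤ ρ) (hq : |q| ≤ ρ) (hq' : |q'| ≤ ρ')
    (hpp : |p - p'| ≤ d) (hqq : |q - q'| ≤ d) (hrr : |ρ - ρ'| ≤ d) (hd : 2 * d ≤ ρ) :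
    |(κ * (p * q) + c) * Real.exp (-(ρ ^ 2 / 4)) - (κ * (p' * q') + c) * Real.exp (-(ρ' ^ 2 / 4))| ≤
      1000 * (|κ| + |c|) * d * Real.exp (-(ρ ^ 2 / 32)) := by
  have hd0 : 0 ≤ d := (abs_nonneg _).trans hpp
  obtain ⟨hr1, hr2⟩ := abs_le.1 hrr
  have hlow : ρ / 2 ≤ ρ' := by linarith
  have hup : ρ' ≤ 3 / 2 * ρ := by linarith
  have hpq : |p * q - p' * q'| ≤ 5 / 2 * ρ * d := by
    have : p * q - p' * q' = p * (q - q') + (p - p') * q' := by ring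
    rw [this]
    refine (abs_add_le _ _).trans ?_
    rw [abs_mul, abs_mul]
    have h1 : |p| * |q - q'| ≤ ρ * d := mul_le_mul hp hqq (abs_nonneg _) hρ
    have h2 : |p - p'| * |q'| ≤ d * (3 / 2 * ρ) :=
      mul_le_mul hpp (hq'.trans hup) (abs_nonneg _) hd0
    linarith
  have hE : |Real.exp (-(ρ ^ 2 / 4)) - Real.exp (-(ρ' ^ 2 / 4))| ≤
      5 / 8 * ρ * d * Real.exp (-(ρ ^ 2 / 16)) := by
    have key : ∀ a c : ℝ, ρ / 2 ≤ a → a ≤ c → Real.exp (-(a ^ 2 / 4)) - Real.exp (-(c ^ 2 / 4)) ≤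
        (c ^ 2 / 4 - a ^ 2 / 4) * Real.exp (-(ρ ^ 2 / 16)) := by
      intro a c h1 h2
      have h3 := Real.add_one_le_exp (-(c ^ 2 / 4 - a ^ 2 / 4))
      have h4 : Real.exp (-(c ^ 2 / 4)) =
          Real.exp (-(c ^ 2 / 4 - a ^ 2 / 4)) * Real.exp (-(a ^ 2 / 4)) := by
        rw [← Real.exp_add]; congr 1; ring
      have h5 : Real.exp (-(a ^ 2 / 4)) ≤ Real.exp (-(ρ ^ 2 / 16)) :=
        Real.exp_le_exp.2 (by nlinarith)
      have h6 := Real.exp_pos (-(a ^ 2 / 4))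
      have h7 : 0 ≤ c ^ 2 / 4 - a ^ 2 / 4 := by nlinarith
      calc _ = (1 - Real.exp (-(c ^ 2 / 4 - a ^ 2 / 4))) * Real.exp (-(a ^ 2 / 4)) := by
            rw [h4]; ring
        _ ≤ (c ^ 2 / 4 - a ^ 2 / 4) * Real.exp (-(a ^ 2 / 4)) := by
            apply mul_le_mul_of_nonneg_right _ h6.le; linarith
        _ ≤ _ := mul_le_mul_of_nonneg_left h5 h7
    have hs : 0 < Real.exp (-(ρ ^ 2 / 16)) := Real.exp_pos _
    have hsq : |ρ ^ 2 / 4 - ρ' ^ 2 / 4| ≤ 5 / 8 * ρ * d := by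
      have : ρ ^ 2 / 4 - ρ' ^ 2 / 4 = (ρ - ρ') * ((ρ + ρ') / 4) := by ring
      rw [this, abs_mul, abs_of_nonneg (show 0 ≤ (ρ + ρ') / 4 by positivity)]
      calc _ ≤ d * ((ρ + ρ') / 4) := by gcongr
        _ ≤ d * ((ρ + 3 / 2 * ρ) / 4) := by gcongr
        _ = _ := by ring
    obtain ⟨hs1, hs2⟩ := abs_le.1 hsq
    rcases le_total ρ ρ' with h | h
    · have h1 : Real.exp (-(ρ' ^ 2 / 4)) ≤ Real.exp (-(ρ ^ 2 / 4)) :=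
        Real.exp_le_exp.2 (by nlinarith)
      rw [abs_of_nonneg (by linarith)]
      refine (key ρ ρ' (by linarith) h).trans ?_
      gcongr; linarith
    · have h1 : Real.exp (-(ρ ^ 2 / 4)) ≤ Real.exp (-(ρ' ^ 2 / 4)) :=
        Real.exp_le_exp.2 (by nlinarith)
      rw [abs_of_nonpos (by linarith), neg_sub]
      refine (key ρ' ρ hlow h).trans ?_
      gcongr
  have hX : 0 < Real.exp (-(ρ ^ 2 / 32)) := Real.exp_pos _
  set s := ρ ^ 2 / 32 with hs
  have hs0 : 0 ≤ s := by positivity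
  have hes : Real.exp (-(ρ ^ 2 / 16)) = Real.exp (-s) * Real.exp (-s) := by
    rw [← Real.exp_add]; congr 1; rw [hs]; ring
  have hle : Real.exp (-(ρ' ^ 2 / 4)) ≤ Real.exp (-s) * Real.exp (-s) := by
    rw [← hes]; exact Real.exp_le_exp.2 (by nlinarith)
  have hle2 : Real.exp (-(ρ ^ 2 / 4)) ≤ Real.exp (-s) * Real.exp (-s) := by
    rw [← hes]; exact Real.exp_le_exp.2 (by nlinarith)
  have hb1 : (1 + s + s ^ 2 / 2) * Real.exp (-s) ≤ 1 := by
    have := Real.quadratic_le_exp_of_nonneg hs0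
    rw [Real.exp_neg, ← div_eq_mul_inv, div_le_one (Real.exp_pos _)]
    exact this
  have hρs : ρ ≤ 4 * (1 + s) := by rw [hs]; nlinarith [sq_nonneg (ρ - 4)]
  have hρs3 : ρ ^ 3 ≤ 256 * (1 + s + s ^ 2 / 2) := by
    have : ρ ^ 2 = 32 * s := by rw [hs]; ring
    calc ρ ^ 3 = ρ * ρ ^ 2 := by ring
      _ ≤ (2 + 4 * s) * (32 * s) := by
          rw [this]; gcongr; rw [hs]; nlinarith [sq_nonneg (ρ - 4)]
      _ ≤ _ := by nlinarith
  have hm1 : ρ * Real.exp (-s) ≤ 4 := by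
    calc _ ≤ 4 * (1 + s + s ^ 2 / 2) * Real.exp (-s) := by
          gcongr; nlinarith
      _ ≤ _ := by linarith
  have hm3 : ρ ^ 3 * Real.exp (-s) ≤ 256 := by
    calc _ ≤ 256 * (1 + s + s ^ 2 / 2) * Real.exp (-s) := by gcongr
      _ ≤ _ := by linarith
  have hpq2 : |p * q| ≤ ρ ^ 2 := by
    rw [abs_mul, sq]; exact mul_le_mul hp hq (abs_nonneg _) hρ
  have split : (κ * (p * q) + c) * Real.exp (-(ρ ^ 2 / 4)) -
      (κ * (p' * q') + c) * Real.exp (-(ρ' ^ 2 / 4)) =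
      (κ * (p * q) + c) * (Real.exp (-(ρ ^ 2 / 4)) - Real.exp (-(ρ' ^ 2 / 4))) +
      κ * (p * q - p' * q') * Real.exp (-(ρ' ^ 2 / 4)) := by ring
  rw [split]
  refine (abs_add_le _ _).trans ?_
  rw [abs_mul, abs_mul, abs_mul κ, abs_of_pos (Real.exp_pos (-(ρ' ^ 2 / 4)))]
  have hA : |κ * (p * q) + c| ≤ |κ| * ρ ^ 2 + |c| := by
    refine (abs_add_le _ _).trans ?_
    rw [abs_mul]; gcongr
  rw [hes] at hE
  calc _ ≤ (|κ| * ρ ^ 2 + |c|) * (5 / 8 * ρ * d * (Real.exp (-s) * Real.exp (-s))) +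
        |κ| * (5 / 2 * ρ * d) * (Real.exp (-s) * Real.exp (-s)) := by gcongr
    _ = d * Real.exp (-s) * (|κ| * (5 / 8) * (ρ ^ 3 * Real.exp (-s)) +
        (5 / 8 * |c| + 5 / 2 * |κ|) * (ρ * Real.exp (-s))) := by ring
    _ ≤ d * Real.exp (-s) * (|κ| * (5 / 8) * 256 + (5 / 8 * |c| + 5 / 2 * |κ|) * 4) := by gcongr
    _ ≤ d * Real.exp (-s) * (1000 * (|κ| + |c|)) := by
        gcongr; linarith [abs_nonneg κ, abs_nonneg c]
    _ = _ := by ring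

end Horiuchi

namespace Horiuchi

variable {n : ℕ}

lemma abs_ker_sub_le (ln : Fin n) (b κ c : ℝ) (i j : Option (Fin n)) {x y y' : Eu n} {τ t r : ℝ}
    (hx : 0 ≤ x ln) (hy : 0 ≤ y ln) (h0 : 0 ≤ τ) (h1 : τ ≤ 1) (ht : 0 < t)
    (hr : ‖y - y'‖ ≤ r) (hxy : 2 * r ≤ ‖x - y‖) :
    |ker ln b κ c i j x y τ t - ker ln b κ c i j x y' τ t| ≤
      1000 * (|κ| + |c|) * (r / (t * √t)) *
        (t ^ (-((n + b) / 2)) * Real.exp (-(1 / 32 * Aq ln x y τ / t))) := by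
  have hs : 0 < √t := Real.sqrt_pos.2 ht
  have hst : √t ^ 2 = t := Real.sq_sqrt ht.le
  set s := √t
  have hdd : ‖disp ln x y τ - disp ln x y' τ‖ ≤ r := (norm_disp_sub ln x y y' h0 h1).trans_le hr
  have hA := norm_disp_sq ln x y h0 h1
  have hA' := norm_disp_sq ln x y' h0 h1
  have hcomp : ∀ o, |disp ln x y τ o - disp ln x y' τ o| ≤ r := fun o => by
    have := PiLp.norm_apply_le (disp ln x y τ - disp ln x y' τ) o
    rw [PiLp.sub_apply, Real.norm_eq_abs] at this
    exact this.trans hdd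
  have hbig : 2 * r ≤ ‖disp ln x y τ‖ := by
    refine hxy.trans ?_
    have := norm_sub_sq_le_Aq hx hy h0
    rw [← hA] at this
    exact (sq_le_sq₀ (norm_nonneg _) (norm_nonneg _)).1 this
  have hdiv : ∀ u v : ℝ, |u| ≤ v → |u / s| ≤ v / s := fun u v h => by
    rw [abs_div, abs_of_pos hs]; gcongr
  have key := abs_quadratic_gaussian_sub_le κ c
    (p := disp ln x y τ i / s) (q := disp ln x y τ j / s)
    (p' := disp ln x y' τ i / s) (q' := disp ln x y' τ j / s)
    (ρ := ‖disp ln x y τ‖ / s) (ρ' := ‖disp ln x y' τ‖ / s) (d := r / s)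
    (by positivity) (by positivity) (hdiv _ _ (abs_disp_le ..)) (hdiv _ _ (abs_disp_le ..))
    (hdiv _ _ (abs_disp_le ..))
    (by rw [← sub_div]; exact hdiv _ _ (hcomp i)) (by rw [← sub_div]; exact hdiv _ _ (hcomp j))
    (by rw [← sub_div]; exact hdiv _ _ ((abs_norm_sub_norm_le _ _).trans hdd))
    (by rw [← mul_div_assoc]; gcongr)
  have hp : 0 < t ^ (-((n + b) / 2)) := by positivity
  have hker : ∀ y, ker ln b κ c i j x y τ t = t ^ (-((n + b) / 2)) * t⁻¹ *
      ((κ * (disp ln x y τ i / s * (disp ln x y τ j / s)) + c) *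
        Real.exp (-((‖disp ln x y τ‖ / s) ^ 2 / 4))) := fun y => by
    rw [ker, div_pow, hst, norm_disp_sq ln x y h0 h1,
      show Aq ln x y τ / (4 * t) = Aq ln x y τ / t / 4 by field_simp]
    have : κ * (disp ln x y τ i * disp ln x y τ j) / t ^ 2 + c / t =
        t⁻¹ * (κ * (disp ln x y τ i / s * (disp ln x y τ j / s)) + c) := by
      rw [div_mul_div_comm, ← sq, hst]; field_simp
    rw [this]; ring
  rw [hker y, hker y', ← mul_sub, abs_mul, abs_of_pos (by positivity)]
  refine (mul_le_mul_of_nonneg_left key (by positivity)).trans (le_of_eq ?_)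
  rw [div_pow, hst, hA, show -(Aq ln x y τ / t / 32) = -(1 / 32 * Aq ln x y τ / t) by ring]
  field_simp

lemma integral_exp_Aq (ln : Fin n) (b c : ℝ) (x y : Eu n) (t : ℝ) :
    ∫ τ, Real.exp (-(c * Aq ln x y τ / t)) ∂(betaM b) =
      Real.exp (-(c * ‖x - y‖ ^ 2 / t)) *
        ∫ τ, Real.exp (-(4 * c * (x ln * y ln) / t * τ)) ∂(betaM b) := by
  rw [← integral_const_mul]
  congr 1; ext τ
  rw [← Real.exp_add]; congr 1; rw [Aq]; ring

lemma add_rpow_le_two_rpow {a d p : ℝ} (ha : 0 ≤ a) (hd : 0 ≤ d) (hp : 0 ≤ p) :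
    (a + d) ^ p ≤ 2 ^ p * (a ^ p + d ^ p) := by
  have h1 : (a + d) ^ p ≤ (2 * max a d) ^ p :=
    Real.rpow_le_rpow (by positivity) (by linarith [le_max_left a d, le_max_right a d]) hp
  rw [Real.mul_rpow (by norm_num) (by positivity)] at h1
  refine h1.trans (mul_le_mul_of_nonneg_left ?_ (by positivity))
  have := Real.rpow_nonneg ha p
  have := Real.rpow_nonneg hd p
  rcases max_choice a d with h | h <;> rw [h] <;> linarith

/-- The weighted heat-type kernel is dominated by a Euclidean Gaussian. -/
lemma exists_weight_mul_integral_le (n : ℕ) {b c : ℝ} (hb : 0 < b) (hc : 0 < c) :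
    ∃ C > 0, ∀ (ln : Fin n) (x y : Eu n) (t : ℝ), 0 < x ln → 0 < y ln → 0 < t →
      (y ln) ^ b * ∫ τ, t ^ (-((n + b) / 2)) * Real.exp (-(c * Aq ln x y τ / t)) ∂(betaM b) ≤
        C * (t ^ (-(n / 2 : ℝ)) * Real.exp (-(c / (2 * t) * ‖x - y‖ ^ 2))) := by
  obtain ⟨C₀, hC₀, hC⟩ := exists_rpow_mul_integral_exp_betaM_le hb
  have hP := isProbabilityMeasure_betaM hb
  refine ⟨2 ^ (b / 2) * ((b / 2 / (c / 2)) ^ (b / 2) + (2 * c) ^ (-(b / 2)) * C₀), by positivity,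
    fun ln x y t hx hy ht => ?_⟩
  rw [integral_const_mul, integral_exp_Aq]
  set z := 4 * c * (x ln * y ln) / t with hz
  have hz0 : 0 ≤ z := by positivity
  set φ := ∫ τ, Real.exp (-(z * τ)) ∂(betaM b) with hφ
  have hφ0 : 0 ≤ φ := integral_nonneg fun τ => (Real.exp_pos _).le
  have hφ1 : φ ≤ 1 := by
    calc φ ≤ ∫ τ, (1 : ℝ) ∂(betaM b) := by
          apply integral_mono_of_nonneg (ae_of_all _ fun τ => (Real.exp_pos _).le)
            (integrable_const _)
          filter_upwards [betaM_ae b] with τ hτ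
          exact Real.exp_le_one_iff.2 (by nlinarith [mul_nonneg hz0 hτ.1.le])
      _ = 1 := by simp
  set s := ‖x - y‖ ^ 2 / t with hs
  have hs0 : 0 ≤ s := by positivity
  have hyn : (y ln) ^ b * t ^ (-(b / 2)) ≤ 2 ^ (b / 2) * (s ^ (b / 2) + (z / (2 * c)) ^ (b / 2)) := by
    have h1 : (y ln) ^ b * t ^ (-(b / 2)) = ((y ln) ^ 2 / t) ^ (b / 2) := by
      rw [Real.div_rpow (by positivity) ht.le, ← Real.rpow_natCast, ← Real.rpow_mul hy.le,
        Real.rpow_neg ht.le, div_eq_mul_inv]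
      congr 2; push_cast; ring
    rw [h1]
    refine le_trans (Real.rpow_le_rpow (by positivity) ?_ (by positivity))
      (add_rpow_le_two_rpow hs0 (by positivity) (by positivity))
    have h2 : (x ln - y ln) ^ 2 ≤ ‖x - y‖ ^ 2 := by
      have := PiLp.norm_apply_le (x - y) ln
      rw [PiLp.sub_apply, Real.norm_eq_abs] at this
      rw [← sq_abs]; gcongr
    have h3 : z / (2 * c) = 2 * (x ln * y ln) / t := by rw [hz]; field_simp; ring
    rw [h3, hs, ← add_div]
    gcongr
    nlinarith [sq_nonneg (x ln)]
  have hsplit : t ^ (-((n + b) / 2)) = t ^ (-(n / 2 : ℝ)) * t ^ (-(b / 2)) := by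
    rw [← Real.rpow_add ht]; congr 1; ring
  have he : Real.exp (-(c * ‖x - y‖ ^ 2 / t)) =
      Real.exp (-(c / 2 * s)) * Real.exp (-(c / 2 * s)) := by
    rw [← Real.exp_add]; congr 1; rw [hs]; ring
  have he2 : Real.exp (-(c / (2 * t) * ‖x - y‖ ^ 2)) = Real.exp (-(c / 2 * s)) := by
    congr 1; rw [hs]; field_simp
  rw [he, he2, hsplit]
  have hE := Real.exp_pos (-(c / 2 * s))
  have hE1 : Real.exp (-(c / 2 * s)) ≤ 1 := Real.exp_le_one_iff.2 (by nlinarith)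
  have m1 : s ^ (b / 2) * Real.exp (-(c / 2 * s)) ≤ (b / 2 / (c / 2)) ^ (b / 2) :=
    rpow_mul_exp_neg_le (by positivity) (by positivity) hs0
  have m2 : (z / (2 * c)) ^ (b / 2) * φ ≤ (2 * c) ^ (-(b / 2)) * C₀ := by
    rw [Real.div_rpow hz0 (by positivity), Real.rpow_neg (by positivity), div_eq_mul_inv]
    calc _ = ((2 * c) ^ (b / 2))⁻¹ * (z ^ (b / 2) * φ) := by ring
      _ ≤ _ := by gcongr; exact hC z hz0
  have hz1 : 0 ≤ (z / (2 * c)) ^ (b / 2) := by positivity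
  have hs1 : 0 ≤ s ^ (b / 2) := by positivity
  have htn : 0 < t ^ (-(n / 2 : ℝ)) := by positivity
  have h2b : (0 : ℝ) < 2 ^ (b / 2) := by positivity
  set E := Real.exp (-(c / 2 * s))
  calc (y ln) ^ b * (t ^ (-(n / 2 : ℝ)) * t ^ (-(b / 2)) * (E * E * φ))
      = (y ln) ^ b * t ^ (-(b / 2)) * (t ^ (-(n / 2 : ℝ)) * (E * E * φ)) := by ring
    _ ≤ 2 ^ (b / 2) * (s ^ (b / 2) + (z / (2 * c)) ^ (b / 2)) *
        (t ^ (-(n / 2 : ℝ)) * (E * E * φ)) := by gcongr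
    _ = 2 ^ (b / 2) * t ^ (-(n / 2 : ℝ)) * E * (s ^ (b / 2) * E * φ +
        (z / (2 * c)) ^ (b / 2) * φ * E) := by ring
    _ ≤ 2 ^ (b / 2) * t ^ (-(n / 2 : ℝ)) * E * ((b / 2 / (c / 2)) ^ (b / 2) * 1 +
        (2 * c) ^ (-(b / 2)) * C₀ * 1) := by gcongr
    _ = _ := by ring

end Horiuchi

namespace Horiuchi

variable {n : ℕ}

/-- A Gaussian in the interpolated distance, normalised by the homogeneous dimension. -/
def gk (ln : Fin n) (b c : ℝ) (x y : Eu n) (τ t : ℝ) : ℝ :=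
  t ^ (-((n + b) / 2)) * Real.exp (-(c * Aq ln x y τ / t))

lemma measurable_gk (ln : Fin n) (b c : ℝ) :
    Measurable (fun p : ((Eu n × Eu n) × ℝ) × ℝ => gk ln b c p.1.1.1 p.1.1.2 p.1.2 p.2) := by
  unfold gk
  have h3 : Measurable (fun p : ((Eu n × Eu n) × ℝ) × ℝ => Aq ln p.1.1.1 p.1.1.2 p.1.2) :=
    (measurable_Aq ln).comp measurable_fst
  fun_prop

lemma gk_comm (ln : Fin n) (b c : ℝ) (x y : Eu n) (τ t : ℝ) :
    gk ln b c x y τ t = gk ln b c y x τ t := by rw [gk, gk, Aq_comm]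

lemma gk_nonneg (ln : Fin n) (b c : ℝ) (x y : Eu n) (τ : ℝ) {t : ℝ} (ht : 0 ≤ t) :
    0 ≤ gk ln b c x y τ t := by unfold gk; positivity

lemma gk_le (ln : Fin n) {b c : ℝ} (hc : 0 ≤ c) {x y : Eu n} (hx : 0 ≤ x ln) (hy : 0 ≤ y ln)
    {τ t : ℝ} (hτ : 0 ≤ τ) (ht : 0 < t) : gk ln b c x y τ t ≤ t ^ (-((n + b) / 2)) := by
  unfold gk
  have : 0 ≤ Aq ln x y τ := (sq_nonneg _).trans (norm_sub_sq_le_Aq hx hy hτ)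
  have h2 : Real.exp (-(c * Aq ln x y τ / t)) ≤ 1 := Real.exp_le_one_iff.2 (by
    have : 0 ≤ c * Aq ln x y τ / t := by positivity
    linarith)
  exact mul_le_of_le_one_right (by positivity) h2

lemma exists_lintegral_gk_le (n : ℕ) {b c : ℝ} (hb : 0 < b) (hc : 0 < c) :
    ∃ C > 0, ∀ (ln : Fin n) (x : Eu n) (t : ℝ), 0 < x ln → 0 < t →
      ∫⁻ y, ∫⁻ τ, ENNReal.ofReal (gk ln b c x y τ t) ∂(betaM b) ∂(mub n ln b) ≤
        ENNReal.ofReal C := by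
  obtain ⟨C, hC, h⟩ := exists_weight_mul_integral_le n hb hc
  have hP := isProbabilityMeasure_betaM hb
  refine ⟨C * (2 * Real.pi / c) ^ (n / 2 : ℝ), by positivity, fun ln x t hx ht => ?_⟩
  have hInt : Integrable (fun y : Eu n =>
      C * (t ^ (-(n / 2 : ℝ)) * Real.exp (-(c / (2 * t) * ‖x - y‖ ^ 2)))) := by
    have := (GaussianFourier.integrable_cexp_neg_mul_sq_norm_add (V := Eu n) (b := (c / (2 * t) : ℝ))
      (by rw [Complex.ofReal_re]; positivity) 0 0).norm
    have h2 : Integrable (fun v : Eu n => Real.exp (-(c / (2 * t) * ‖v‖ ^ 2))) := by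
      refine this.congr (ae_of_all _ fun v => ?_)
      simp only [inner_zero_left, Complex.ofReal_zero, mul_zero, add_zero, Complex.norm_exp]
      norm_cast
      simp
    exact ((h2.comp_sub_left x).const_mul _).const_mul C
  rw [lintegral_mub]
  calc _ ≤ ∫⁻ y in upper ln, ENNReal.ofReal
        (C * (t ^ (-(n / 2 : ℝ)) * Real.exp (-(c / (2 * t) * ‖x - y‖ ^ 2)))) := by
        apply setLIntegral_mono' (measurableSet_upper ln)
        intro y hy
        have hy : 0 < y ln := hy
        rw [← ofReal_integral_eq_lintegral_ofReal, ← ENNReal.ofReal_mul (by positivity)]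
        · exact ENNReal.ofReal_le_ofReal (h ln x y t hx hy ht)
        · refine Integrable.of_bound ?_ (C := t ^ (-((n + b) / 2))) ?_
          · have : Measurable (fun τ => gk ln b c x y τ t) :=
              (measurable_gk ln b c).comp (f := fun τ => (((x, y), τ), t)) (by fun_prop)
            exact this.aestronglyMeasurable
          · filter_upwards [betaM_ae b] with τ hτ
            rw [Real.norm_of_nonneg (gk_nonneg ln b c x y τ ht.le)]
            exact gk_le ln hc.le hx.le hy.le hτ.1.le ht
        · exact ae_of_all _ fun τ => gk_nonneg ln b c x y τ ht.le
    _ ≤ ∫⁻ y, ENNReal.ofReal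
        (C * (t ^ (-(n / 2 : ℝ)) * Real.exp (-(c / (2 * t) * ‖x - y‖ ^ 2)))) :=
        setLIntegral_le_lintegral _ _
    _ = ENNReal.ofReal (∫ y : Eu n,
        C * (t ^ (-(n / 2 : ℝ)) * Real.exp (-(c / (2 * t) * ‖x - y‖ ^ 2)))) := by
        rw [ofReal_integral_eq_lintegral_ofReal hInt (ae_of_all _ fun y => by positivity)]
    _ = _ := by
        congr 1
        rw [integral_const_mul, integral_const_mul, integral_sub_left_eq_self
          (fun v : Eu n => Real.exp (-(c / (2 * t) * ‖v‖ ^ 2)))]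
        simp_rw [← neg_mul]
        rw [GaussianFourier.integral_rexp_neg_mul_sq_norm (by positivity)]
        simp only [finrank_euclideanSpace, Fintype.card_fin]
        rw [show Real.pi / (c / (2 * t)) = t * (2 * Real.pi / c) by field_simp,
          Real.mul_rpow ht.le (by positivity), Real.rpow_neg ht.le]
        have : (0 : ℝ) < t ^ (n / 2 : ℝ) := by positivity
        field_simp

lemma setLIntegral_gk_le {b c C : ℝ} (hc : 0 ≤ c) {ln : Fin n} {y : Eu n} {t r : ℝ}
    (hy : 0 < y ln) (ht : 0 < t) (hr : 0 ≤ r)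
    (h : ∫⁻ x, ∫⁻ τ, ENNReal.ofReal (gk ln b (c / 2) y x τ t) ∂(betaM b) ∂(mub n ln b) ≤
        ENNReal.ofReal C) :
    ∫⁻ x in {x | 2 * r ≤ ‖x - y‖}, ∫⁻ τ, ENNReal.ofReal (gk ln b c x y τ t) ∂(betaM b)
      ∂(mub n ln b) ≤ ENNReal.ofReal (Real.exp (-(2 * c * (r ^ 2 / t))) * C) := by
  have hm : MeasurableSet {x : Eu n | 2 * r ≤ ‖x - y‖} :=
    measurableSet_le measurable_const (by fun_prop)
  rw [ENNReal.ofReal_mul (Real.exp_pos _).le]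
  refine le_trans ?_ (mul_le_mul_of_nonneg_left h zero_le)
  rw [← lintegral_const_mul']
  swap; · simp
  refine le_trans ?_ (setLIntegral_le_lintegral {x : Eu n | 2 * r ≤ ‖x - y‖} _)
  apply lintegral_mono_ae
  filter_upwards [ae_restrict_mem hm, ae_restrict_of_ae (mub_ae_upper ln b)] with x hx hxn
  rw [← lintegral_const_mul']
  swap; · simp
  apply lintegral_mono_ae
  filter_upwards [betaM_ae b] with τ hτ
  rw [← ENNReal.ofReal_mul (Real.exp_pos _).le]
  apply ENNReal.ofReal_le_ofReal
  rw [gk_comm ln b (c / 2), gk, gk, mul_left_comm, ← Real.exp_add]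
  have hx : 2 * r ≤ ‖x - y‖ := hx
  have h1 : (2 * r) ^ 2 ≤ Aq ln x y τ := le_trans (by gcongr)
    (norm_sub_sq_le_Aq hxn.le hy.le hτ.1.le)
  gcongr
  rw [← neg_add, neg_le_neg_iff]
  have : 2 * c * (r ^ 2 / t) = c / 2 * (2 * r) ^ 2 / t := by ring
  rw [this]
  calc c / 2 * (2 * r) ^ 2 / t + c / 2 * Aq ln x y τ / t
      ≤ c / 2 * Aq ln x y τ / t + c / 2 * Aq ln x y τ / t := by gcongr
    _ = _ := by ring

lemma lintegral_scale_le {m r : ℝ} (hm : 0 < m) (hr : 0 < r) :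
    ∫⁻ t in Set.Ioi (0 : ℝ), ENNReal.ofReal (r / (t * √t) * Real.exp (-(m * (r ^ 2 / t)))) ≤
      ENNReal.ofReal (2 / m + 2) := by
  have hr2 : 0 < r ^ 2 := by positivity
  rw [← Set.Ioc_union_Ioi_eq_Ioi hr2.le]
  refine (lintegral_union_le _ _ _).trans ?_
  rw [ENNReal.ofReal_add (by positivity) (by norm_num)]
  apply add_le_add
  · calc _ ≤ ∫⁻ t in Set.Ioc 0 (r ^ 2), ENNReal.ofReal (1 / (m * r) * t ^ (-(1 / 2) : ℝ)) := by
          apply setLIntegral_mono' measurableSet_Ioc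
          intro t ht
          apply ENNReal.ofReal_le_ofReal
          have ht0 : 0 < t := ht.1
          have hs : 0 < √t := Real.sqrt_pos.2 ht0
          have h1 : m * (r ^ 2 / t) * Real.exp (-(m * (r ^ 2 / t))) ≤ 1 := by
            have := Real.add_one_le_exp (m * (r ^ 2 / t))
            rw [Real.exp_neg, ← div_eq_mul_inv, div_le_one (Real.exp_pos _)]
            linarith
          rw [Real.rpow_neg ht0.le, ← Real.sqrt_eq_rpow]
          calc _ = 1 / (m * r) * (√t)⁻¹ * (m * (r ^ 2 / t) * Real.exp (-(m * (r ^ 2 / t)))) := by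
                field_simp
            _ ≤ 1 / (m * r) * (√t)⁻¹ * 1 := by gcongr
            _ = _ := by ring
      _ = ENNReal.ofReal (∫ t in Set.Ioc 0 (r ^ 2), 1 / (m * r) * t ^ (-(1 / 2) : ℝ)) := by
          rw [ofReal_integral_eq_lintegral_ofReal]
          · have := (intervalIntegral.intervalIntegrable_rpow' (a := 0) (b := r ^ 2)
              (r := (-(1 / 2) : ℝ)) (by norm_num)).const_mul (1 / (m * r))
            rwa [intervalIntegrable_iff_integrableOn_Ioc_of_le hr2.le] at this
          · filter_upwards [ae_restrict_mem measurableSet_Ioc] with t ht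
            have := ht.1
            simp only [Pi.zero_apply]
            positivity
      _ ≤ _ := by
          apply ENNReal.ofReal_le_ofReal
          rw [← intervalIntegral.integral_of_le hr2.le, intervalIntegral.integral_const_mul,
            integral_rpow (Or.inl (by norm_num))]
          norm_num
          rw [← Real.sqrt_eq_rpow, Real.sqrt_sq hr.le]
          apply le_of_eq; field_simp
  · calc _ ≤ ∫⁻ t in Set.Ioi (r ^ 2), ENNReal.ofReal (r * t ^ (-(3 / 2) : ℝ)) := by
          apply setLIntegral_mono' measurableSet_Ioi
          intro t ht
          apply ENNReal.ofReal_le_ofReal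
          have ht0 : 0 < t := hr2.trans ht
          have h2 : t ^ (-(3 / 2) : ℝ) = 1 / (t * √t) := by
            rw [Real.rpow_neg ht0.le, show (3 / 2 : ℝ) = 1 + 1 / 2 by norm_num,
              Real.rpow_add ht0, Real.rpow_one, ← Real.sqrt_eq_rpow, one_div]
          rw [h2, mul_one_div]
          apply mul_le_of_le_one_right
          · have := Real.sqrt_nonneg t
            positivity
          · apply Real.exp_le_one_iff.2
            have : 0 ≤ m * (r ^ 2 / t) := by positivity
            linarith
      _ = ENNReal.ofReal (∫ t in Set.Ioi (r ^ 2), r * t ^ (-(3 / 2) : ℝ)) := by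
          rw [ofReal_integral_eq_lintegral_ofReal]
          · exact (integrableOn_Ioi_rpow_of_lt (by norm_num) hr2).const_mul r
          · filter_upwards [ae_restrict_mem measurableSet_Ioi] with t ht
            have : 0 < t := hr2.trans ht
            simp only [Pi.zero_apply]
            positivity
      _ ≤ _ := by
          apply ENNReal.ofReal_le_ofReal
          rw [integral_const_mul, integral_Ioi_rpow_of_lt (by norm_num) hr2]
          norm_num
          rw [show (-(1 / 2) : ℝ) = -(1 / 2 : ℝ) by norm_num, Real.rpow_neg hr2.le,
            ← Real.sqrt_eq_rpow, Real.sqrt_sq hr.le]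
          apply le_of_eq; field_simp

/-- Hörmander's condition for the kernels `ker`, with the time and beta variables integrated
in absolute value. -/
lemma exists_hormander (n : ℕ) {b : ℝ} (hb : 0 < b) (κ c : ℝ) :
    ∃ C > 0, ∀ (ln : Fin n) (i j : Option (Fin n)) (y y' : Eu n) (r : ℝ), 0 < y ln → 0 < r →
      ‖y - y'‖ ≤ r →
      ∫⁻ x in {x | 2 * r ≤ ‖x - y‖}, ∫⁻ τ, (∫⁻ t in Set.Ioi (0 : ℝ),
        ENNReal.ofReal |ker ln b κ c i j x y τ t - ker ln b κ c i j x y' τ t|) ∂(betaM b)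
        ∂(mub n ln b) ≤ ENNReal.ofReal C := by
  obtain ⟨C, hC, h⟩ := exists_lintegral_gk_le n hb (c := 1 / 32 / 2) (by norm_num)
  set L := 1000 * (|κ| + |c|) with hL
  have hL0 : 0 ≤ L := by positivity
  refine ⟨L * C * (2 / (2 * (1 / 32)) + 2) + 1, by positivity,
    fun ln i j y y' r hy hr hyy => ?_⟩
  have hm : MeasurableSet {x : Eu n | 2 * r ≤ ‖x - y‖} :=
    measurableSet_le measurable_const (by fun_prop)
  have hgm : Measurable (fun p : (Eu n × ℝ) × ℝ => gk ln b (1 / 32) p.1.1 y p.1.2 p.2) :=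
    (measurable_gk ln b _).comp (f := fun p : (Eu n × ℝ) × ℝ => (((p.1.1, y), p.1.2), p.2))
      (by fun_prop)
  calc _ ≤ ∫⁻ x in {x | 2 * r ≤ ‖x - y‖}, ∫⁻ τ, (∫⁻ t in Set.Ioi (0 : ℝ),
        ENNReal.ofReal (L * (r / (t * √t))) * ENNReal.ofReal (gk ln b (1 / 32) x y τ t))
          ∂(betaM b) ∂(mub n ln b) := by
        apply lintegral_mono_ae
        filter_upwards [ae_restrict_mem hm, ae_restrict_of_ae (mub_ae_upper ln b)] with x hx hxn
        apply lintegral_mono_ae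
        filter_upwards [betaM_ae b] with τ hτ
        apply setLIntegral_mono' measurableSet_Ioi
        intro t ht
        have ht : 0 < t := ht
        rw [← ENNReal.ofReal_mul (by have := Real.sqrt_nonneg t; positivity)]
        exact ENNReal.ofReal_le_ofReal
          (abs_ker_sub_le ln b κ c i j hxn.le hy.le hτ.1.le hτ.2.le ht hyy hx)
    _ = ∫⁻ t in Set.Ioi (0 : ℝ), ENNReal.ofReal (L * (r / (t * √t))) *
          ∫⁻ x in {x | 2 * r ≤ ‖x - y‖}, ∫⁻ τ, ENNReal.ofReal (gk ln b (1 / 32) x y τ t)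
          ∂(betaM b) ∂(mub n ln b) := by
        simp_rw [← lintegral_const_mul' _ _ ENNReal.ofReal_ne_top]
        have e1 : ∀ x, ∫⁻ τ, (∫⁻ t in Set.Ioi (0 : ℝ),
            ENNReal.ofReal (L * (r / (t * √t))) * ENNReal.ofReal (gk ln b (1 / 32) x y τ t))
            ∂(betaM b) = ∫⁻ t in Set.Ioi (0 : ℝ), ∫⁻ τ,
            ENNReal.ofReal (L * (r / (t * √t))) * ENNReal.ofReal (gk ln b (1 / 32) x y τ t)
            ∂(betaM b) := fun x => by
          apply lintegral_lintegral_swap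
          have : Measurable (fun p : ℝ × ℝ => gk ln b (1 / 32) x y p.1 p.2) :=
            hgm.comp (f := fun p : ℝ × ℝ => ((x, p.1), p.2)) (by fun_prop)
          unfold Function.uncurry
          apply Measurable.aemeasurable
          fun_prop
        simp_rw [e1]
        apply lintegral_lintegral_swap
        apply Measurable.aemeasurable
        unfold Function.uncurry
        apply Measurable.lintegral_prod_right'
          (f := fun q : (Eu n × ℝ) × ℝ => ENNReal.ofReal (L * (r / (q.1.2 * √q.1.2))) *
            ENNReal.ofReal (gk ln b (1 / 32) q.1.1 y q.2 q.1.2))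
        have : Measurable (fun q : (Eu n × ℝ) × ℝ => gk ln b (1 / 32) q.1.1 y q.2 q.1.2) :=
          hgm.comp (f := fun q : (Eu n × ℝ) × ℝ => ((q.1.1, q.2), q.1.2)) (by fun_prop)
        fun_prop
    _ ≤ ∫⁻ t in Set.Ioi (0 : ℝ), ENNReal.ofReal (L * C) *
          ENNReal.ofReal (r / (t * √t) * Real.exp (-(2 * (1 / 32) * (r ^ 2 / t)))) := by
        apply setLIntegral_mono' measurableSet_Ioi
        intro t ht
        have ht : 0 < t := ht
        have hs := Real.sqrt_nonneg t
        refine (mul_le_mul_of_nonneg_left (setLIntegral_gk_le (by norm_num) hy ht hr.le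
          (h ln y t hy ht)) zero_le).trans (le_of_eq ?_)
        rw [← ENNReal.ofReal_mul (by positivity), ← ENNReal.ofReal_mul (by positivity)]
        congr 1; ring
    _ ≤ _ := by
        rw [lintegral_const_mul' _ _ ENNReal.ofReal_ne_top]
        refine (mul_le_mul_of_nonneg_left (lintegral_scale_le (by norm_num) hr)
          zero_le).trans ?_
        rw [← ENNReal.ofReal_mul (by positivity)]
        exact ENNReal.ofReal_le_ofReal (by linarith)

end Horiuchi

namespace Horiuchi

variable {n : ℕ}

section Gaussian

variable {Ω : Type*} [MeasurableSpace Ω] (ν : Measure Ω) (q : Ω → ℝ) (ζ : Ω → Eu n)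

/-- A superposition of Gaussians. -/
def gaussSum (a : Ω → ℝ) (x : Eu n) : ℝ :=
  ∫ ω, a ω * Real.exp (-(q ω * ‖x‖ ^ 2) + inner ℝ (ζ ω) x) ∂ν

/-- Amplitudes for which the parameters of `gaussSum` stay in a compact range. -/
structure Amplitude (a : Ω → ℝ) : Prop where
  integrable : Integrable a ν
  bounds : ∃ q₀ q₁ Z : ℝ, 0 < q₀ ∧ 0 ≤ Z ∧
    ∀ᵐ ω ∂ν, a ω ≠ 0 → q₀ ≤ q ω ∧ q ω ≤ q₁ ∧ ‖ζ ω‖ ≤ Z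

variable {ν q ζ}

lemma Amplitude.mul_of_bounded {a m : Ω → ℝ} (ha : Amplitude ν q ζ a) (hm : Measurable m) {B : ℝ}
    (hB : ∀ᵐ ω ∂ν, a ω ≠ 0 → |m ω| ≤ B) : Amplitude ν q ζ (fun ω => m ω * a ω) := by
  refine ⟨?_, ?_⟩
  · refine Integrable.mono' (ha.integrable.norm.const_mul B)
      (hm.aestronglyMeasurable.mul ha.integrable.aestronglyMeasurable) ?_
    filter_upwards [hB] with ω hω
    rw [norm_mul, Real.norm_eq_abs (m ω)]
    by_cases h : a ω = 0
    · simp [h]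
    · exact mul_le_mul_of_nonneg_right (hω h) (norm_nonneg _)
  · obtain ⟨q₀, q₁, Z, h0, hZ, h⟩ := ha.bounds
    refine ⟨q₀, q₁, Z, h0, hZ, ?_⟩
    filter_upwards [h] with ω hω hne
    exact hω (right_ne_zero_of_mul hne)

lemma Amplitude.q_mul {a : Ω → ℝ} (ha : Amplitude ν q ζ a) (hq : Measurable q) :
    Amplitude ν q ζ (fun ω => q ω * a ω) := by
  obtain ⟨q₀, q₁, Z, h0, hZ, h⟩ := ha.bounds
  refine ha.mul_of_bounded hq (B := q₁) ?_
  filter_upwards [h] with ω hω hne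
  obtain ⟨h1, h2, h3⟩ := hω hne
  rwa [abs_of_pos (h0.trans_le h1)]

lemma abs_coord_le (x : Eu n) (i : Fin n) : |x i| ≤ ‖x‖ := by
  simpa using PiLp.norm_apply_le x i

lemma Amplitude.coord_mul {a : Ω → ℝ} (ha : Amplitude ν q ζ a) (hζ : Measurable ζ) (i : Fin n) :
    Amplitude ν q ζ (fun ω => ζ ω i * a ω) := by
  obtain ⟨q₀, q₁, Z, h0, hZ, h⟩ := ha.bounds
  refine ha.mul_of_bounded (by fun_prop) (B := Z) ?_
  filter_upwards [h] with ω hω hne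
  exact (abs_coord_le _ _).trans (hω hne).2.2

lemma Amplitude.ae_norm_le {a : Ω → ℝ} (ha : Amplitude ν q ζ a) :
    ∃ K c : ℝ, 0 < K ∧ 0 < c ∧ ∀ᵐ ω ∂ν, ∀ x : Eu n,
      ‖a ω * Real.exp (-(q ω * ‖x‖ ^ 2) + inner ℝ (ζ ω) x)‖ ≤
        ‖a ω‖ * (K * Real.exp (-(c * ‖x‖ ^ 2))) := by
  obtain ⟨q₀, q₁, Z, h0, hZ, h⟩ := ha.bounds
  refine ⟨Real.exp (Z ^ 2 / (2 * q₀)), q₀ / 2, Real.exp_pos _, by positivity, ?_⟩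
  filter_upwards [h] with ω hω x
  rw [norm_mul, Real.norm_of_nonneg (Real.exp_pos _).le]
  by_cases hne : a ω = 0
  · simp [hne]
  obtain ⟨h1, h2, h3⟩ := hω hne
  refine mul_le_mul_of_nonneg_left ?_ (norm_nonneg _)
  rw [← Real.exp_add]
  apply Real.exp_le_exp.2
  have hin : inner ℝ (ζ ω) x ≤ Z * ‖x‖ :=
    (real_inner_le_norm _ _).trans (by gcongr)
  have h4 : q₀ * ‖x‖ ^ 2 ≤ q ω * ‖x‖ ^ 2 := by gcongr
  have h5 : Z * ‖x‖ ≤ Z ^ 2 / (2 * q₀) + q₀ / 2 * ‖x‖ ^ 2 := by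
    have : Z ^ 2 / (2 * q₀) + q₀ / 2 * ‖x‖ ^ 2 - Z * ‖x‖ = (Z - q₀ * ‖x‖) ^ 2 / (2 * q₀) := by
      field_simp; ring
    have h6 : 0 ≤ (Z - q₀ * ‖x‖) ^ 2 / (2 * q₀) := by positivity
    linarith
  linarith

lemma Amplitude.integrable_mul_exp {a : Ω → ℝ} (ha : Amplitude ν q ζ a) (hq : Measurable q)
    (hζ : Measurable ζ) (x : Eu n) :
    Integrable (fun ω => a ω * Real.exp (-(q ω * ‖x‖ ^ 2) + inner ℝ (ζ ω) x)) ν := by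
  obtain ⟨K, c, hK, hc, h⟩ := ha.ae_norm_le
  refine Integrable.mono' (ha.integrable.norm.mul_const (K * Real.exp (-(c * ‖x‖ ^ 2))))
    (ha.integrable.aestronglyMeasurable.mul
      (Measurable.aestronglyMeasurable (by fun_prop))) ?_
  filter_upwards [h] with ω hω using hω x

lemma Amplitude.hasFDerivAt {a : Ω → ℝ} (ha : Amplitude ν q ζ a) (hq : Measurable q)
    (hζ : Measurable ζ) (x : Eu n) :
    ∃ L : Eu n →L[ℝ] ℝ, HasFDerivAt (gaussSum ν q ζ a) L x ∧
      ∀ j, L (EuclideanSpace.single j 1) = gaussSum ν q ζ (fun ω => ζ ω j * a ω) x +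
        -2 * (x j * gaussSum ν q ζ (fun ω => q ω * a ω) x) := by
  obtain ⟨K, c, hK, hc, h⟩ := ha.ae_norm_le
  obtain ⟨q₀, q₁, Z, h0, hZ, hb⟩ := ha.bounds
  set F' : Eu n → Ω → (Eu n →L[ℝ] ℝ) := fun x ω =>
    (a ω * Real.exp (-(q ω * ‖x‖ ^ 2) + inner ℝ (ζ ω) x)) •
      (innerSL ℝ (ζ ω) - (2 * q ω) • innerSL ℝ x) with hF'
  have hF'm : AEStronglyMeasurable (F' x) ν := by
    have h1 := (ha.integrable_mul_exp hq hζ x).aestronglyMeasurable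
    have h2 : Measurable (fun ω => innerSL ℝ (ζ ω) - (2 * q ω) • innerSL ℝ x : Ω → (Eu n →L[ℝ] ℝ)) := by
      have := (innerSL ℝ (E := Eu n)).continuous.measurable.comp hζ
      exact this.sub ((hq.const_mul 2).smul_const _)
    exact h1.smul h2.aestronglyMeasurable
  have hbound : ∀ᵐ ω ∂ν, ∀ z ∈ Metric.ball x 1,
      ‖F' z ω‖ ≤ ‖a ω‖ * (K * (Z + 2 * q₁ * (‖x‖ + 1))) := by
    filter_upwards [h, hb] with ω hω hbω z hz
    by_cases hne : a ω = 0
    · simp [hF', hne]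
    obtain ⟨h1, h2, h3⟩ := hbω hne
    have hzn : ‖z‖ ≤ ‖x‖ + 1 := by
      have := norm_le_norm_add_norm_sub' z x
      rw [Metric.mem_ball, dist_eq_norm] at hz
      linarith
    have hq0 : 0 < q ω := h0.trans_le h1
    have hq1 : 0 ≤ q₁ := hq0.le.trans h2
    have hn : ‖innerSL ℝ (ζ ω) - (2 * q ω) • innerSL ℝ z‖ ≤ Z + 2 * q₁ * (‖x‖ + 1) := by
      refine (norm_sub_le _ _).trans ?_
      rw [norm_smul, innerSL_apply_norm, innerSL_apply_norm, Real.norm_of_nonneg (by positivity)]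
      gcongr
    simp only [hF', norm_smul]
    calc _ ≤ ‖a ω‖ * (K * 1) * (Z + 2 * q₁ * (‖x‖ + 1)) := by
          refine mul_le_mul ((hω z).trans ?_) hn (norm_nonneg _) (by positivity)
          gcongr
          exact Real.exp_le_one_iff.2 (by have : 0 ≤ c * ‖z‖ ^ 2 := by positivity
                                          linarith)
      _ = _ := by ring
  have key := hasFDerivAt_integral_of_dominated_of_fderiv_le (𝕜 := ℝ) (μ := ν)
    (F := fun x ω => a ω * Real.exp (-(q ω * ‖x‖ ^ 2) + inner ℝ (ζ ω) x)) (F' := F') (x₀ := x)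
    (bound := fun ω => ‖a ω‖ * (K * (Z + 2 * q₁ * (‖x‖ + 1)))) (Metric.ball_mem_nhds x one_pos)
    (Filter.Eventually.of_forall fun z => (ha.integrable_mul_exp hq hζ z).aestronglyMeasurable)
    (ha.integrable_mul_exp hq hζ x) hF'm hbound (ha.integrable.norm.mul_const _)
    (ae_of_all _ fun ω z _ => by
      have h1 : HasFDerivAt (fun z : Eu n => ‖z‖ ^ 2) (2 • innerSL ℝ z) z := by
        simpa using (hasStrictFDerivAt_norm_sq z).hasFDerivAt
      have h2 : HasFDerivAt (fun z : Eu n => inner ℝ (ζ ω) z) (innerSL ℝ (ζ ω)) z :=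
        (innerSL ℝ (ζ ω)).hasFDerivAt
      refine (((((h1.const_mul (q ω)).neg).add h2).exp).const_mul (a ω)).congr_fderiv ?_
      ext w
      simp [hF']
      ring)
  refine ⟨_, key, fun j => ?_⟩
  have hF'i : Integrable (F' x) ν := by
    refine Integrable.mono' (ha.integrable.norm.mul_const (K * (Z + 2 * q₁ * (‖x‖ + 1)))) hF'm ?_
    filter_upwards [hbound] with ω hω using hω x (Metric.mem_ball_self one_pos)
  rw [ContinuousLinearMap.integral_apply hF'i, gaussSum, gaussSum, ← integral_const_mul,
    ← integral_const_mul, ← integral_add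
      ((ha.coord_mul hζ j).integrable_mul_exp hq hζ x)
      ((((ha.q_mul hq).integrable_mul_exp hq hζ x).const_mul _).const_mul _)]
  congr 1; ext ω
  simp [hF', EuclideanSpace.inner_single_right]
  ring

variable (ν q ζ)

/-- The algebra generated by superpositions of Gaussians and multiplication by coordinates. -/
inductive Nice : (Eu n → ℝ) → Prop
  | base (a : Ω → ℝ) (ha : Amplitude ν q ζ a) : Nice (gaussSum ν q ζ a)
  | const_mul (c : ℝ) (φ : Eu n → ℝ) (hφ : Nice φ) : Nice (fun x => c * φ x)
  | coord_mul (i : Fin n) (φ : Eu n → ℝ) (hφ : Nice φ) : Nice (fun x => x i * φ x)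
  | add (φ ψ : Eu n → ℝ) (hφ : Nice φ) (hψ : Nice ψ) : Nice (fun x => φ x + ψ x)
  | mul (φ ψ : Eu n → ℝ) (hφ : Nice φ) (hψ : Nice ψ) : Nice (fun x => φ x * ψ x)


/-- Gaussian decay. -/
def GaussDecay (φ : Eu n → ℝ) : Prop :=
  ∃ K c : ℝ, 0 < K ∧ 0 < c ∧ ∀ x, |φ x| ≤ K * Real.exp (-(c * ‖x‖ ^ 2))

variable {ν q ζ}

lemma GaussDecay.const_mul {φ : Eu n → ℝ} (h : GaussDecay φ) (c : ℝ) :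
    GaussDecay (fun x => c * φ x) := by
  obtain ⟨K, d, hK, hd, h⟩ := h
  refine ⟨(|c| + 1) * K, d, by positivity, hd, fun x => ?_⟩
  rw [abs_mul, mul_assoc]
  exact mul_le_mul (by linarith) (h x) (abs_nonneg _) (by positivity)

lemma GaussDecay.coord_mul {φ : Eu n → ℝ} (h : GaussDecay φ) (i : Fin n) :
    GaussDecay (fun x => x i * φ x) := by
  obtain ⟨K, d, hK, hd, h⟩ := h
  have hC : 0 < (1 / 2 / (d / 2)) ^ (1 / 2 : ℝ) := by positivity
  refine ⟨(1 / 2 / (d / 2)) ^ (1 / 2 : ℝ) * K, d / 2, by positivity, by positivity, fun x => ?_⟩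
  have h1 := rpow_mul_exp_neg_le (p := 1 / 2) (c := d / 2) (z := ‖x‖ ^ 2) (by norm_num)
    (by positivity) (by positivity)
  rw [← Real.sqrt_eq_rpow, Real.sqrt_sq (norm_nonneg _)] at h1
  rw [abs_mul]
  calc |x i| * |φ x| ≤ ‖x‖ * (K * Real.exp (-(d * ‖x‖ ^ 2))) :=
        mul_le_mul (abs_coord_le x i) (h x) (abs_nonneg _) (norm_nonneg _)
    _ = K * Real.exp (-(d / 2 * ‖x‖ ^ 2)) * (‖x‖ * Real.exp (-(d / 2 * ‖x‖ ^ 2))) := by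
        rw [show -(d * ‖x‖ ^ 2) = -(d / 2 * ‖x‖ ^ 2) + -(d / 2 * ‖x‖ ^ 2) by ring, Real.exp_add]
        ring
    _ ≤ K * Real.exp (-(d / 2 * ‖x‖ ^ 2)) * (1 / 2 / (d / 2)) ^ (1 / 2 : ℝ) := by gcongr
    _ = _ := by ring

lemma GaussDecay.add {φ ψ : Eu n → ℝ} (h : GaussDecay φ) (h' : GaussDecay ψ) :
    GaussDecay (fun x => φ x + ψ x) := by
  obtain ⟨K, d, hK, hd, h⟩ := h
  obtain ⟨K', d', hK', hd', h'⟩ := h'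
  refine ⟨K + K', min d d', by positivity, lt_min hd hd', fun x => ?_⟩
  refine (abs_add_le _ _).trans ?_
  rw [add_mul]
  refine add_le_add ((h x).trans ?_) ((h' x).trans ?_) <;> gcongr
  exacts [min_le_left _ _, min_le_right _ _]

lemma GaussDecay.mul {φ ψ : Eu n → ℝ} (h : GaussDecay φ) (h' : GaussDecay ψ) :
    GaussDecay (fun x => φ x * ψ x) := by
  obtain ⟨K, d, hK, hd, h⟩ := h
  obtain ⟨K', d', hK', hd', h'⟩ := h'
  refine ⟨K * K', d + d', by positivity, by positivity, fun x => ?_⟩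
  rw [abs_mul]
  refine (mul_le_mul (h x) (h' x) (abs_nonneg _) (by positivity)).trans (le_of_eq ?_)
  rw [add_mul, neg_add, Real.exp_add]; ring

lemma Nice.decay {φ : Eu n → ℝ} (h : Nice ν q ζ φ) : GaussDecay φ := by
  induction h with
  | base a ha =>
    obtain ⟨K, c, hK, hc, h⟩ := ha.ae_norm_le
    refine ⟨(∫ ω, ‖a ω‖ ∂ν + 1) * K, c, ?_, hc, fun x => ?_⟩
    · have : 0 ≤ ∫ ω, ‖a ω‖ ∂ν := integral_nonneg fun _ => norm_nonneg _
      positivity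
    rw [gaussSum, ← Real.norm_eq_abs]
    refine (norm_integral_le_integral_norm _).trans ?_
    calc _ ≤ ∫ ω, ‖a ω‖ * (K * Real.exp (-(c * ‖x‖ ^ 2))) ∂ν := by
          apply integral_mono_of_nonneg (ae_of_all _ fun _ => norm_nonneg _)
            (ha.integrable.norm.mul_const _)
          filter_upwards [h] with ω hω using hω x
      _ ≤ _ := by
          rw [integral_mul_const, mul_assoc]
          gcongr
          linarith
  | const_mul c φ _ ih => exact ih.const_mul c
  | coord_mul i φ _ ih => exact ih.coord_mul i
  | add φ ψ _ _ ih ih' => exact ih.add ih'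
  | mul φ ψ _ _ ih ih' => exact ih.mul ih'

lemma Nice.differentiable {φ : Eu n → ℝ} (h : Nice ν q ζ φ) (hq : Measurable q)
    (hζ : Measurable ζ) : Differentiable ℝ φ := by
  induction h with
  | base a ha =>
    intro x
    obtain ⟨L, hL, _⟩ := ha.hasFDerivAt hq hζ x
    exact hL.differentiableAt
  | const_mul c φ _ ih => exact ih.const_mul c
  | coord_mul i φ _ ih =>
    exact (by fun_prop : Differentiable ℝ (fun x : Eu n => x i)).mul ih
  | add φ ψ _ _ ih ih' => exact ih.add ih'
  | mul φ ψ _ _ ih ih' => exact ih.mul ih'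

lemma pd_const_mul (c : ℝ) {φ : Eu n → ℝ} (h : Differentiable ℝ φ) (j : Fin n) :
    pd (fun x => c * φ x) j = fun x => c * pd φ j x := by
  ext x
  rw [pd, ((h x).hasFDerivAt.const_mul c).fderiv]; rfl

lemma pd_add {φ ψ : Eu n → ℝ} (h : Differentiable ℝ φ) (h' : Differentiable ℝ ψ) (j : Fin n) :
    pd (fun x => φ x + ψ x) j = fun x => pd φ j x + pd ψ j x := by
  ext x
  rw [pd, fderiv_fun_add (h x) (h' x)]; rfl

lemma pd_mul {φ ψ : Eu n → ℝ} (h : Differentiable ℝ φ) (h' : Differentiable ℝ ψ) (j : Fin n) :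
    pd (fun x => φ x * ψ x) j = fun x => φ x * pd ψ j x + ψ x * pd φ j x := by
  ext x
  rw [pd, fderiv_fun_mul (h x) (h' x)]; rfl

lemma pd_coord (i j : Fin n) : pd (fun x : Eu n => x i) j = fun _ => if i = j then 1 else 0 := by
  ext x
  have h : HasFDerivAt (fun x : Eu n => x i) (EuclideanSpace.proj (𝕜 := ℝ) i) x :=
    (EuclideanSpace.proj (𝕜 := ℝ) i).hasFDerivAt
  rw [pd, h.fderiv]
  simp

lemma pd_coord_mul (i : Fin n) {φ : Eu n → ℝ} (h : Differentiable ℝ φ) (j : Fin n) :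
    pd (fun x => x i * φ x) j = fun x => x i * pd φ j x + φ x * if i = j then 1 else 0 := by
  rw [pd_mul (by fun_prop) h, pd_coord]

lemma pd_gaussSum {a : Ω → ℝ} (ha : Amplitude ν q ζ a) (hq : Measurable q) (hζ : Measurable ζ)
    (j : Fin n) : pd (gaussSum ν q ζ a) j = fun x => gaussSum ν q ζ (fun ω => ζ ω j * a ω) x +
        -2 * (x j * gaussSum ν q ζ (fun ω => q ω * a ω) x) := by
  ext x
  obtain ⟨L, hL, h⟩ := ha.hasFDerivAt hq hζ x
  rw [pd, hL.fderiv, h]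

lemma Nice.pd {φ : Eu n → ℝ} (h : Nice ν q ζ φ) (hq : Measurable q)
    (hζ : Measurable ζ) (j : Fin n) : Nice ν q ζ (pd φ j) := by
  induction h with
  | base a ha =>
    rw [pd_gaussSum ha hq hζ]
    exact .add _ _ (.base _ (ha.coord_mul hζ j))
      (.const_mul _ _ (.coord_mul _ _ (.base _ (ha.q_mul hq))))
  | const_mul c φ h ih =>
    rw [pd_const_mul c (h.differentiable hq hζ)]
    exact .const_mul _ _ ih
  | coord_mul i φ h ih =>
    rw [pd_coord_mul i (h.differentiable hq hζ)]
    have : Nice ν q ζ (fun x => φ x * if i = j then 1 else 0) := by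
      simp_rw [mul_comm (φ _)]
      exact .const_mul _ _ h
    exact .add _ _ (.coord_mul _ _ ih) this
  | add φ ψ h h' ih ih' =>
    rw [pd_add (h.differentiable hq hζ) (h'.differentiable hq hζ)]
    exact .add _ _ ih ih'
  | mul φ ψ h h' ih ih' =>
    rw [pd_mul (h.differentiable hq hζ) (h'.differentiable hq hζ)]
    exact .add _ _ (.mul _ _ h ih') (.mul _ _ h' ih)

lemma fderiv_eq_sum_pd (φ : Eu n → ℝ) (x : Eu n) :
    fderiv ℝ φ x = ∑ i, _root_.pd φ i x • (EuclideanSpace.proj (𝕜 := ℝ) i : Eu n →L[ℝ] ℝ) := by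
  apply ContinuousLinearMap.coe_injective
  apply (EuclideanSpace.basisFun (Fin n) ℝ).toBasis.ext
  intro i
  simp [_root_.pd]

lemma Nice.pd_comm {φ : Eu n → ℝ} (h : Nice ν q ζ φ) (hq : Measurable q)
    (hζ : Measurable ζ) (i j : Fin n) : _root_.pd (_root_.pd φ i) j = _root_.pd (_root_.pd φ j) i := by
  have hd : Differentiable ℝ (fderiv ℝ φ) := by
    rw [funext (fderiv_eq_sum_pd φ)]
    refine Differentiable.fun_sum fun i _ => ?_
    exact ((h.pd hq hζ i).differentiable hq hζ).smul_const _
  ext x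
  have hs := second_derivative_symmetric (𝕜 := ℝ) (f := φ) (f' := fderiv ℝ φ)
    (f'' := fderiv ℝ (fderiv ℝ φ) x) (x := x)
    (fun y => ((h.differentiable hq hζ) y).hasFDerivAt) (hd x).hasFDerivAt
  have e : ∀ k l : Fin n, _root_.pd (_root_.pd φ k) l x =
      fderiv ℝ (fderiv ℝ φ) x (EuclideanSpace.single l 1) (EuclideanSpace.single k 1) := by
    intro k l
    have := ((hd x).hasFDerivAt.clm_apply (hasFDerivAt_const (EuclideanSpace.single k (1 : ℝ)) x)).fderiv
    unfold _root_.pd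
    rw [this]
    simp
  rw [e, e, hs]

end Gaussian

end Horiuchi

namespace Horiuchi

variable {n : ℕ}

lemma integrable_gaussian (n : ℕ) {c : ℝ} (hc : 0 < c) :
    Integrable (fun v : Eu n => Real.exp (-(c * ‖v‖ ^ 2))) := by
  have := (GaussianFourier.integrable_cexp_neg_mul_sq_norm_add (V := Eu n) (b := (c : ℝ))
    (by rwa [Complex.ofReal_re]) 0 0).norm
  refine this.congr (ae_of_all _ fun v => ?_)
  simp only [inner_zero_left, Complex.ofReal_zero, mul_zero, add_zero, Complex.norm_exp]
  norm_cast
  simp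

lemma GaussDecay.integrable_weight_mul {φ : Eu n → ℝ} (h : GaussDecay φ) (hφ : Continuous φ)
    (ln : Fin n) {p : ℝ} (hp : 0 < p) :
    Integrable (fun x => (max (x ln) 0) ^ p * φ x) := by
  obtain ⟨K, c, hK, hc, h⟩ := h
  have hw : Continuous (fun x : Eu n => (max (x ln) 0) ^ p) :=
    (by fun_prop : Continuous (fun x : Eu n => max (x ln) 0)).rpow_const fun _ => Or.inr hp.le
  have hg := ((integrable_gaussian n (c := c / 2) (by positivity)).const_mul
    ((p / 2 / (c / 2)) ^ (p / 2) * K))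
  refine Integrable.mono' hg (hw.mul hφ).aestronglyMeasurable
    (ae_of_all _ fun x => ?_)
  have h1 := rpow_mul_exp_neg_le (p := p / 2) (c := c / 2) (z := ‖x‖ ^ 2) (by positivity)
    (by positivity) (by positivity)
  have h2 : (‖x‖ ^ 2) ^ (p / 2) = ‖x‖ ^ p := by
    rw [← Real.rpow_natCast, ← Real.rpow_mul (norm_nonneg _)]
    congr 1; push_cast; ring
  rw [h2] at h1
  have hx : max (x ln) 0 ≤ ‖x‖ :=
    max_le ((le_abs_self _).trans (abs_coord_le x ln)) (norm_nonneg _)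
  have h0 : 0 ≤ max (x ln) 0 := le_max_right _ _
  rw [Real.norm_eq_abs, abs_mul, abs_of_nonneg (Real.rpow_nonneg h0 _)]
  calc _ ≤ ‖x‖ ^ p * (K * Real.exp (-(c * ‖x‖ ^ 2))) := by
        gcongr; exact h x
    _ = K * Real.exp (-(c / 2 * ‖x‖ ^ 2)) * (‖x‖ ^ p * Real.exp (-(c / 2 * ‖x‖ ^ 2))) := by
        rw [show -(c * ‖x‖ ^ 2) = -(c / 2 * ‖x‖ ^ 2) + -(c / 2 * ‖x‖ ^ 2) by ring, Real.exp_add]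
        ring
    _ ≤ K * Real.exp (-(c / 2 * ‖x‖ ^ 2)) * (p / 2 / (c / 2)) ^ (p / 2) := by gcongr
    _ = _ := by ring

lemma integral_mub_eq (ln : Fin n) {b : ℝ} (hb : 0 < b) (φ : Eu n → ℝ) :
    ∫ x, φ x ∂(mub n ln b) = ∫ x, (max (x ln) 0) ^ b * φ x := by
  rw [integral_mub, ← integral_indicator (measurableSet_upper ln)]
  congr 1; ext x
  by_cases hx : 0 < x ln
  · rw [Set.indicator_of_mem (show x ∈ upper ln from hx), max_eq_left hx.le]
  · rw [Set.indicator_of_notMem (show x ∉ upper ln from hx), max_eq_right (not_lt.1 hx),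
      Real.zero_rpow hb.ne', zero_mul]

lemma GaussDecay.integrable_mub {φ : Eu n → ℝ} (h : GaussDecay φ) (hφ : Continuous φ)
    (ln : Fin n) {b : ℝ} (hb : 0 < b) : Integrable φ (mub n ln b) := by
  rw [mub_eq, integrable_withDensity_iff_integrable_smul' (measurable_weight ln b) (by simp)]
  refine ((h.integrable_weight_mul hφ ln hb).integrableOn (s := upper ln)).congr ?_
  filter_upwards [ae_restrict_mem (measurableSet_upper ln)] with x hx
  have hx : 0 < x ln := hx
  rw [max_eq_left hx.le, ENNReal.toReal_ofReal (by positivity), smul_eq_mul]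

section IBP

variable {Ω : Type*} [MeasurableSpace Ω] {ν : Measure Ω} {q : Ω → ℝ} {ζ : Ω → Eu n}

lemma Nice.integrable_mub {φ : Eu n → ℝ} (h : Nice ν q ζ φ) (hq : Measurable q)
    (hζ : Measurable ζ) (ln : Fin n) {b : ℝ} (hb : 0 < b) : Integrable φ (mub n ln b) :=
  h.decay.integrable_mub (h.differentiable hq hζ).continuous ln hb

lemma hasLineDerivAt_pd {φ : Eu n → ℝ} (h : Differentiable ℝ φ) (i : Fin n) (x : Eu n) :
    HasLineDerivAt ℝ φ (pd φ i x) x (EuclideanSpace.single i 1) :=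
  (h x).hasFDerivAt.hasLineDerivAt _

lemma Nice.integral_pd_eq_zero {φ : Eu n → ℝ} (h : Nice ν q ζ φ) (hq : Measurable q)
    (hζ : Measurable ζ) {ln i : Fin n} (hi : i ≠ ln) {b : ℝ} (hb : 0 < b) :
    ∫ x, _root_.pd φ i x ∂(mub n ln b) = 0 := by
  rw [integral_mub_eq ln hb]
  have hd := h.differentiable hq hζ
  have hp := h.pd hq hζ i
  have := integral_bilinear_hasLineDerivAt_right_eq_neg_left_of_integrable (μ := volume)
    (f := fun x : Eu n => (max (x ln) 0) ^ b) (f' := fun _ => 0) (g := φ) (g' := _root_.pd φ i)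
    (v := EuclideanSpace.single i 1) (B := ContinuousLinearMap.mul ℝ ℝ)
    (by simp)
    (hp.decay.integrable_weight_mul (hp.differentiable hq hζ).continuous ln hb)
    (h.decay.integrable_weight_mul hd.continuous ln hb)
    (fun x _ => by
      have : (fun t : ℝ => (max ((x + t • EuclideanSpace.single i (1 : ℝ) : Eu n) ln) 0) ^ b) =
          fun _ => (max (x ln) 0) ^ b := by
        ext t
        simp [hi]
      unfold HasLineDerivAt
      rw [this]
      exact hasDerivAt_const _ _)
    (fun x _ => hasLineDerivAt_pd hd i x)
  simpa using this

lemma hasDerivAt_max_rpow {p : ℝ} (hp : 1 < p) (s : ℝ) :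
    HasDerivAt (fun s : ℝ => (max s 0) ^ p) (p * (max s 0) ^ (p - 1)) s := by
  rcases lt_trichotomy s 0 with h | h | h
  · rw [max_eq_right h.le, Real.zero_rpow (by linarith), mul_zero]
    refine (hasDerivAt_const s (0 : ℝ)).congr_of_eventuallyEq ?_
    filter_upwards [eventually_lt_nhds h] with t ht
    rw [max_eq_right ht.le, Real.zero_rpow (by linarith)]
  · subst h
    rw [max_self, Real.zero_rpow (by linarith), mul_zero, hasDerivAt_iff_isLittleO_nhds_zero]
    have h1 := (Real.hasDerivAt_rpow_const (x := 0) (p := p) (Or.inr hp.le))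
    rw [Real.zero_rpow (by linarith), mul_zero, hasDerivAt_iff_isLittleO_nhds_zero] at h1
    refine Asymptotics.IsLittleO.trans_isBigO ?_ (Asymptotics.isBigO_refl _ _)
    rw [Asymptotics.isLittleO_iff] at h1 ⊢
    intro c hc
    filter_upwards [h1 hc] with t ht
    rcases le_total t 0 with h | h
    · simp only [zero_add, smul_zero, sub_zero, max_self, max_eq_right h,
        Real.zero_rpow (show p ≠ 0 by linarith), norm_zero]
      positivity
    · simpa [max_eq_left h, Real.zero_rpow (show p ≠ 0 by linarith)] using ht
  · rw [max_eq_left h.le]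
    refine (Real.hasDerivAt_rpow_const (Or.inl h.ne')).congr_of_eventuallyEq ?_
    filter_upwards [eventually_gt_nhds h] with t ht
    rw [max_eq_left ht.le]

lemma Nice.integral_coord_mul_pd {φ : Eu n → ℝ} (h : Nice ν q ζ φ) (hq : Measurable q)
    (hζ : Measurable ζ) (ln : Fin n) {b : ℝ} (hb : 0 < b) :
    ∫ x, x ln * _root_.pd φ ln x ∂(mub n ln b) = -(1 + b) * ∫ x, φ x ∂(mub n ln b) := by
  rw [integral_mub_eq ln hb, integral_mub_eq ln hb]
  have hd := h.differentiable hq hζ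
  have hp := h.pd hq hζ ln
  have key := integral_bilinear_hasLineDerivAt_right_eq_neg_left_of_integrable (μ := volume)
    (f := fun x : Eu n => (max (x ln) 0) ^ (1 + b))
    (f' := fun x => (1 + b) * (max (x ln) 0) ^ b) (g := φ) (g' := _root_.pd φ ln)
    (v := EuclideanSpace.single ln 1) (B := ContinuousLinearMap.mul ℝ ℝ)
    (by
      have := (h.decay.integrable_weight_mul hd.continuous ln hb).const_mul (1 + b)
      simpa [mul_assoc] using this)
    (hp.decay.integrable_weight_mul (hp.differentiable hq hζ).continuous ln (by linarith))
    (h.decay.integrable_weight_mul hd.continuous ln (by linarith))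
    (fun x _ => by
      have h1 := hasDerivAt_max_rpow (p := 1 + b) (by linarith) (x ln)
      rw [add_sub_cancel_left] at h1
      have h2 : HasFDerivAt (fun x : Eu n => x ln) (EuclideanSpace.proj (𝕜 := ℝ) ln) x :=
        (EuclideanSpace.proj (𝕜 := ℝ) ln).hasFDerivAt
      have h3 := (h1.comp_hasFDerivAt x h2).hasLineDerivAt (EuclideanSpace.single ln 1)
      simpa [Function.comp_def] using h3)
    (fun x _ => hasLineDerivAt_pd hd ln x)
  simp only [ContinuousLinearMap.mul_apply', mul_assoc] at key
  rw [integral_const_mul] at key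
  rw [neg_mul, ← key]
  congr 1; ext x
  rcases le_or_gt (x ln) 0 with hx | hx
  · rw [max_eq_right hx, Real.zero_rpow hb.ne', Real.zero_rpow (by linarith)]; simp
  · rw [max_eq_left hx.le, Real.rpow_add hx, Real.rpow_one]; ring

lemma Nice.sub {φ ψ : Eu n → ℝ} (h : Nice ν q ζ φ) (h' : Nice ν q ζ ψ) :
    Nice ν q ζ (fun x => φ x - ψ x) := by
  have := Nice.add _ _ h (.const_mul (-1) _ h')
  simpa [← sub_eq_add_neg] using this

lemma Nice.sq {φ : Eu n → ℝ} (h : Nice ν q ζ φ) : Nice ν q ζ (fun x => φ x ^ 2) := by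
  simp_rw [pow_two]
  exact .mul _ _ h h

/-- Integration by parts in a tangential direction. -/
lemma Nice.integral_mul_pd {φ ψ : Eu n → ℝ} (h : Nice ν q ζ φ) (h' : Nice ν q ζ ψ)
    (hq : Measurable q) (hζ : Measurable ζ) {ln i : Fin n} (hi : i ≠ ln) {b : ℝ} (hb : 0 < b) :
    ∫ x, _root_.pd φ i x * ψ x ∂(mub n ln b) = -∫ x, φ x * _root_.pd ψ i x ∂(mub n ln b) := by
  have := (Nice.mul _ _ h h').integral_pd_eq_zero hq hζ hi hb
  rw [pd_mul (h.differentiable hq hζ) (h'.differentiable hq hζ), integral_add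
    ((Nice.mul _ _ h (h'.pd hq hζ i)).integrable_mub hq hζ ln hb)
    ((Nice.mul _ _ h' (h.pd hq hζ i)).integrable_mub hq hζ ln hb)] at this
  have e : ∀ x, _root_.pd φ i x * ψ x = ψ x * _root_.pd φ i x := fun x => mul_comm _ _
  simp_rw [e]
  linarith

variable {u v : Eu n → ℝ}

lemma integral_tangential_mul (hu : Nice ν q ζ u) (hq : Measurable q) (hζ : Measurable ζ)
    {ln i j : Fin n} (hi : i ≠ ln) (hj : j ≠ ln) {b : ℝ} (hb : 0 < b) :
    ∫ x, pd (pd u i) i x * pd (pd u j) j x ∂(mub n ln b) =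
      ∫ x, (pd (pd u j) i x) ^ 2 ∂(mub n ln b) := by
  have hui := hu.pd hq hζ i
  have huj := hu.pd hq hζ j
  rw [hui.integral_mul_pd (huj.pd hq hζ j) hq hζ hi hb]
  have h2 := hui.integral_mul_pd (hui.pd hq hζ j) hq hζ hj hb
  have h3 : pd (pd (pd u i) j) j = pd (pd (pd u j) j) i := by
    rw [hu.pd_comm hq hζ i j, huj.pd_comm hq hζ i j]
  rw [h3] at h2
  rw [← h2, hu.pd_comm hq hζ i j]
  simp_rw [pow_two]

lemma integral_tangential_mul_normal (hu : Nice ν q ζ u) (hv : Nice ν q ζ v)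
    (hq : Measurable q) (hζ : Measurable ζ) {ln i : Fin n} (hi : i ≠ ln) {b : ℝ} (hb : 0 < b)
    (huv : pd u ln = fun x => x ln * v x) :
    ∫ x, pd (pd u i) i x * (pd (pd u ln) ln x + b * v x) ∂(mub n ln b) =
      ∫ x, (pd (pd u ln) i x) ^ 2 ∂(mub n ln b) := by
  have hui := hu.pd hq hζ i
  have hvi := hv.pd hq hζ i
  have hvd := hv.differentiable hq hζ
  have hvl := hv.pd hq hζ ln
  have hun := hu.pd hq hζ ln
  rw [hui.integral_mul_pd (.add _ _ (hun.pd hq hζ ln) (.const_mul b _ hv)) hq hζ hi hb]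
  have e1 : pd (pd u ln) i = fun x => x ln * pd v i x := by
    rw [huv, pd_coord_mul ln hvd]
    simp [hi.symm]
  have e2 : pd (pd u i) ln = fun x => x ln * pd v i x := by
    rw [hu.pd_comm hq hζ i ln, e1]
  have e3 : pd (fun x => pd (pd u ln) ln x + b * v x) i =
      fun x => x ln * pd (pd v i) ln x + (1 + b) * pd v i x := by
    rw [pd_add ((hun.pd hq hζ ln).differentiable hq hζ) ((Nice.const_mul b _ hv).differentiable hq hζ),
      pd_const_mul b hvd, ← hun.pd_comm hq hζ, e1, pd_coord_mul ln (hvi.differentiable hq hζ)]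
    ext x; simp; ring
  rw [e3, e1]
  have key := (Nice.mul _ _ hui hvi).integral_coord_mul_pd hq hζ ln hb
  rw [pd_mul (hui.differentiable hq hζ) (hvi.differentiable hq hζ), e2] at key
  have i1 := (Nice.mul _ _ hui hvi).integrable_mub hq hζ ln hb
  have i2 := (Nice.mul _ _ hui (.coord_mul ln _ (hvi.pd hq hζ ln))).integrable_mub hq hζ ln hb
  have i3 := (Nice.coord_mul ln _ hvi).sq.integrable_mub hq hζ ln hb
  have f1 : ∫ x, pd u i x * (x ln * pd (pd v i) ln x + (1 + b) * pd v i x) ∂(mub n ln b) =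
      ∫ x, pd u i x * (x ln * pd (pd v i) ln x) ∂(mub n ln b) +
      (1 + b) * ∫ x, pd u i x * pd v i x ∂(mub n ln b) := by
    rw [← integral_const_mul, ← integral_add i2 (i1.const_mul _)]
    congr 1; ext x; ring
  have f2 : ∫ x, x ln * (pd u i x * pd (pd v i) ln x + pd v i x * (x ln * pd v i x))
        ∂(mub n ln b) = ∫ x, pd u i x * (x ln * pd (pd v i) ln x) ∂(mub n ln b) +
      ∫ x, (x ln * pd v i x) ^ 2 ∂(mub n ln b) := by
    rw [← integral_add i2 i3]
    congr 1; ext x; ring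
  rw [f2] at key
  rw [f1]
  linarith

lemma integral_normal_mul (hv : Nice ν q ζ v) (hq : Measurable q) (hζ : Measurable ζ)
    {ln : Fin n} {b : ℝ} (hb : 0 < b) (huv : pd u ln = fun x => x ln * v x) :
    2 * ∫ x, v x * pd (pd u ln) ln x ∂(mub n ln b) =
      (1 - b) * ∫ x, v x ^ 2 ∂(mub n ln b) := by
  have hvd := hv.differentiable hq hζ
  have hvl := hv.pd hq hζ ln
  have key := (Nice.mul _ _ hv hv).integral_coord_mul_pd hq hζ ln hb
  rw [pd_mul hvd hvd] at key
  have i1 := hv.sq.integrable_mub hq hζ ln hb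
  have i2 := (Nice.mul _ _ hv (.coord_mul ln _ hvl)).integrable_mub hq hζ ln hb
  have f1 : ∫ x, v x * pd (pd u ln) ln x ∂(mub n ln b) =
      ∫ x, v x * (x ln * pd v ln x) ∂(mub n ln b) + ∫ x, v x ^ 2 ∂(mub n ln b) := by
    rw [huv, pd_coord_mul ln hvd, ← integral_add i2 i1]
    congr 1; ext x; simp; ring
  have f2 : ∫ x, x ln * (v x * pd v ln x + v x * pd v ln x) ∂(mub n ln b) =
      2 * ∫ x, v x * (x ln * pd v ln x) ∂(mub n ln b) := by
    rw [← integral_const_mul]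
    congr 1; ext x; ring
  have f3 : ∫ x, v x * v x ∂(mub n ln b) = ∫ x, v x ^ 2 ∂(mub n ln b) := by
    simp_rw [pow_two]
  rw [f2, f3] at key
  rw [f1]
  linarith

/-- Weighted Bochner identity. -/
lemma integral_sq_eq_sum (hu : Nice ν q ζ u) (hv : Nice ν q ζ v)
    (hq : Measurable q) (hζ : Measurable ζ) {ln : Fin n} {b : ℝ} (hb : 0 < b)
    (huv : pd u ln = fun x => x ln * v x) :
    ∫ x, (∑ i, pd (pd u i) i x + b * v x) ^ 2 ∂(mub n ln b) =
      ∑ i, ∑ j, ∫ x, (pd (pd u j) i x) ^ 2 ∂(mub n ln b) + b * ∫ x, v x ^ 2 ∂(mub n ln b) := by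
  have hun := (hu.pd hq hζ ln).pd hq hζ ln
  have hN := Nice.add _ _ hun (.const_mul b _ hv)
  have hii := fun i => (hu.pd hq hζ i).pd hq hζ i
  set S := Finset.univ.erase ln with hS
  have hmem : ∀ i ∈ S, i ≠ ln := fun i hi => Finset.ne_of_mem_erase hi
  have split : ∀ f : Fin n → ℝ, ∑ i, f i = f ln + ∑ i ∈ S, f i := fun f =>
    (Finset.add_sum_erase _ _ (Finset.mem_univ ln)).symm
  have I := fun {φ : Eu n → ℝ} (h : Nice ν q ζ φ) => h.integrable_mub hq hζ ln hb
  have e1 : ∀ x, (∑ i, pd (pd u i) i x + b * v x) ^ 2 =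
      (∑ i ∈ S, ∑ j ∈ S, pd (pd u i) i x * pd (pd u j) j x +
        2 * ∑ i ∈ S, pd (pd u i) i x * (pd (pd u ln) ln x + b * v x)) +
      ((pd (pd u ln) ln x) ^ 2 + 2 * b * (v x * pd (pd u ln) ln x) + b ^ 2 * v x ^ 2) := by
    intro x
    rw [split, ← Finset.sum_mul, ← Finset.sum_mul_sum]
    ring
  have i1 : ∀ i ∈ S, Integrable (fun x => ∑ j ∈ S, pd (pd u i) i x * pd (pd u j) j x)
      (mub n ln b) := fun i _ =>
    integrable_finsetSum _ fun j _ => I (.mul _ _ (hii i) (hii j))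
  have i2 : Integrable (fun x => ∑ i ∈ S, pd (pd u i) i x * (pd (pd u ln) ln x + b * v x))
      (mub n ln b) := integrable_finsetSum _ fun i _ => I (.mul _ _ (hii i) hN)
  have i3 := I hun.sq
  have i4 := (I (.mul _ _ hv hun)).const_mul (2 * b)
  have i5 := (I hv.sq).const_mul (b ^ 2)
  have i6 : Integrable (fun x => ∑ i ∈ S, ∑ j ∈ S, pd (pd u i) i x * pd (pd u j) j x)
      (mub n ln b) := integrable_finsetSum _ i1
  have j1 : Integrable (fun x => ∑ i ∈ S, ∑ j ∈ S, pd (pd u i) i x * pd (pd u j) j x +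
      2 * ∑ i ∈ S, pd (pd u i) i x * (pd (pd u ln) ln x + b * v x)) (mub n ln b) :=
    i6.add (i2.const_mul 2)
  have j2 : Integrable (fun x => (pd (pd u ln) ln x) ^ 2 + 2 * b * (v x * pd (pd u ln) ln x))
      (mub n ln b) := i3.add i4
  have j3 : Integrable (fun x => (pd (pd u ln) ln x) ^ 2 + 2 * b * (v x * pd (pd u ln) ln x) +
      b ^ 2 * v x ^ 2) (mub n ln b) := j2.add i5
  simp_rw [e1]
  rw [integral_add j1 j3, integral_add i6 (i2.const_mul 2),
    integral_add j2 i5, integral_add i3 i4, integral_const_mul, integral_const_mul,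
    integral_const_mul, integral_finsetSum _ i1,
    integral_finsetSum _ fun i _ => I (.mul _ _ (hii i) hN)]
  have e2 : ∀ i ∈ S, ∫ x, ∑ j ∈ S, pd (pd u i) i x * pd (pd u j) j x ∂(mub n ln b) =
      ∑ j ∈ S, ∫ x, (pd (pd u j) i x) ^ 2 ∂(mub n ln b) := by
    intro i hi
    rw [integral_finsetSum _ fun j _ => I (.mul _ _ (hii i) (hii j))]
    exact Finset.sum_congr rfl fun j hj =>
      integral_tangential_mul hu hq hζ (hmem i hi) (hmem j hj) hb
  have e3 : ∀ i ∈ S, ∫ x, pd (pd u i) i x * (pd (pd u ln) ln x + b * v x) ∂(mub n ln b) =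
      ∫ x, (pd (pd u ln) i x) ^ 2 ∂(mub n ln b) := fun i hi =>
    integral_tangential_mul_normal hu hv hq hζ (hmem i hi) hb huv
  have e4 : ∀ j ∈ S, ∫ x, (pd (pd u j) ln x) ^ 2 ∂(mub n ln b) =
      ∫ x, (pd (pd u ln) j x) ^ 2 ∂(mub n ln b) := fun j _ => by
    rw [hu.pd_comm hq hζ j ln]
  have e5 := integral_normal_mul hv hq hζ hb huv
  rw [Finset.sum_congr rfl e2, Finset.sum_congr rfl e3, split]
  simp_rw [split (fun j => ∫ x, (pd (pd u j) _ x) ^ 2 ∂(mub n ln b))]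
  rw [Finset.sum_add_distrib, Finset.sum_congr rfl e4]
  linear_combination b * e5

lemma integral_pd_pd_sq_le (hu : Nice ν q ζ u) (hv : Nice ν q ζ v)
    (hq : Measurable q) (hζ : Measurable ζ) {ln : Fin n} {b : ℝ} (hb : 0 < b)
    (huv : pd u ln = fun x => x ln * v x) (i j : Fin n) :
    ∫ x, (pd (pd u j) i x) ^ 2 ∂(mub n ln b) ≤
      ∫ x, (∑ i, pd (pd u i) i x + b * v x) ^ 2 ∂(mub n ln b) := by
  rw [integral_sq_eq_sum hu hv hq hζ hb huv]
  have h0 : ∀ i j, 0 ≤ ∫ x, (pd (pd u j) i x) ^ 2 ∂(mub n ln b) := fun i j =>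
    integral_nonneg fun x => sq_nonneg _
  have h1 : 0 ≤ b * ∫ x, v x ^ 2 ∂(mub n ln b) :=
    mul_nonneg hb.le (integral_nonneg fun x => sq_nonneg _)
  have h2 := Finset.single_le_sum (f := fun j => ∫ x, (pd (pd u j) i x) ^ 2 ∂(mub n ln b))
    (fun j _ => h0 i j) (Finset.mem_univ j)
  have h3 := Finset.single_le_sum (f := fun i => ∑ j, ∫ x, (pd (pd u j) i x) ^ 2 ∂(mub n ln b))
    (fun i _ => Finset.sum_nonneg fun j _ => h0 i j) (Finset.mem_univ i)
  linarith

lemma integral_normal_quotient_sq_le (hu : Nice ν q ζ u) (hv : Nice ν q ζ v)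
    (hq : Measurable q) (hζ : Measurable ζ) {ln : Fin n} {b : ℝ} (hb : 0 < b)
    (huv : pd u ln = fun x => x ln * v x) :
    b * ∫ x, (v x) ^ 2 ∂(mub n ln b) ≤
      ∫ x, (∑ i, pd (pd u i) i x + b * v x) ^ 2 ∂(mub n ln b) := by
  rw [integral_sq_eq_sum hu hv hq hζ hb huv]
  have h0 : 0 ≤ ∑ i, ∑ j, ∫ x, (pd (pd u j) i x) ^ 2 ∂(mub n ln b) :=
    Finset.sum_nonneg fun i _ => Finset.sum_nonneg fun j _ => integral_nonneg fun x => sq_nonneg _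
  linarith

end IBP

end Horiuchi

namespace Horiuchi

variable {n : ℕ}

/-- Bounded measurable functions with bounded support. -/
structure BddSupp (g : Eu n → ℝ) : Prop where
  measurable : Measurable g
  bdd : ∃ M : ℝ, 0 ≤ M ∧ ∀ y, |g y| ≤ M
  supp : ∃ R : ℝ, 0 ≤ R ∧ ∀ y, g y ≠ 0 → ‖y‖ ≤ R

lemma BddSupp.mul_of_bounded {g m : Eu n → ℝ} (hg : BddSupp g) (hm : Measurable m) {B : ℝ}
    (hB : ∀ y, |m y| ≤ B) : BddSupp (fun y => m y * g y) := by
  obtain ⟨M, hM, h1⟩ := hg.bdd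
  obtain ⟨R, hR, h2⟩ := hg.supp
  have hB0 : 0 ≤ B := (abs_nonneg _).trans (hB 0)
  refine ⟨hm.mul hg.measurable, ⟨B * M, by positivity, fun y => ?_⟩, R, hR,
    fun y hy => h2 y (right_ne_zero_of_mul hy)⟩
  rw [abs_mul]
  exact mul_le_mul (hB y) (h1 y) (abs_nonneg _) hB0

lemma BddSupp.add {g g' : Eu n → ℝ} (hg : BddSupp g) (hg' : BddSupp g') :
    BddSupp (fun y => g y + g' y) := by
  obtain ⟨M, hM, h1⟩ := hg.bdd
  obtain ⟨R, hR, h2⟩ := hg.supp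
  obtain ⟨M', hM', h1'⟩ := hg'.bdd
  obtain ⟨R', hR', h2'⟩ := hg'.supp
  refine ⟨hg.measurable.add hg'.measurable, ⟨M + M', by positivity, fun y =>
    (abs_add_le _ _).trans (add_le_add (h1 y) (h1' y))⟩, R + R', by positivity, fun y hy => ?_⟩
  by_cases h : g y = 0
  · have : g' y ≠ 0 := by simpa [h] using hy
    linarith [h2' y this]
  · linarith [h2 y h]

lemma BddSupp.sum {ι : Type*} (s : Finset ι) {g : ι → Eu n → ℝ} (hg : ∀ i ∈ s, BddSupp (g i)) :
    BddSupp (fun y => ∑ i ∈ s, g i y) := by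
  classical
  induction s using Finset.induction_on with
  | empty => exact ⟨by simp [measurable_const], ⟨0, le_rfl, by simp⟩, 0, le_rfl, by simp⟩
  | insert a s has ih =>
    simp_rw [Finset.sum_insert has]
    exact (hg a (Finset.mem_insert_self _ _)).add
      (ih fun i hi => hg i (Finset.mem_insert_of_mem hi))

lemma BddSupp.abs {g : Eu n → ℝ} (hg : BddSupp g) : BddSupp (fun y => |g y|) := by
  obtain ⟨M, hM, h1⟩ := hg.bdd
  obtain ⟨R, hR, h2⟩ := hg.supp
  exact ⟨hg.measurable.abs, ⟨M, hM, fun y => by rw [abs_abs]; exact h1 y⟩, R, hR,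
    fun y hy => h2 y (by simpa using hy)⟩

lemma BddSupp.integrable {g : Eu n → ℝ} (hg : BddSupp g) (ln : Fin n) {b : ℝ} (hb : 0 < b) :
    Integrable g (mub n ln b) := by
  obtain ⟨M, hM, h1⟩ := hg.bdd
  obtain ⟨R, hR, h2⟩ := hg.supp
  have hE : GaussDecay (fun x : Eu n => (M + 1) * Real.exp (R ^ 2) * Real.exp (-(1 * ‖x‖ ^ 2))) :=
    ⟨(M + 1) * Real.exp (R ^ 2), 1, by positivity, one_pos, fun x => by
      rw [abs_of_nonneg (by positivity)]⟩
  refine (hE.integrable_mub (by fun_prop) ln hb).mono' hg.measurable.aestronglyMeasurable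
    (ae_of_all _ fun y => ?_)
  by_cases h : g y = 0
  · rw [h, norm_zero]; positivity
  have h3 : ‖y‖ ^ 2 ≤ R ^ 2 := by have := h2 y h; gcongr
  rw [mul_assoc, ← Real.exp_add, Real.norm_eq_abs]
  have : 1 ≤ Real.exp (R ^ 2 + -(1 * ‖y‖ ^ 2)) := Real.one_le_exp (by linarith)
  nlinarith [h1 y]

/-- The parameter space `((y, τ), t)` of the truncated heat representation. -/
def m3 (ln : Fin n) (b s T : ℝ) : Measure ((Eu n × ℝ) × ℝ) :=
  ((mub n ln b).prod (betaM b)).prod (volume.restrict (Set.Ioc s T))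

lemma m3_ae (ln : Fin n) (b s T : ℝ) : ∀ᵐ ω ∂(m3 ln b s T),
    0 < ω.1.1 ln ∧ (0 < ω.1.2 ∧ ω.1.2 < 1) ∧ s < ω.2 ∧ ω.2 ≤ T := by
  have h1 := Measure.quasiMeasurePreserving_fst (μ := (mub n ln b).prod (betaM b))
    (ν := volume.restrict (Set.Ioc s T))
  have h2 := Measure.quasiMeasurePreserving_snd (μ := (mub n ln b).prod (betaM b))
    (ν := volume.restrict (Set.Ioc s T))
  have h3 := Measure.quasiMeasurePreserving_fst (μ := mub n ln b) (ν := betaM b)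
  have h4 := Measure.quasiMeasurePreserving_snd (μ := mub n ln b) (ν := betaM b)
  filter_upwards [h1.ae (h3.ae (mub_ae_upper ln b)), h1.ae (h4.ae (betaM_ae b)),
    h2.ae (ae_restrict_mem measurableSet_Ioc)] with ω a1 a2 a3
  exact ⟨a1, a2, a3⟩

lemma BddSupp.integrable_m3 {g : Eu n → ℝ} (hg : BddSupp g) (ln : Fin n) {b : ℝ} (hb : 0 < b)
    (s T : ℝ) : Integrable (fun ω : (Eu n × ℝ) × ℝ => g ω.1.1) (m3 ln b s T) := by
  have := isProbabilityMeasure_betaM hb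
  exact ((hg.integrable ln hb).comp_fst (betaM b)).comp_fst _

/-- The Gaussian rate of the heat representation. -/
def heatRate (ω : (Eu n × ℝ) × ℝ) : ℝ := 1 / (4 * ω.2)

/-- The linear exponent of the heat representation. -/
def heatShift (ln : Fin n) (ω : (Eu n × ℝ) × ℝ) : Eu n :=
  WithLp.toLp 2 fun i => (if i = ln then 1 - 2 * ω.1.2 else 1) * ω.1.1 i / (2 * ω.2)

/-- The amplitude of the heat representation. -/
def heatAmp (n : ℕ) (b : ℝ) (g : Eu n → ℝ) (ω : (Eu n × ℝ) × ℝ) : ℝ :=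
  ω.2 ^ (-((n + b) / 2)) * Real.exp (-(‖ω.1.1‖ ^ 2 / (4 * ω.2))) * g ω.1.1

lemma measurable_heatRate : Measurable (heatRate : (Eu n × ℝ) × ℝ → ℝ) := by
  unfold heatRate; fun_prop

lemma measurable_heatShift (ln : Fin n) : Measurable (heatShift ln) := by
  unfold heatShift
  refine (WithLp.measurable_toLp 2 _).comp (measurable_pi_lambda _ fun i => ?_)
  split_ifs <;> fun_prop

lemma heatShift_apply (ln : Fin n) (ω : (Eu n × ℝ) × ℝ) (i : Fin n) :
    heatShift ln ω i = (if i = ln then 1 - 2 * ω.1.2 else 1) * ω.1.1 i / (2 * ω.2) := rfl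

lemma heatShift_sub (ln : Fin n) (x : Eu n) (ω : (Eu n × ℝ) × ℝ) (i : Fin n) :
    heatShift ln ω i - 2 * (x i * heatRate ω) = -(disp ln x ω.1.1 ω.1.2 (some i) / (2 * ω.2)) := by
  rw [heatShift_apply, disp_some, heatRate]
  by_cases h : ω.2 = 0
  · simp [h]
  field_simp
  ring

lemma heatAmp_mul_exp (ln : Fin n) (b : ℝ) (g : Eu n → ℝ) (x : Eu n) (ω : (Eu n × ℝ) × ℝ) :
    heatAmp n b g ω * Real.exp (-(heatRate ω * ‖x‖ ^ 2) + inner ℝ (heatShift ln ω) x) =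
      gk ln b (1 / 4) x ω.1.1 ω.1.2 ω.2 * g ω.1.1 := by
  have hin : inner ℝ (heatShift ln ω) x =
      (inner ℝ x ω.1.1 - 2 * ω.1.2 * (x ln * ω.1.1 ln)) / (2 * ω.2) := by
    simp only [PiLp.inner_apply, heatShift_apply]
    have : ∀ i, inner ℝ ((if i = ln then 1 - 2 * ω.1.2 else 1) * ω.1.1 i / (2 * ω.2)) (x i) =
        (inner ℝ (x i) (ω.1.1 i) - if i = ln then 2 * ω.1.2 * (x ln * ω.1.1 ln) else 0) /
          (2 * ω.2) := by
      intro i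
      split_ifs with h
      · subst h; simp; ring
      · simp; ring
    simp_rw [this, ← Finset.sum_div, Finset.sum_sub_distrib]
    simp
  rw [hin, heatAmp, gk, heatRate, Aq, norm_sub_sq_real]
  rw [show ∀ p e g E : ℝ, p * e * g * E = p * (e * E) * g from fun _ _ _ _ => by ring,
    ← Real.exp_add]
  congr 3
  by_cases h : ω.2 = 0
  · simp [h]
  field_simp
  ring

section

variable {g : Eu n → ℝ}

lemma amplitude_heatAmp (hg : BddSupp g) (ln : Fin n) {b s T : ℝ} (hb : 0 < b) (hs : 0 < s)
    (hsT : s ≤ T) : Amplitude (m3 ln b s T) heatRate (heatShift ln) (heatAmp n b g) := by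
  obtain ⟨R, hR, hsupp⟩ := hg.supp
  refine ⟨?_, 1 / (4 * T), 1 / (4 * s), R / (2 * s), by have := hs.trans_le hsT; positivity,
    by positivity, ?_⟩
  · refine ((hg.integrable_m3 ln hb s T).norm.const_mul (s ^ (-((n + b) / 2)))).mono' ?_ ?_
    · have := hg.measurable
      unfold heatAmp
      exact Measurable.aestronglyMeasurable (by fun_prop)
    · filter_upwards [m3_ae ln b s T] with ω hω
      obtain ⟨-, -, h1, -⟩ := hω
      have h0 : 0 < ω.2 := hs.trans h1
      rw [heatAmp, norm_mul]
      refine mul_le_mul_of_nonneg_right ?_ (norm_nonneg _)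
      rw [norm_mul, Real.norm_of_nonneg (by positivity), Real.norm_of_nonneg (by positivity)]
      have e1 : Real.exp (-(‖ω.1.1‖ ^ 2 / (4 * ω.2))) ≤ 1 := Real.exp_le_one_iff.2 (by
        have : 0 ≤ ‖ω.1.1‖ ^ 2 / (4 * ω.2) := by positivity
        linarith)
      refine (mul_le_of_le_one_right (by positivity) e1).trans ?_
      exact Real.rpow_le_rpow_of_nonpos hs h1.le (by
        have : (0 : ℝ) ≤ n := Nat.cast_nonneg n
        linarith)
  · filter_upwards [m3_ae ln b s T] with ω hω hne
    obtain ⟨-, ⟨h3, h4⟩, h1, h2⟩ := hω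
    have h0 : 0 < ω.2 := hs.trans h1
    refine ⟨one_div_le_one_div_of_le (by positivity) (by linarith),
      one_div_le_one_div_of_le (by positivity) (by linarith), ?_⟩
    have hy := hsupp _ (right_ne_zero_of_mul hne)
    rw [← abs_of_nonneg (show 0 ≤ R / (2 * s) by positivity),
      ← abs_of_nonneg (norm_nonneg (heatShift ln ω)),
      ← sq_le_sq, EuclideanSpace.norm_sq_eq]
    calc ∑ i, ‖heatShift ln ω i‖ ^ 2 ≤ ∑ i, ‖ω.1.1 i‖ ^ 2 / (2 * ω.2) ^ 2 := by
          refine Finset.sum_le_sum fun i _ => ?_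
          rw [heatShift_apply, Real.norm_eq_abs, sq_abs, div_pow, Real.norm_eq_abs, sq_abs, mul_pow]
          gcongr
          refine mul_le_of_le_one_left (sq_nonneg _) ?_
          split_ifs
          · nlinarith
          · norm_num
      _ = ‖ω.1.1‖ ^ 2 / (2 * ω.2) ^ 2 := by rw [← Finset.sum_div, EuclideanSpace.norm_sq_eq]
      _ ≤ R ^ 2 / (2 * s) ^ 2 := by gcongr
      _ = _ := by rw [div_pow]

/-- The truncated singular integral with kernel `ker`. -/
def Sop (ln : Fin n) (b κ c : ℝ) (i j : Option (Fin n)) (s T : ℝ) (g : Eu n → ℝ) (x : Eu n) : ℝ :=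
  ∫ ω, ker ln b κ c i j x ω.1.1 ω.1.2 ω.2 * g ω.1.1 ∂(m3 ln b s T)

/-- The truncated potential. -/
def Pot (ln : Fin n) (b s T : ℝ) (g : Eu n → ℝ) (x : Eu n) : ℝ :=
  ∫ ω, gk ln b (1 / 4) x ω.1.1 ω.1.2 ω.2 * g ω.1.1 ∂(m3 ln b s T)

lemma Pot_eq (ln : Fin n) (b s T : ℝ) (g : Eu n → ℝ) :
    Pot ln b s T g = gaussSum (m3 ln b s T) heatRate (heatShift ln) (heatAmp n b g) := by
  ext x
  simp_rw [Pot, gaussSum, heatAmp_mul_exp]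

lemma ker_eq_gk (ln : Fin n) (b κ c : ℝ) (i j : Option (Fin n)) (x y : Eu n) (τ t : ℝ) :
    ker ln b κ c i j x y τ t =
      (κ * (disp ln x y τ i * disp ln x y τ j) / t ^ 2 + c / t) * gk ln b (1 / 4) x y τ t := by
  rw [ker, gk, show -(1 / 4 * Aq ln x y τ / t) = -(Aq ln x y τ / (4 * t)) by
    rw [mul_comm 4 t, ← div_div]; ring]
  ring

lemma pd_Pot (hg : BddSupp g) (ln : Fin n) {b s T : ℝ} (hb : 0 < b) (hs : 0 < s)
    (hsT : s ≤ T) (j : Fin n) (x : Eu n) : pd (Pot ln b s T g) j x =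
      ∫ ω, -(disp ln x ω.1.1 ω.1.2 (some j) / (2 * ω.2)) *
        (gk ln b (1 / 4) x ω.1.1 ω.1.2 ω.2 * g ω.1.1) ∂(m3 ln b s T) := by
  have hA := amplitude_heatAmp hg ln hb hs hsT
  rw [Pot_eq, pd_gaussSum hA measurable_heatRate (measurable_heatShift ln)]
  simp only [gaussSum]
  rw [← integral_const_mul, ← integral_const_mul, ← integral_add]
  · congr 1; ext ω
    rw [← heatShift_sub, ← heatAmp_mul_exp]; ring
  · exact (hA.coord_mul (measurable_heatShift ln) j).integrable_mul_exp measurable_heatRate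
      (measurable_heatShift ln) x
  · exact (((hA.q_mul measurable_heatRate).integrable_mul_exp measurable_heatRate
      (measurable_heatShift ln) x).const_mul _).const_mul _

lemma pd_pd_Pot (hg : BddSupp g) (ln : Fin n) {b s T : ℝ} (hb : 0 < b) (hs : 0 < s)
    (hsT : s ≤ T) (i j : Fin n) : pd (pd (Pot ln b s T g) j) i =
      Sop ln b (1 / 4) (if i = j then -1 / 2 else 0) (some i) (some j) s T g := by
  have hA := amplitude_heatAmp hg ln hb hs hsT
  have mq := measurable_heatRate (n := n)
  have mζ := measurable_heatShift ln
  have hj := hA.coord_mul mζ j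
  have hqA := hA.q_mul mq
  have d := fun {a : (Eu n × ℝ) × ℝ → ℝ} (h : Amplitude (m3 ln b s T) heatRate (heatShift ln) a) =>
    (Nice.base a h).differentiable mq mζ
  ext x
  rw [Pot_eq, pd_gaussSum hA mq mζ, pd_add (d hj) (by have := d hqA; fun_prop),
    pd_const_mul _ (by have := d hqA; fun_prop), pd_coord_mul j (d hqA), pd_gaussSum hj mq mζ,
    pd_gaussSum hqA mq mζ]
  have I := fun {a : (Eu n × ℝ) × ℝ → ℝ} (h : Amplitude (m3 ln b s T) heatRate (heatShift ln) a) =>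
    h.integrable_mul_exp mq mζ x
  have i1 := I (hj.coord_mul mζ i)
  have i2 := (I (hj.q_mul mq)).const_mul (-2 * x i)
  have i3 := (I (hqA.coord_mul mζ i)).const_mul (-2 * x j)
  have i4 := (I (hqA.q_mul mq)).const_mul (4 * x i * x j)
  have i5 := (I hqA).const_mul (-2 * if j = i then 1 else 0)
  have e : Sop ln b (1 / 4) (if i = j then -1 / 2 else 0) (some i) (some j) s T g x =
      ∫ ω, ((((heatShift ln ω i * (heatShift ln ω j * heatAmp n b g ω)) *
          Real.exp (-(heatRate ω * ‖x‖ ^ 2) + inner ℝ (heatShift ln ω) x) +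
        -2 * x i * ((heatRate ω * (heatShift ln ω j * heatAmp n b g ω)) *
          Real.exp (-(heatRate ω * ‖x‖ ^ 2) + inner ℝ (heatShift ln ω) x))) +
        -2 * x j * ((heatShift ln ω i * (heatRate ω * heatAmp n b g ω)) *
          Real.exp (-(heatRate ω * ‖x‖ ^ 2) + inner ℝ (heatShift ln ω) x))) +
        4 * x i * x j * ((heatRate ω * (heatRate ω * heatAmp n b g ω)) *
          Real.exp (-(heatRate ω * ‖x‖ ^ 2) + inner ℝ (heatShift ln ω) x))) +
        (-2 * if j = i then 1 else 0) * ((heatRate ω * heatAmp n b g ω) *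
          Real.exp (-(heatRate ω * ‖x‖ ^ 2) + inner ℝ (heatShift ln ω) x)) ∂(m3 ln b s T) := by
    refine integral_congr_ae ?_
    filter_upwards [m3_ae ln b s T] with ω hω
    have h0 : 0 < ω.2 := hs.trans hω.2.2.1
    have h1 := heatShift_sub ln x ω i
    have h2 := heatShift_sub ln x ω j
    have h3 := heatAmp_mul_exp ln b g x ω
    rw [ker_eq_gk, mul_assoc, ← h3]
    have h4 : disp ln x ω.1.1 ω.1.2 (some i) = -(2 * ω.2) * (heatShift ln ω i - 2 * (x i * heatRate ω)) := by
      rw [h1]; field_simp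
    have h5 : disp ln x ω.1.1 ω.1.2 (some j) = -(2 * ω.2) * (heatShift ln ω j - 2 * (x j * heatRate ω)) := by
      rw [h2]; field_simp
    have h6 : (if i = j then (-1 / 2 : ℝ) else 0) / ω.2 = -2 * (if j = i then 1 else 0) * heatRate ω := by
      rw [heatRate]; simp only [eq_comm (a := j)]; split_ifs <;> field_simp <;> norm_num
    rw [h4, h5, h6]
    field_simp
    ring
  have j1 := i1.add i2
  have j2 := j1.add i3
  have j3 := j2.add i4
  rw [e]
  refine Eq.trans ?_ (integral_add j3 i5).symm
  refine Eq.trans ?_ (congrArg (· + _) (integral_add j2 i4).symm)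
  refine Eq.trans ?_ (congrArg (· + _ + _) (integral_add j1 i3).symm)
  refine Eq.trans ?_ (congrArg (· + _ + _ + _) (integral_add i1 i2).symm)
  rw [integral_const_mul, integral_const_mul, integral_const_mul, integral_const_mul]
  simp only [gaussSum]
  ring

end

end Horiuchi

namespace Horiuchi

variable {n : ℕ} {g : Eu n → ℝ}

/-- The multiplier that turns the potential into its normal quotient. -/
def normalMult (ln : Fin n) (b : ℝ) (ω : (Eu n × ℝ) × ℝ) : ℝ :=
  1 / (4 * b) * (disp ln 0 ω.1.1 ω.1.2 none * disp ln 0 ω.1.1 ω.1.2 none) / ω.2 ^ 2 +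
    -1 / 2 / ω.2

lemma measurable_normalMult (ln : Fin n) (b : ℝ) : Measurable (normalMult ln b) := by
  unfold normalMult
  simp only [disp_none]
  fun_prop

lemma amplitude_normalMult (hg : BddSupp g) (ln : Fin n) {b s T : ℝ} (hb : 0 < b) (hs : 0 < s)
    (hsT : s ≤ T) : Amplitude (m3 ln b s T) heatRate (heatShift ln)
      (fun ω => normalMult ln b ω * heatAmp n b g ω) := by
  obtain ⟨R, hR, hsupp⟩ := hg.supp
  refine (amplitude_heatAmp hg ln hb hs hsT).mul_of_bounded (measurable_normalMult ln b)
    (B := 1 / (4 * b) * (4 * R ^ 2) / s ^ 2 + 1 / 2 / s) ?_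
  filter_upwards [m3_ae ln b s T] with ω hω hne
  obtain ⟨-, ⟨h3, h4⟩, h1, h2⟩ := hω
  have h0 : 0 < ω.2 := hs.trans h1
  have hy := hsupp _ (right_ne_zero_of_mul hne)
  have hτ : 0 ≤ ω.1.2 * (1 - ω.1.2) := mul_nonneg h3.le (by linarith)
  rw [normalMult, disp_none]
  have e : 2 * √(ω.1.2 * (1 - ω.1.2)) * ω.1.1 ln * (2 * √(ω.1.2 * (1 - ω.1.2)) * ω.1.1 ln) =
      4 * (ω.1.2 * (1 - ω.1.2) * ω.1.1 ln ^ 2) := by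
    rw [show ∀ a y : ℝ, 2 * a * y * (2 * a * y) = 4 * (a ^ 2 * y ^ 2) from fun _ _ => by ring,
      Real.sq_sqrt hτ]
  rw [e]
  refine (abs_add_le _ _).trans ?_
  have h5 : ω.1.1 ln ^ 2 ≤ R ^ 2 := by
    rw [sq_le_sq, abs_of_nonneg hR]; exact (abs_coord_le _ _).trans hy
  have h6 : ω.1.2 * (1 - ω.1.2) * ω.1.1 ln ^ 2 ≤ R ^ 2 :=
    (mul_le_of_le_one_left (sq_nonneg _) (by nlinarith)).trans h5
  refine add_le_add ?_ ?_
  · rw [abs_of_nonneg (by positivity)]; gcongr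
  · rw [abs_div, abs_of_pos h0]
    norm_num
    gcongr

lemma Sop_none_eq (ln : Fin n) (b s T : ℝ) :
    Sop ln b (1 / (4 * b)) (-1 / 2) none none s T g =
      gaussSum (m3 ln b s T) heatRate (heatShift ln)
        (fun ω => normalMult ln b ω * heatAmp n b g ω) := by
  ext x
  simp only [Sop, gaussSum, mul_assoc, heatAmp_mul_exp, ker_eq_gk, normalMult, disp_none]

lemma pd_Pot_normal (hg : BddSupp g) (ln : Fin n) {b s T : ℝ} (hb : 0 < b) (hs : 0 < s)
    (hsT : s ≤ T) : pd (Pot ln b s T g) ln =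
      fun x => x ln * Sop ln b (1 / (4 * b)) (-1 / 2) none none s T g x := by
  have hP := isProbabilityMeasure_betaM hb
  ext x
  rw [pd_Pot hg ln hb hs hsT, Sop, ← integral_const_mul]
  have hA := amplitude_heatAmp hg ln hb hs hsT
  have mq := measurable_heatRate (n := n)
  have mζ := measurable_heatShift ln
  have i1 : Integrable (fun ω : (Eu n × ℝ) × ℝ => -(disp ln x ω.1.1 ω.1.2 (some ln) / (2 * ω.2)) *
        (gk ln b (1 / 4) x ω.1.1 ω.1.2 ω.2 * g ω.1.1)) (m3 ln b s T) := by
    have := ((hA.coord_mul mζ ln).integrable_mul_exp mq mζ x).sub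
      (((hA.q_mul mq).integrable_mul_exp mq mζ x).const_mul (2 * x ln))
    refine this.congr (ae_of_all _ fun ω => ?_)
    simp only [Pi.sub_apply]
    rw [← heatShift_sub, ← heatAmp_mul_exp]; ring
  have i2 : Integrable (fun ω : (Eu n × ℝ) × ℝ => x ln *
        (ker ln b (1 / (4 * b)) (-1 / 2) none none x ω.1.1 ω.1.2 ω.2 * g ω.1.1))
        (m3 ln b s T) := by
    have := ((amplitude_normalMult hg ln hb hs hsT).integrable_mul_exp mq mζ x).const_mul (x ln)
    refine this.congr (ae_of_all _ fun ω => ?_)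
    simp only [mul_assoc, heatAmp_mul_exp, ker_eq_gk, normalMult, disp_none]
  rw [m3] at i1 i2 ⊢
  rw [integral_prod_symm _ i1, integral_prod_symm _ i2]
  refine integral_congr_ae ?_
  filter_upwards [i1.prod_left_ae, i2.prod_left_ae, ae_restrict_mem measurableSet_Ioc]
    with t j1 j2 ht
  have h0 : 0 < t := hs.trans ht.1
  rw [integral_prod _ j1, integral_prod _ j2]
  congr 1; ext y
  simp only
  set z := x ln * y ln / t with hz
  set P := t ^ (-((n + b) / 2)) * Real.exp (-(‖x - y‖ ^ 2 / (4 * t))) * g y with hPdef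
  have hgk : ∀ τ, gk ln b (1 / 4) x y τ t * g y = P * Real.exp (-(z * τ)) := by
    intro τ
    rw [gk, hPdef, show ∀ p e g E : ℝ, p * e * g * E = p * (e * E) * g from fun _ _ _ _ => by ring,
      ← Real.exp_add, Aq, hz]
    congr 3
    field_simp
    ring
  have hE : Continuous fun τ : ℝ => Real.exp (-(z * τ)) := by fun_prop
  have hb1 : ∀ φ : ℝ → ℝ, Continuous φ → Integrable φ (betaM b) := by
    intro φ hφ
    obtain ⟨M, hM⟩ := (isCompact_Icc (a := (0 : ℝ)) (b := 1)).exists_bound_of_continuousOn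
      hφ.continuousOn
    refine Integrable.of_bound hφ.aestronglyMeasurable (C := M) ?_
    filter_upwards [betaM_ae b] with τ hτ using hM τ ⟨hτ.1.le, hτ.2.le⟩
  have k1 := hb1 (fun τ => Real.exp (-(z * τ))) hE
  have k2 := hb1 (fun τ => (1 - 2 * τ) * Real.exp (-(z * τ))) (by fun_prop)
  have k3 := hb1 (fun τ => τ * (1 - τ) * Real.exp (-(z * τ))) (by fun_prop)
  have e1 : ∀ τ, -(disp ln x y τ (some ln) / (2 * t)) * (gk ln b (1 / 4) x y τ t * g y) =
      -(x ln / (2 * t)) * P * Real.exp (-(z * τ)) +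
        y ln / (2 * t) * P * ((1 - 2 * τ) * Real.exp (-(z * τ))) := by
    intro τ
    rw [hgk, disp_some, if_pos rfl]; field_simp; ring
  have e2 : ∀ᵐ τ ∂(betaM b), x ln * (ker ln b (1 / (4 * b)) (-1 / 2) none none x y τ t * g y) =
      -(x ln / (2 * t)) * P * Real.exp (-(z * τ)) +
        x ln * y ln ^ 2 / (b * t ^ 2) * P * (τ * (1 - τ) * Real.exp (-(z * τ))) := by
    filter_upwards [betaM_ae b] with τ hτ
    have hτ' : 0 ≤ τ * (1 - τ) := mul_nonneg hτ.1.le (by linarith [hτ.2])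
    rw [ker_eq_gk, mul_assoc, hgk, disp_none,
      show ∀ a y : ℝ, 2 * a * y * (2 * a * y) = 4 * (a ^ 2 * y ^ 2) from fun _ _ => by ring,
      Real.sq_sqrt hτ']
    field_simp
    ring
  rw [integral_congr_ae e2]
  simp_rw [e1]
  rw [integral_add (k1.const_mul _) (k2.const_mul _), integral_add (k1.const_mul _)
    (k3.const_mul _), integral_const_mul, integral_const_mul, integral_const_mul]
  have key := betaM_integral_by_parts hb z
  have : ∫ τ, (1 - 2 * τ) * Real.exp (-(z * τ)) ∂(betaM b) =
      2 / b * (z * ∫ τ, τ * (1 - τ) * Real.exp (-(z * τ)) ∂(betaM b)) := by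
    have h2b : 2 / b * (b / 2) = 1 := by field_simp
    linear_combination (2 / b) * key -
      (∫ τ, (1 - 2 * τ) * Real.exp (-(z * τ)) ∂(betaM b)) * h2b
  rw [this, hz]
  field_simp

/-- The heat-type semigroup at time `t`. -/
def heatOp (ln : Fin n) (b : ℝ) (g : Eu n → ℝ) (t : ℝ) (x : Eu n) : ℝ :=
  ∫ p, gk ln b (1 / 4) x p.1 p.2 t * g p.1 ∂((mub n ln b).prod (betaM b))

lemma integrable_heat (hg : BddSupp g) (ln : Fin n) {b t : ℝ} (hb : 0 < b) (ht : 0 < t)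
    {x : Eu n} (hx : 0 ≤ x ln) : Integrable (fun p => gk ln b (1 / 4) x p.1 p.2 t * g p.1)
      ((mub n ln b).prod (betaM b)) := by
  have hP := isProbabilityMeasure_betaM hb
  have h1 : Integrable (fun p : Eu n × ℝ => g p.1) ((mub n ln b).prod (betaM b)) :=
    (hg.integrable ln hb).comp_fst (betaM b)
  have hm : Measurable fun p : Eu n × ℝ => gk ln b (1 / 4) x p.1 p.2 t :=
    (measurable_gk ln b (1 / 4)).comp (by fun_prop : Measurable fun p : Eu n × ℝ =>
      (((x, p.1), p.2), t))
  refine (h1.norm.const_mul (t ^ (-((n + b) / 2)))).mono'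
    (hm.aestronglyMeasurable.mul h1.aestronglyMeasurable) ?_
  have h3 := Measure.quasiMeasurePreserving_fst (μ := mub n ln b) (ν := betaM b)
  have h4 := Measure.quasiMeasurePreserving_snd (μ := mub n ln b) (ν := betaM b)
  filter_upwards [h3.ae (mub_ae_upper ln b), h4.ae (betaM_ae b)] with p hp hp'
  rw [norm_mul, Real.norm_of_nonneg (gk_nonneg ln b _ _ _ _ ht.le)]
  exact mul_le_mul_of_nonneg_right (gk_le ln (by norm_num) hx hp.le hp'.1.le ht) (norm_nonneg _)

lemma hasDerivAt_gk (ln : Fin n) (b : ℝ) (x y : Eu n) (τ : ℝ) {t : ℝ} (ht : 0 < t) :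
    HasDerivAt (gk ln b (1 / 4) x y τ)
      ((Aq ln x y τ / (4 * t ^ 2) - (n + b) / (2 * t)) * gk ln b (1 / 4) x y τ t) t := by
  have h1 := Real.hasDerivAt_rpow_const (x := t) (p := -((n + b) / 2)) (Or.inl ht.ne')
  have h2 := (((hasDerivAt_id t).fun_inv ht.ne').const_mul (-(1 / 4 * Aq ln x y τ))).exp
  have h3 := h1.mul h2
  have e : gk ln b (1 / 4) x y τ = (fun t => t ^ (-((n + b) / 2))) *
      fun t => Real.exp (-(1 / 4 * Aq ln x y τ) * (id t)⁻¹) := by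
    ext t; simp only [gk, Pi.mul_apply, id]; congr 2; ring
  rw [e]
  refine h3.congr_deriv ?_
  simp only [Pi.mul_apply, id]
  rw [Real.rpow_sub_one ht.ne']
  field_simp
  ring

lemma laplace_Pot (hg : BddSupp g) (ln : Fin n) {b s T : ℝ} (hb : 0 < b) (hs : 0 < s)
    (hsT : s ≤ T) {x : Eu n} (hx : 0 ≤ x ln) : ∑ i, pd (pd (Pot ln b s T g) i) i x +
      b * Sop ln b (1 / (4 * b)) (-1 / 2) none none s T g x =
      heatOp ln b g T x - heatOp ln b g s x := by
  have hP := isProbabilityMeasure_betaM hb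
  have hA := amplitude_heatAmp hg ln hb hs hsT
  have mq := measurable_heatRate (n := n)
  have mζ := measurable_heatShift ln
  have i1 : ∀ i : Fin n, Integrable (fun ω => ker ln b (1 / 4) (-1 / 2) (some i) (some i)
      x ω.1.1 ω.1.2 ω.2 * g ω.1.1) (m3 ln b s T) := by
    intro i
    have a1 := ((hA.coord_mul mζ i).coord_mul mζ i).integrable_mul_exp mq mζ x
    have a2 := (((hA.q_mul mq).coord_mul mζ i).integrable_mul_exp mq mζ x).const_mul (-4 * x i)
    have a3 := (((hA.q_mul mq).q_mul mq).integrable_mul_exp mq mζ x).const_mul (4 * x i * x i)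
    have a4 := (((hA.q_mul mq)).integrable_mul_exp mq mζ x).const_mul (-2)
    refine (((a1.add a2).add a3).add a4).congr ?_
    filter_upwards [m3_ae ln b s T] with ω hω
    have h0 : 0 < ω.2 := hs.trans hω.2.2.1
    have h1 := heatShift_sub ln x ω i
    simp only [Pi.add_apply]
    rw [ker_eq_gk, mul_assoc _ (gk ln b (1 / 4) x ω.1.1 ω.1.2 ω.2), ← heatAmp_mul_exp ln b g x ω]
    have h4 : disp ln x ω.1.1 ω.1.2 (some i) =
        -(2 * ω.2) * (heatShift ln ω i - 2 * (x i * heatRate ω)) := by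
      rw [h1]; field_simp
    have h6 : (-1 / 2 : ℝ) / ω.2 = -2 * heatRate ω := by
      rw [heatRate]; field_simp; norm_num
    rw [h4, h6]
    field_simp
    ring
  have i2 : Integrable (fun ω => b * (ker ln b (1 / (4 * b)) (-1 / 2) none none
      x ω.1.1 ω.1.2 ω.2 * g ω.1.1)) (m3 ln b s T) := by
    have := ((amplitude_normalMult hg ln hb hs hsT).integrable_mul_exp mq mζ x).const_mul b
    refine this.congr (ae_of_all _ fun ω => ?_)
    simp only [mul_assoc, heatAmp_mul_exp, ker_eq_gk, normalMult, disp_none]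
  have e1 : ∀ i, pd (pd (Pot ln b s T g) i) i x = ∫ ω, ker ln b (1 / 4) (-1 / 2) (some i) (some i)
      x ω.1.1 ω.1.2 ω.2 * g ω.1.1 ∂(m3 ln b s T) := by
    intro i; rw [pd_pd_Pot hg ln hb hs hsT, if_pos rfl, Sop]
  simp_rw [e1]
  rw [Sop, ← integral_const_mul, ← integral_finsetSum _ fun i _ => i1 i,
    ← integral_add (integrable_finsetSum _ fun i _ => i1 i) i2]
  have e2 : ∀ᵐ ω ∂(m3 ln b s T), ∑ i, ker ln b (1 / 4) (-1 / 2) (some i) (some i)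
      x ω.1.1 ω.1.2 ω.2 * g ω.1.1 + b * (ker ln b (1 / (4 * b)) (-1 / 2) none none
      x ω.1.1 ω.1.2 ω.2 * g ω.1.1) = (Aq ln x ω.1.1 ω.1.2 / (4 * ω.2 ^ 2) - (n + b) / (2 * ω.2)) *
        gk ln b (1 / 4) x ω.1.1 ω.1.2 ω.2 * g ω.1.1 := by
    filter_upwards [m3_ae ln b s T] with ω hω
    have h0 : 0 < ω.2 := hs.trans hω.2.2.1
    obtain ⟨-, ⟨t0, t1⟩, -⟩ := hω
    have hD := sum_sq_disp_some ln x ω.1.1 ω.1.2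
    have hτ' : 0 ≤ ω.1.2 * (1 - ω.1.2) := mul_nonneg t0.le (by linarith)
    simp_rw [ker_eq_gk, ← Finset.sum_mul, Finset.sum_add_distrib, ← Finset.sum_div,
      ← Finset.mul_sum, ← sq, hD, disp_none, mul_pow, Real.sq_sqrt hτ']
    simp
    field_simp
    ring
  have i3 := ((integrable_finsetSum Finset.univ fun i _ => i1 i).add i2).congr e2
  rw [integral_congr_ae e2]
  rw [m3] at i3 ⊢
  rw [integral_prod _ i3, heatOp, heatOp, ← integral_sub
    (integrable_heat hg ln hb (hs.trans_le hsT) hx) (integrable_heat hg ln hb hs hx)]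
  refine integral_congr_ae ?_
  filter_upwards [i3.prod_right_ae] with p hp
  rw [← intervalIntegral.integral_of_le hsT, intervalIntegral.integral_mul_const,
    intervalIntegral.integral_eq_sub_of_hasDerivAt (f := gk ln b (1 / 4) x p.1 p.2)]
  · ring
  · intro t ht
    rw [Set.uIcc_of_le hsT] at ht
    exact hasDerivAt_gk ln b x p.1 p.2 (hs.trans_le ht.1)
  · refine ContinuousOn.intervalIntegrable ?_
    rw [Set.uIcc_of_le hsT]
    intro t ht
    have h0 : 0 < t := hs.trans_le ht.1
    have := (hasDerivAt_gk ln b x p.1 p.2 h0).continuousAt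
    refine ContinuousAt.continuousWithinAt ?_
    fun_prop (disch := positivity)

end Horiuchi

namespace Horiuchi

variable {n : ℕ} {g : Eu n → ℝ}

lemma sq_lintegral_mul_le {α : Type*} [MeasurableSpace α] (μ : Measure α) {h k : α → ℝ≥0∞}
    (hh : Measurable h) (hk : Measurable k) :
    (∫⁻ a, h a * k a ∂μ) ^ 2 ≤ (∫⁻ a, h a ∂μ) * ∫⁻ a, h a * k a ^ 2 ∂μ := by
  have key := ENNReal.lintegral_mul_le_Lp_mul_Lq (μ.withDensity h) Real.HolderConjugate.two_two
    (f := fun _ => 1) (g := k) aemeasurable_const hk.aemeasurable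
  simp only [Pi.mul_apply, one_mul, ENNReal.rpow_two] at key
  rw [lintegral_withDensity_eq_lintegral_mul _ hh hk,
    lintegral_withDensity_eq_lintegral_mul _ hh (by fun_prop),
    lintegral_withDensity_eq_lintegral_mul _ hh (by fun_prop)] at key
  simp only [Pi.mul_apply, one_pow, mul_one] at key
  calc _ ≤ ((∫⁻ a, h a ∂μ) ^ (1 / 2 : ℝ) * (∫⁻ a, h a * k a ^ 2 ∂μ) ^ (1 / 2 : ℝ)) ^ 2 := by
        gcongr
    _ = _ := by
        rw [mul_pow, ← ENNReal.rpow_two, ← ENNReal.rpow_two, ← ENNReal.rpow_mul,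
          ← ENNReal.rpow_mul]
        norm_num

/-- Schur test for the semigroup. -/
lemma exists_lintegral_heatOp_sq_le (n : ℕ) {b : ℝ} (hb : 0 < b) : ∃ C > 0, ∀ (ln : Fin n)
    (g : Eu n → ℝ) (t : ℝ), BddSupp g → 0 < t →
    ∫⁻ x, ENNReal.ofReal (heatOp ln b g t x ^ 2) ∂(mub n ln b) ≤
      ENNReal.ofReal (C * ∫ x, g x ^ 2 ∂(mub n ln b)) := by
  obtain ⟨C, hC, h⟩ := exists_lintegral_gk_le n hb (c := 1 / 4) (by norm_num)
  have hP := isProbabilityMeasure_betaM hb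
  refine ⟨C * C, by positivity, fun ln g t hg ht => ?_⟩
  obtain ⟨m2, hm2⟩ : ∃ m2, m2 = (mub n ln b).prod (betaM b) := ⟨_, rfl⟩
  have : SFinite m2 := by rw [hm2]; infer_instance
  obtain ⟨G, hG⟩ : ∃ G : Eu n → ℝ≥0∞, G = fun y => ENNReal.ofReal (g y ^ 2) := ⟨_, rfl⟩
  have hGm : Measurable G := by rw [hG]; have := hg.measurable; fun_prop
  obtain ⟨K, hK⟩ : ∃ K : Eu n → Eu n → ℝ → ℝ≥0∞,
      K = fun x y τ => ENNReal.ofReal (gk ln b (1 / 4) x y τ t) := ⟨_, rfl⟩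
  have hKm : Measurable (fun p : (Eu n × Eu n) × ℝ => K p.1.1 p.1.2 p.2) := by
    rw [hK]
    exact ENNReal.measurable_ofReal.comp ((measurable_gk ln b (1 / 4)).comp
      (measurable_id.prodMk measurable_const))
  have hKx : ∀ x, Measurable (fun p : Eu n × ℝ => K x p.1 p.2) := fun x =>
    hKm.comp (by fun_prop : Measurable fun p : Eu n × ℝ => ((x, p.1), p.2))
  have hKI : ∀ x, ∫⁻ p, K x p.1 p.2 ∂m2 = ∫⁻ y, ∫⁻ τ, K x y τ ∂(betaM b) ∂(mub n ln b) := fun x => by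
    rw [hm2]; exact lintegral_prod _ (hKx x).aemeasurable
  have step : ∀ᵐ x ∂(mub n ln b), ENNReal.ofReal (heatOp ln b g t x ^ 2) ≤
      ENNReal.ofReal C * ∫⁻ p, K x p.1 p.2 * G p.1 ∂m2 := by
    filter_upwards [mub_ae_upper ln b] with x hx
    have h1 : ENNReal.ofReal |heatOp ln b g t x| ≤
        ∫⁻ p, K x p.1 p.2 * ENNReal.ofReal |g p.1| ∂m2 := by
      rw [heatOp, ← Real.enorm_eq_ofReal_abs, hm2]
      refine (enorm_integral_le_lintegral_enorm _).trans (lintegral_mono fun p => ?_)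
      rw [enorm_mul, Real.enorm_eq_ofReal_abs, Real.enorm_eq_ofReal_abs,
        abs_of_nonneg (gk_nonneg ln b _ _ _ _ ht.le), hK]
    rw [← sq_abs, ENNReal.ofReal_pow (abs_nonneg _)]
    calc _ ≤ (∫⁻ p, K x p.1 p.2 * ENNReal.ofReal |g p.1| ∂m2) ^ 2 := by gcongr
      _ ≤ _ := sq_lintegral_mul_le m2 (hKx x) (by have := hg.measurable; fun_prop)
      _ ≤ _ := by
        rw [hKI]
        gcongr
        · rw [hK]; exact h ln x t hx ht
        · simp only [hG]
          rw [← ENNReal.ofReal_pow (abs_nonneg _), sq_abs]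
  refine (lintegral_mono_ae step).trans ?_
  have hGI : ∫⁻ y, G y ∂(mub n ln b) = ENNReal.ofReal (∫ x, g x ^ 2 ∂(mub n ln b)) := by
    rw [hG, ofReal_integral_eq_lintegral_ofReal _ (ae_of_all _ fun _ => sq_nonneg _)]
    obtain ⟨M, hM, h1⟩ := hg.bdd
    simp_rw [pow_two]
    exact (hg.mul_of_bounded hg.measurable h1).integrable ln hb
  have hm3 : Measurable (fun p : Eu n × (Eu n × ℝ) => K p.1 p.2.1 p.2.2 * G p.2.1) :=
    (hKm.comp (by fun_prop : Measurable fun p : Eu n × (Eu n × ℝ) => ((p.1, p.2.1), p.2.2))).mul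
      (hGm.comp (by fun_prop))
  have hmi : Measurable (fun x => ∫⁻ p, K x p.1 p.2 * G p.1 ∂m2) := hm3.lintegral_prod_right'
  rw [lintegral_const_mul _ hmi, mul_assoc, ENNReal.ofReal_mul hC.le, ENNReal.ofReal_mul hC.le]
  gcongr
  rw [lintegral_lintegral_swap hm3.aemeasurable, ← hGI]
  have h3 : Measurable (fun p : Eu n × ℝ => ∫⁻ x, K x p.1 p.2 * G p.1 ∂(mub n ln b)) :=
    hm3.lintegral_prod_left'
  rw [hm2, lintegral_prod _ h3.aemeasurable, ← lintegral_const_mul _ hGm]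
  refine lintegral_mono_ae ?_
  filter_upwards [mub_ae_upper ln b] with y hy
  have hKy : Measurable (fun p : ℝ × Eu n => K p.2 y p.1) :=
    hKm.comp (by fun_prop : Measurable fun p : ℝ × Eu n => ((p.2, y), p.1))
  calc _ = ∫⁻ τ, (∫⁻ x, K x y τ ∂(mub n ln b)) * G y ∂(betaM b) := by
        congr 1; ext τ
        exact lintegral_mul_const _ (hKy.comp (by fun_prop : Measurable fun x : Eu n => (τ, x)))
    _ = (∫⁻ τ, (∫⁻ x, K x y τ ∂(mub n ln b)) ∂(betaM b)) * G y :=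
        lintegral_mul_const _ hKy.lintegral_prod_right'
    _ = (∫⁻ x, (∫⁻ τ, K x y τ ∂(betaM b)) ∂(mub n ln b)) * G y := by
        rw [lintegral_lintegral_swap hKy.aemeasurable]
    _ ≤ _ := by
        gcongr
        refine le_trans (le_of_eq ?_) (h ln y t hy ht)
        simp_rw [hK, gk_comm ln b _ _ y]

/-- The parameters for which `ker` is a second derivative, or a normal quotient of a first
derivative, of the heat-type kernel. -/
inductive Adm (b : ℝ) : ℝ → ℝ → Option (Fin n) → Option (Fin n) → Prop
  | deriv (i j : Fin n) : Adm b (1 / 4) (if i = j then -1 / 2 else 0) (some i) (some j)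
  | normal : Adm b (1 / (4 * b)) (-1 / 2) none none

lemma Adm.continuous_Sop {b κ c : ℝ} {i j : Option (Fin n)} (h : Adm b κ c i j) (hg : BddSupp g)
    (ln : Fin n) (hb : 0 < b) {s T : ℝ} (hs : 0 < s) (hsT : s ≤ T) :
    Continuous (Sop ln b κ c i j s T g) := by
  cases h with
  | deriv i j =>
    have hA := amplitude_heatAmp hg ln hb hs hsT
    rw [← pd_pd_Pot hg ln hb hs hsT, Pot_eq]
    exact ((((Nice.base _ hA).pd measurable_heatRate (measurable_heatShift ln) j).pd
      measurable_heatRate (measurable_heatShift ln) i).differentiable measurable_heatRate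
      (measurable_heatShift ln)).continuous
  | normal =>
    rw [Sop_none_eq]
    exact ((Nice.base _ (amplitude_normalMult hg ln hb hs hsT)).differentiable measurable_heatRate
      (measurable_heatShift ln)).continuous

lemma exists_lintegral_Sop_sq_le (n : ℕ) {b : ℝ} (hb : 0 < b) : ∃ C > 0, ∀ (κ c : ℝ)
    (i j : Option (Fin n)), Adm b κ c i j → ∀ (ln : Fin n) (g : Eu n → ℝ), BddSupp g →
    ∀ s T, 0 < s → s ≤ T →
    ∫⁻ x, ENNReal.ofReal (Sop ln b κ c i j s T g x ^ 2) ∂(mub n ln b) ≤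
      ENNReal.ofReal (C * ∫ x, g x ^ 2 ∂(mub n ln b)) := by
  obtain ⟨C, hC, h⟩ := exists_lintegral_heatOp_sq_le n hb
  refine ⟨(1 + 1 / b) * (4 * C), by positivity, fun κ c i j hadm ln g hg s T hs hsT => ?_⟩
  have mq := measurable_heatRate (n := n)
  have mζ := measurable_heatShift ln
  have hu : Nice (m3 ln b s T) heatRate (heatShift ln) (Pot ln b s T g) := by
    rw [Pot_eq]; exact .base _ (amplitude_heatAmp hg ln hb hs hsT)
  have hv : Nice (m3 ln b s T) heatRate (heatShift ln)
      (Sop ln b (1 / (4 * b)) (-1 / 2) none none s T g) := by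
    rw [Sop_none_eq]; exact .base _ (amplitude_normalMult hg ln hb hs hsT)
  have huv := pd_Pot_normal hg ln hb hs hsT
  set X := ∫ x, (∑ i, pd (pd (Pot ln b s T g) i) i x +
      b * Sop ln b (1 / (4 * b)) (-1 / 2) none none s T g x) ^ 2 ∂(mub n ln b) with hX
  have hX0 : 0 ≤ X := integral_nonneg fun x => sq_nonneg _
  set J := ∫ x, g x ^ 2 ∂(mub n ln b)
  have hJ0 : 0 ≤ J := integral_nonneg fun x => sq_nonneg _
  have hXle : X ≤ 4 * C * J := by
    have hgm := hg.measurable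
    rw [hX, integral_eq_lintegral_of_nonneg_ae (ae_of_all _ fun _ => sq_nonneg _)]
    · refine ENNReal.toReal_le_of_le_ofReal (by positivity) ?_
      calc _ ≤ ∫⁻ x, (2 * ENNReal.ofReal (heatOp ln b g T x ^ 2) +
              2 * ENNReal.ofReal (heatOp ln b g s x ^ 2)) ∂(mub n ln b) := by
            refine lintegral_mono_ae ?_
            filter_upwards [mub_ae_upper ln b] with x hx
            rw [laplace_Pot hg ln hb hs hsT hx.le, show (2 : ℝ≥0∞) = ENNReal.ofReal 2 by simp,
              ← ENNReal.ofReal_mul (by norm_num), ← ENNReal.ofReal_mul (by norm_num),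
              ← ENNReal.ofReal_add (by positivity) (by positivity)]
            apply ENNReal.ofReal_le_ofReal
            nlinarith [sq_nonneg (heatOp ln b g T x + heatOp ln b g s x)]
        _ ≤ (∫⁻ x, 2 * ENNReal.ofReal (heatOp ln b g T x ^ 2) ∂(mub n ln b)) +
              ∫⁻ x, 2 * ENNReal.ofReal (heatOp ln b g s x ^ 2) ∂(mub n ln b) := by
            have hm : Measurable (heatOp ln b g T) := by
              refine (StronglyMeasurable.integral_prod_right' (f := fun p : Eu n × (Eu n × ℝ) =>
                gk ln b (1 / 4) p.1 p.2.1 p.2.2 T * g p.2.1) ?_).measurable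
              refine Measurable.stronglyMeasurable (Measurable.mul ?_ (by fun_prop))
              exact (measurable_gk ln b (1 / 4)).comp (by fun_prop : Measurable
                fun p : Eu n × (Eu n × ℝ) => (((p.1, p.2.1), p.2.2), T))
            rw [lintegral_add_left (by fun_prop)]
        _ ≤ 2 * ENNReal.ofReal (C * J) + 2 * ENNReal.ofReal (C * J) := by
            rw [lintegral_const_mul' _ _ (by simp), lintegral_const_mul' _ _ (by simp)]
            gcongr
            · exact h ln g T hg (hs.trans_le hsT)
            · exact h ln g s hg hs
        _ = _ := by
            rw [← two_mul, show (2 : ℝ≥0∞) = ENNReal.ofReal 2 by simp,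
              ← ENNReal.ofReal_mul (by norm_num), ← ENNReal.ofReal_mul (by norm_num)]
            congr 1; ring
    · have hc := hv.differentiable mq mζ
      have hc2 := fun i => ((hu.pd mq mζ i).pd mq mζ i).differentiable mq mζ
      have := hc.continuous
      have := fun i => (hc2 i).continuous
      exact Continuous.aestronglyMeasurable (by fun_prop)
  have fin : ∀ φ : Eu n → ℝ, Nice (m3 ln b s T) heatRate (heatShift ln) φ →
      ∫ x, φ x ^ 2 ∂(mub n ln b) ≤ (1 + 1 / b) * X →
      ∫⁻ x, ENNReal.ofReal (φ x ^ 2) ∂(mub n ln b) ≤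
        ENNReal.ofReal ((1 + 1 / b) * (4 * C) * J) := by
    intro φ hφ hle
    rw [← ofReal_integral_eq_lintegral_ofReal (hφ.sq.integrable_mub mq mζ ln hb)
      (ae_of_all _ fun _ => sq_nonneg _)]
    apply ENNReal.ofReal_le_ofReal
    calc _ ≤ _ := hle
      _ ≤ (1 + 1 / b) * (4 * C * J) := by gcongr
      _ = _ := by ring
  have hbi : 0 ≤ 1 / b * X := by positivity
  cases hadm with
  | deriv i j =>
    rw [← pd_pd_Pot hg ln hb hs hsT]
    refine fin _ ((hu.pd mq mζ j).pd mq mζ i) ?_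
    have := integral_pd_pd_sq_le hu hv mq mζ hb huv i j
    linarith
  | normal =>
    refine fin _ hv ?_
    have := integral_normal_quotient_sq_le hu hv mq mζ hb huv
    calc _ = 1 / b * (b * ∫ x, Sop ln b (1 / (4 * b)) (-1 / 2) none none s T g x ^ 2
          ∂(mub n ln b)) := by field_simp
      _ ≤ 1 / b * X := by gcongr
      _ ≤ _ := by linarith

end Horiuchi

namespace Horiuchi

variable {n : ℕ}

/-- The label of the grid cell of side `h` containing `x`. -/
def lab (h : ℝ) (x : Eu n) : Fin n → ℤ := fun i => ⌊x i / h⌋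

lemma measurable_lab (h : ℝ) : Measurable (lab h : Eu n → Fin n → ℤ) :=
  measurable_pi_lambda _ fun i => Int.measurable_floor.comp (by fun_prop)

/-- The grid cell of side `h` with label `k`. -/
def cell (h : ℝ) (k : Fin n → ℤ) : Set (Eu n) := lab h ⁻¹' {k}

lemma measurableSet_cell (h : ℝ) (k : Fin n → ℤ) : MeasurableSet (cell h k) :=
  measurable_lab h (measurableSet_singleton k)

lemma mem_cell {h : ℝ} {k : Fin n → ℤ} {x : Eu n} : x ∈ cell h k ↔ lab h x = k := Iff.rfl

lemma lab_half {h : ℝ} {x y : Eu n} (hxy : lab (h / 2) x = lab (h / 2) y) :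
    lab h x = lab h y := by
  funext i
  have key : ∀ z : Eu n, ⌊z i / h⌋ = ⌊z i / (h / 2)⌋ / 2 := fun z => by
    have := Int.floor_div_natCast (z i / (h / 2)) 2
    rw [show z i / (h / 2) / ((2 : ℕ) : ℝ) = z i / h by push_cast; field_simp] at this
    simpa using this
  have hi : ⌊x i / (h / 2)⌋ = ⌊y i / (h / 2)⌋ := congrFun hxy i
  simp only [lab, key, hi]

lemma norm_sub_le_of_lab_eq {h : ℝ} (hh : 0 < h) {x y : Eu n} (hxy : lab h x = lab h y) :
    ‖x - y‖ ≤ n * h := by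
  have h1 : ∀ i, (x i - y i) ^ 2 ≤ h ^ 2 := fun i => by
    have hi : ⌊x i / h⌋ = ⌊y i / h⌋ := congrFun hxy i
    have := Int.abs_sub_lt_one_of_floor_eq_floor hi
    rw [← sub_div, abs_div, abs_of_pos hh, div_lt_one hh] at this
    rw [← sq_abs]
    gcongr
  refine le_of_sq_le_sq ?_ (by positivity)
  rw [norm_sq_sub_eq_sum]
  calc _ ≤ ∑ _i : Fin n, h ^ 2 := Finset.sum_le_sum fun i _ => h1 i
    _ = n * h ^ 2 := by simp
    _ ≤ n ^ 2 * h ^ 2 := by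
      gcongr
      exact_mod_cast Nat.le_self_pow two_ne_zero n
    _ = _ := by ring

lemma nontrivial_eu (ln : Fin n) : Nontrivial (Eu n) := by
  have : Nonempty (Fin n) := ⟨ln⟩
  infer_instance

lemma mub_closedBall_le (ln : Fin n) {b : ℝ} (hb : 0 < b) {x : Eu n} {ρ : ℝ} (hρ : 0 ≤ ρ) :
    mub n ln b (Metric.closedBall x ρ) ≤
      ENNReal.ofReal ((x ln + ρ) ^ b * ρ ^ n) * volume (Metric.ball (0 : Eu n) 1) := by
  rw [mub_apply ln b measurableSet_closedBall]
  have h1 : ∀ z ∈ Metric.closedBall x ρ ∩ upper ln,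
      ENNReal.ofReal (z ln ^ b) ≤ ENNReal.ofReal ((x ln + ρ) ^ b) := by
    rintro z ⟨hz, hz' : 0 < z ln⟩
    rw [mem_closedBall_iff_norm] at hz
    have := (abs_coord_le (z - x) ln).trans hz
    rw [PiLp.sub_apply] at this
    apply ENNReal.ofReal_le_ofReal
    have := (abs_le.1 this).2
    apply Real.rpow_le_rpow hz'.le (by linarith) hb.le
  by_cases hx : 0 ≤ x ln + ρ
  · calc _ ≤ ∫⁻ _z in Metric.closedBall x ρ ∩ upper ln, ENNReal.ofReal ((x ln + ρ) ^ b) :=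
          setLIntegral_mono measurable_const h1
      _ = ENNReal.ofReal ((x ln + ρ) ^ b) * volume (Metric.closedBall x ρ ∩ upper ln) := by
          rw [setLIntegral_const]
      _ ≤ ENNReal.ofReal ((x ln + ρ) ^ b) * volume (Metric.closedBall x ρ) := by
          gcongr; exact Set.inter_subset_left
      _ = _ := by
          rw [Measure.addHaar_closedBall _ _ hρ, ENNReal.ofReal_mul (by positivity), mul_assoc]
          simp
  · have : Metric.closedBall x ρ ∩ upper ln = ∅ := by
      rw [Set.eq_empty_iff_forall_notMem]
      rintro z ⟨hz, hz' : 0 < z ln⟩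
      rw [mem_closedBall_iff_norm] at hz
      have := (abs_coord_le (z - x) ln).trans hz
      rw [PiLp.sub_apply] at this
      have := (abs_le.1 this).2
      linarith
    rw [this]
    simp

lemma le_mub_cell (ln : Fin n) {b : ℝ} (hb : 0 < b) {x : Eu n} (hx : 0 < x ln) {h : ℝ}
    (hh : 0 < h) :
    ENNReal.ofReal (((x ln + h) / 4) ^ b * (h / 4) ^ n) * volume (Metric.ball (0 : Eu n) 1) ≤
      mub n ln b (cell h (lab h x)) := by
  have := nontrivial_eu ln
  obtain ⟨z, hz⟩ : ∃ z : Eu n, ∀ i, z i =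
      (⌊x i / h⌋ : ℝ) * h + (if i = ln then 3 / 4 else 1 / 2) * h :=
    ⟨WithLp.toLp 2 fun i => (⌊x i / h⌋ : ℝ) * h + (if i = ln then 3 / 4 else 1 / 2) * h,
      fun i => rfl⟩
  have h1 : ∀ w ∈ Metric.ball z (h / 4), ∀ i, |w i - z i| < h / 4 := fun w hw i => by
    have := (abs_coord_le (w - z) i).trans_lt (mem_ball_iff_norm.1 hw)
    rwa [PiLp.sub_apply] at this
  have hfl : ∀ i, (⌊x i / h⌋ : ℝ) * h ≤ x i ∧ x i < (⌊x i / h⌋ : ℝ) * h + h := fun i => by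
    have e1 := Int.floor_le (x i / h)
    have e2 := Int.lt_floor_add_one (x i / h)
    rw [le_div_iff₀ hh] at e1
    rw [div_lt_iff₀ hh] at e2
    exact ⟨e1, by linarith⟩
  have hk : (0 : ℝ) ≤ (⌊x ln / h⌋ : ℝ) * h :=
    mul_nonneg (by exact_mod_cast Int.floor_nonneg.2 (by positivity)) hh.le
  have h2 : ∀ w ∈ Metric.ball z (h / 4), (x ln + h) / 4 ≤ w ln := fun w hw => by
    have e := (abs_lt.1 (h1 w hw ln)).1
    rw [hz ln, if_pos rfl] at e
    linarith [(hfl ln).2]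
  have hsub : Metric.ball z (h / 4) ⊆ cell h (lab h x) ∩ upper ln := fun w hw => by
    refine ⟨?_, lt_of_lt_of_le (by positivity) (h2 w hw)⟩
    rw [mem_cell]
    funext i
    simp only [lab]
    rw [Int.floor_eq_iff, le_div_iff₀ hh, div_lt_iff₀ hh]
    have e := abs_lt.1 (h1 w hw i)
    rw [hz i] at e
    split_ifs at e
    · exact ⟨by linarith, by linarith⟩
    · exact ⟨by linarith, by linarith⟩
  rw [mub_apply ln b (measurableSet_cell _ _)]
  calc _ = ENNReal.ofReal (((x ln + h) / 4) ^ b) * volume (Metric.ball z (h / 4)) := by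
        rw [Measure.addHaar_ball volume z (by positivity), ENNReal.ofReal_mul (by positivity),
          mul_assoc]
        simp
    _ = ∫⁻ _w in Metric.ball z (h / 4), ENNReal.ofReal (((x ln + h) / 4) ^ b) := by
        rw [setLIntegral_const]
    _ ≤ ∫⁻ w in Metric.ball z (h / 4), ENNReal.ofReal (w ln ^ b) :=
        setLIntegral_mono (measurable_weight ln b) fun w hw => ENNReal.ofReal_le_ofReal
          (Real.rpow_le_rpow (by positivity) (h2 w hw) hb.le)
    _ ≤ _ := lintegral_mono_set hsub

/-- Doubling: balls are controlled by grid cells of comparable size. -/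
lemma exists_mub_closedBall_le_cell (n : ℕ) {b : ℝ} (hb : 0 < b) (K : ℝ) : ∃ C > 0,
    ∀ (ln : Fin n) (x : Eu n) (h : ℝ), 0 < x ln → 0 < h →
    mub n ln b (Metric.closedBall x (K * h)) ≤
      ENNReal.ofReal C * mub n ln b (cell h (lab h x)) := by
  obtain ⟨L, hL1, hKL⟩ : ∃ L : ℝ, 1 ≤ L ∧ K ≤ L := ⟨max 1 K, le_max_left _ _, le_max_right _ _⟩
  have hL : 0 < L := by linarith
  refine ⟨(4 * L) ^ b * (4 * L) ^ n, by positivity, fun ln x h hx hh => ?_⟩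
  calc _ ≤ mub n ln b (Metric.closedBall x (L * h)) := by gcongr
    _ ≤ ENNReal.ofReal ((x ln + L * h) ^ b * (L * h) ^ n) * volume (Metric.ball (0 : Eu n) 1) :=
        mub_closedBall_le ln hb (by positivity)
    _ ≤ ENNReal.ofReal ((4 * L) ^ b * (4 * L) ^ n * (((x ln + h) / 4) ^ b * (h / 4) ^ n)) *
          volume (Metric.ball (0 : Eu n) 1) := by
        refine mul_le_mul' (ENNReal.ofReal_le_ofReal ?_) le_rfl
        have e1 : x ln + L * h ≤ 4 * L * ((x ln + h) / 4) := by nlinarith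
        have e2 : L * h ≤ 4 * L * (h / 4) := by linarith
        calc _ ≤ (4 * L * ((x ln + h) / 4)) ^ b * (4 * L * (h / 4)) ^ n := by
              gcongr
          _ = _ := by
              rw [Real.mul_rpow (by positivity) (by positivity), mul_pow]; ring
    _ = ENNReal.ofReal ((4 * L) ^ b * (4 * L) ^ n) *
          (ENNReal.ofReal (((x ln + h) / 4) ^ b * (h / 4) ^ n) *
            volume (Metric.ball (0 : Eu n) 1)) := by
        rw [ENNReal.ofReal_mul (by positivity), mul_assoc]
    _ ≤ _ := by gcongr; exact le_mub_cell ln hb hx hh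

lemma mub_closedBall_lt_top (ln : Fin n) {b : ℝ} (hb : 0 < b) (x : Eu n) (ρ : ℝ) :
    mub n ln b (Metric.closedBall x ρ) < ∞ := by
  rcases lt_or_ge ρ 0 with h | h
  · rw [Metric.closedBall_eq_empty.2 h]; simp
  · exact (mub_closedBall_le ln hb h).trans_lt
      (ENNReal.mul_lt_top ENNReal.ofReal_lt_top measure_ball_lt_top)

lemma cell_subset_closedBall {h : ℝ} (hh : 0 < h) {k : Fin n → ℤ} {x : Eu n} (hx : lab h x = k) :
    cell h k ⊆ Metric.closedBall x (n * h) := fun y hy => by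
  rw [mem_closedBall_iff_norm]
  exact norm_sub_le_of_lab_eq hh ((mem_cell.1 hy).trans hx.symm)

lemma mub_cell_lt_top (ln : Fin n) {b : ℝ} (hb : 0 < b) {h : ℝ} (hh : 0 < h) (k : Fin n → ℤ) :
    mub n ln b (cell h k) < ∞ := by
  rcases (cell h k).eq_empty_or_nonempty with h0 | ⟨x, hx⟩
  · rw [h0]; simp
  · exact (measure_mono (cell_subset_closedBall hh (mem_cell.1 hx))).trans_lt
      (mub_closedBall_lt_top ln hb _ _)

lemma isLocallyFiniteMeasure_mub (ln : Fin n) {b : ℝ} (hb : 0 < b) :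
    IsLocallyFiniteMeasure (mub n ln b) :=
  ⟨fun x => ⟨_, Metric.closedBall_mem_nhds x one_pos, mub_closedBall_lt_top ln hb x 1⟩⟩

end Horiuchi

namespace Horiuchi

variable {n : ℕ} {g : Eu n → ℝ}

lemma lab_dyadic_of_le {h : ℝ} {i j : ℕ} (hij : i ≤ j) {x y : Eu n}
    (hxy : lab (h / 2 ^ j) x = lab (h / 2 ^ j) y) : lab (h / 2 ^ i) x = lab (h / 2 ^ i) y := by
  induction j, hij using Nat.le_induction with
  | base => exact hxy
  | succ j _ ih =>
    refine ih (lab_half ?_)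
    rwa [div_div, ← pow_succ]

/-- The dyadic cell of generation `q.1` with label `q.2`. -/
def dcell (h : ℝ) (q : ℕ × (Fin n → ℤ)) : Set (Eu n) := cell (h / 2 ^ q.1) q.2

lemma measurableSet_dcell (h : ℝ) (q : ℕ × (Fin n → ℤ)) : MeasurableSet (dcell h q) :=
  measurableSet_cell _ _

lemma nonempty_of_lt_setIntegral (ln : Fin n) {b c : ℝ} (hc : 0 ≤ c) {s : Set (Eu n)}
    (hs : MeasurableSet s) (h : c < ∫ x in s, |g x| ∂(mub n ln b)) :
    ∃ x ∈ s, 0 < x ln ∧ g x ≠ 0 := by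
  by_contra! hne
  have : ∫ x in s, |g x| ∂(mub n ln b) = 0 := by
    refine integral_eq_zero_of_ae ?_
    filter_upwards [ae_restrict_of_ae (mub_ae_upper ln b), ae_restrict_mem hs] with x hx hxs
    simp [hne x hxs hx]
  linarith

/-- Calderón–Zygmund stopping-time selection with finitely many generations. -/
lemma exists_selection (hg : BddSupp g) (ln : Fin n) {b : ℝ} (hb : 0 < b) {h lam D : ℝ}
    (hh : 0 < h) (hlam : 0 < lam)
    (hD : ∀ (x : Eu n) (r : ℝ), 0 < x ln → 0 < r →
      mub n ln b (Metric.closedBall x (2 * n * r)) ≤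
        ENNReal.ofReal D * mub n ln b (cell r (lab r x)))
    (hD0 : 0 < D)
    (h0 : ∀ k, ∫ x in cell h k, |g x| ∂(mub n ln b) ≤ lam * (mub n ln b).real (cell h k))
    (m : ℕ) : ∃ F : Finset (ℕ × (Fin n → ℤ)),
      (F : Set (ℕ × (Fin n → ℤ))).Pairwise (Function.onFun Disjoint (dcell h)) ∧
      (∀ q ∈ F, lam * (mub n ln b).real (dcell h q) < ∫ x in dcell h q, |g x| ∂(mub n ln b) ∧
        ∫ x in dcell h q, |g x| ∂(mub n ln b) ≤ D * lam * (mub n ln b).real (dcell h q)) ∧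
      ∀ x ∉ ⋃ q ∈ F, dcell h q, ∫ z in cell (h / 2 ^ m) (lab (h / 2 ^ m) x), |g z| ∂(mub n ln b) ≤
        lam * (mub n ln b).real (cell (h / 2 ^ m) (lab (h / 2 ^ m) x)) := by
  classical
  obtain ⟨μ, hμ⟩ : ∃ μ, μ = mub n ln b := ⟨_, rfl⟩
  rw [← hμ] at h0 ⊢
  simp only [← hμ] at hD
  obtain ⟨R, hR, hsupp⟩ := hg.supp
  have hgi : Integrable (fun x => |g x|) μ := by rw [hμ]; exact (hg.integrable ln hb).abs
  let P : ℕ × (Fin n → ℤ) → Prop := fun q =>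
    lam * μ.real (dcell h q) < ∫ x in dcell h q, |g x| ∂μ
  let S : Set (ℕ × (Fin n → ℤ)) := {q | q.1 ≤ m ∧ P q ∧
    ∃ x, lab (h / 2 ^ q.1) x = q.2 ∧ ∀ i < q.1, ¬ P (i, lab (h / 2 ^ i) x)}
  have hne : ∀ q, P q → ∃ x ∈ dcell h q, 0 < x ln ∧ g x ≠ 0 := fun q hq => by
    refine nonempty_of_lt_setIntegral (b := b) ln (c := lam * μ.real (dcell h q)) (by positivity)
      (measurableSet_dcell h q) ?_
    rw [← hμ]; exact hq
  have hS : S.Finite := by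
    let bd : ℕ → ℤ := fun j => ⌈R / (h / 2 ^ j)⌉
    refine Set.Finite.subset (s := ⋃ j ∈ Set.Iic m,
      (fun k => (j, k)) '' Set.Icc (fun _ : Fin n => -bd j) (fun _ => bd j)) ?_ ?_
    · exact (Set.finite_Iic m).biUnion fun j _ => (Set.finite_Icc _ _).image _
    · rintro ⟨j, k⟩ ⟨hj, hP, -⟩
      obtain ⟨x, hx, -, hgx⟩ := hne _ hP
      have hx' : lab (h / 2 ^ j) x = k := hx
      refine Set.mem_biUnion hj ⟨k, ?_, rfl⟩
      have hpos : 0 < h / 2 ^ j := by positivity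
      have hxi : ∀ i, |x i / (h / 2 ^ j)| ≤ R / (h / 2 ^ j) := fun i => by
        rw [abs_div, abs_of_pos hpos]
        gcongr
        exact (abs_coord_le x i).trans (hsupp x hgx)
      constructor
      · intro i
        rw [← hx']
        simp only [lab, Int.le_floor, bd]
        push_cast
        linarith [Int.le_ceil (R / (h / 2 ^ j)), (abs_le.1 (hxi i)).1]
      · intro i
        rw [← hx']
        simp only [lab, bd]
        exact (Int.floor_le_ceil _).trans (Int.ceil_le_ceil (abs_le.1 (hxi i)).2)
  refine ⟨hS.toFinset, ?_, ?_, ?_⟩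
  · rw [Set.Finite.coe_toFinset]
    have key : ∀ q ∈ S, ∀ q' ∈ S, q.1 ≤ q'.1 → ∀ z, z ∈ dcell h q → z ∈ dcell h q' → q = q' := by
      rintro ⟨j, k⟩ hq ⟨j', k'⟩ hq' hle z (hz : lab _ z = k) (hz' : lab _ z = k')
      rcases hle.eq_or_lt with e | hlt
      · dsimp only at e; subst e; rw [← hz, ← hz']
      · obtain ⟨-, -, x, hx, hx2⟩ := hq'
        have : lab (h / 2 ^ j') x = lab (h / 2 ^ j') z := hx.trans hz'.symm
        have e2 := lab_dyadic_of_le hlt.le this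
        refine absurd ?_ (hx2 j hlt)
        rw [e2]
        dsimp only at hz
        rw [hz]
        exact hq.2.1
    intro q hq q' hq' hqq'
    refine Set.disjoint_left.2 fun z hz hz' => ?_
    rcases le_total q.1 q'.1 with hle | hle
    · exact hqq' (key q hq q' hq' hle z hz hz')
    · exact hqq' (key q' hq' q hq hle z hz' hz).symm
  · intro q hq
    rw [Set.Finite.mem_toFinset] at hq
    obtain ⟨j, k⟩ := q
    obtain ⟨hj, hP, x, hx, hx2⟩ := hq
    refine ⟨hP, ?_⟩
    obtain ⟨z, hz, hz0, -⟩ := hne _ hP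
    have hz' : lab (h / 2 ^ j) z = k := hz
    cases j with
    | zero =>
      exfalso
      have h1 : lam * μ.real (dcell h (0, k)) < ∫ x in dcell h (0, k), |g x| ∂μ := hP
      simp only [dcell, pow_zero, div_one] at h1
      exact absurd (h0 k) (not_le.2 h1)
    | succ j =>
      have hpos : 0 < h / 2 ^ (j + 1) := by positivity
      have hxz : lab (h / 2 ^ j) x = lab (h / 2 ^ j) z :=
        lab_dyadic_of_le (Nat.le_succ j) (hx.trans hz'.symm)
      have h1 := hx2 j (Nat.lt_succ_self j)
      rw [hxz] at h1
      have h1' := not_lt.1 h1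
      have hsub : dcell h (j + 1, k) ⊆ dcell h (j, lab (h / 2 ^ j) z) := fun w hw =>
        lab_dyadic_of_le (Nat.le_succ j) ((show lab (h / 2 ^ (j + 1)) w = k from hw).trans hz'.symm)
      have hsub2 : dcell h (j, lab (h / 2 ^ j) z) ⊆
          Metric.closedBall z (2 * n * (h / 2 ^ (j + 1))) := by
        have := cell_subset_closedBall (show 0 < h / 2 ^ j by positivity) (x := z) rfl
        rw [show 2 * (n : ℝ) * (h / 2 ^ (j + 1)) = n * (h / 2 ^ j) by rw [pow_succ]; field_simp]
        exact this
      have hdb : μ.real (dcell h (j, lab (h / 2 ^ j) z)) ≤ D * μ.real (dcell h (j + 1, k)) := by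
        have h3 := (measure_mono hsub2).trans (hD z _ hz0 hpos)
        rw [hz'] at h3
        have h4 : μ (cell (h / 2 ^ (j + 1)) k) ≠ ∞ := by
          rw [hμ]; exact (mub_cell_lt_top ln hb hpos k).ne
        have h5 := ENNReal.toReal_mono (ENNReal.mul_ne_top ENNReal.ofReal_ne_top h4) h3
        rwa [ENNReal.toReal_mul, ENNReal.toReal_ofReal hD0.le] at h5
      calc _ ≤ ∫ x in dcell h (j, lab (h / 2 ^ j) z), |g x| ∂μ :=
            setIntegral_mono_set hgi.integrableOn (ae_of_all _ fun _ => abs_nonneg _)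
              (ae_of_all _ hsub)
        _ ≤ lam * μ.real (dcell h (j, lab (h / 2 ^ j) z)) := h1'
        _ ≤ lam * (D * μ.real (dcell h (j + 1, k))) := by gcongr
        _ = _ := by ring
  · intro x hx
    by_contra hlt
    rw [not_le] at hlt
    have hex : ∃ j, P (j, lab (h / 2 ^ j) x) := ⟨m, hlt⟩
    refine hx (Set.mem_biUnion (x := (Nat.find hex, lab (h / 2 ^ Nat.find hex) x)) ?_ rfl)
    rw [Finset.mem_coe, Set.Finite.mem_toFinset]
    exact ⟨Nat.find_min' hex hlt, Nat.find_spec hex, x, rfl, fun i hi => Nat.find_min hex hi⟩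

end Horiuchi

namespace Horiuchi

variable {n : ℕ} {g : Eu n → ℝ}

lemma BddSupp.sq (hg : BddSupp g) : BddSupp (fun y => g y ^ 2) := by
  obtain ⟨M, hM, h1⟩ := hg.bdd
  simp_rw [pow_two]
  exact hg.mul_of_bounded hg.measurable h1

/-- On a union of sufficiently small cells with small averages, the square integral is controlled
by the `L¹` norm. -/
lemma exists_level (hg : BddSupp g) (ln : Fin n) {b : ℝ} (hb : 0 < b) {h lam : ℝ} (hh : 0 < h)
    (hlam : 0 < lam) (hI : 0 < ∫ x, |g x| ∂(mub n ln b)) :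
    ∃ m : ℕ, ∀ N : Set (Eu n), MeasurableSet N →
      (∀ x ∈ N, ∫ z in cell (h / 2 ^ m) (lab (h / 2 ^ m) x), |g z| ∂(mub n ln b) ≤
        lam * (mub n ln b).real (cell (h / 2 ^ m) (lab (h / 2 ^ m) x))) →
      ∫ x in N, g x ^ 2 ∂(mub n ln b) ≤ 3 * lam * ∫ x, |g x| ∂(mub n ln b) := by
  have hfin := fun r (hr : 0 < r) => mub_cell_lt_top (n := n) ln hb (h := r) hr
  have hgi := (hg.integrable ln hb).abs
  have hg2 := hg.sq.integrable ln hb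
  have := isLocallyFiniteMeasure_mub ln hb
  generalize mub n ln b = μ at *
  have hreg : μ.Regular := inferInstance
  obtain ⟨M, hM, hgM⟩ := hg.bdd
  obtain ⟨I, hIe⟩ : ∃ I, I = ∫ x, |g x| ∂μ := ⟨_, rfl⟩
  rw [← hIe] at hI ⊢
  obtain ⟨φ, hφc, hφ1, hφ2, hφ3⟩ := hgi.exists_hasCompactSupport_integral_sub_le
    (ε := lam * I / (2 * (M + 1))) (by positivity)
  have huc := hφc.uniformContinuous_of_continuous hφ2
  rw [Metric.uniformContinuous_iff] at huc
  obtain ⟨δ, hδ, huc⟩ := huc lam hlam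
  obtain ⟨m, hm⟩ : ∃ m : ℕ, n * (h / 2 ^ m) < δ := by
    obtain ⟨m, hm⟩ := pow_unbounded_of_one_lt (n * h / δ) (one_lt_two : (1 : ℝ) < 2)
    refine ⟨m, ?_⟩
    rw [div_lt_iff₀ hδ] at hm
    rw [← mul_div_assoc, div_lt_iff₀ (by positivity)]
    linarith
  refine ⟨m, fun N hN hav => ?_⟩
  have hpos : 0 < h / 2 ^ m := by positivity
  obtain ⟨d, hd⟩ : ∃ d, d = h / 2 ^ m := ⟨_, rfl⟩
  rw [← hd] at hpos hm
  simp_rw [← hd] at hav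
  have hdi : Integrable (fun x => |(|g x| - φ x)|) μ := (hgi.sub hφ3).abs
  have hpw : ∀ k, ∫ x in N ∩ cell d k, g x ^ 2 ∂μ ≤
      2 * lam * (∫ x in N ∩ cell d k, |g x| ∂μ) + 2 * M * ∫ x in cell d k, |(|g x| - φ x)| ∂μ := by
    intro k
    have he0 : 0 ≤ ∫ x in cell d k, |(|g x| - φ x)| ∂μ := integral_nonneg fun _ => abs_nonneg _
    have hg0 : 0 ≤ ∫ x in N ∩ cell d k, |g x| ∂μ := integral_nonneg fun _ => abs_nonneg _
    rcases eq_or_ne (μ (cell d k)) 0 with h0 | h0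
    · have : μ (N ∩ cell d k) = 0 := measure_mono_null Set.inter_subset_right h0
      rw [setIntegral_measure_zero _ this, setIntegral_measure_zero _ this,
        setIntegral_measure_zero _ h0]
      simp
    have hmk : 0 < μ.real (cell d k) := ENNReal.toReal_pos h0 (hfin d hpos k).ne
    obtain ⟨e, he⟩ : ∃ e, e = ∫ x in cell d k, |(|g x| - φ x)| ∂μ := ⟨_, rfl⟩
    rw [← he] at he0 ⊢
    have hφx : ∀ x ∈ N ∩ cell d k, φ x ≤ 2 * lam + e / μ.real (cell d k) := by
      rintro x ⟨hxN, hxk : lab d x = k⟩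
      have h1 := hav x hxN
      rw [hxk] at h1
      have h2 : ∫ z in cell d k, φ x ∂μ ≤
          ∫ z in cell d k, (|g z| + |(|g z| - φ z)| + lam) ∂μ := by
        have hcf : IntegrableOn (fun _ => φ x) (cell d k) μ := integrableOn_const (hfin d hpos k).ne
        have hcl : IntegrableOn (fun _ => lam) (cell d k) μ := integrableOn_const (hfin d hpos k).ne
        refine setIntegral_mono_on hcf ((hgi.integrableOn.add hdi.integrableOn).add hcl)
          (measurableSet_cell d k) fun z hz => ?_
        have e1 := huc (show dist x z < δ from by
          rw [dist_eq_norm]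
          exact (norm_sub_le_of_lab_eq hpos (hxk.trans (mem_cell.1 hz).symm)).trans_lt hm)
        rw [Real.dist_eq] at e1
        have := (abs_lt.1 e1).2
        have := neg_le_abs (|g z| - φ z)
        linarith
      have hcl : IntegrableOn (fun _ => lam) (cell d k) μ := integrableOn_const (hfin d hpos k).ne
      have h3 : ∫ z in cell d k, (|g z| + |(|g z| - φ z)| + lam) ∂μ =
          (∫ z in cell d k, |g z| ∂μ) + e + lam * μ.real (cell d k) := by
        have e1 : ∫ z in cell d k, (|g z| + |(|g z| - φ z)|) ∂μ = (∫ z in cell d k, |g z| ∂μ) + e := by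
          rw [he]; exact integral_add hgi.integrableOn hdi.integrableOn
        rw [← e1]
        refine (integral_add (hgi.integrableOn.add hdi.integrableOn) hcl).trans ?_
        rw [setIntegral_const, smul_eq_mul, mul_comm lam]
        rfl
      rw [h3, setIntegral_const, smul_eq_mul] at h2
      have h4 : φ x * μ.real (cell d k) ≤ (2 * lam + e / μ.real (cell d k)) * μ.real (cell d k) := by
        rw [add_mul, div_mul_cancel₀ _ hmk.ne']
        linarith
      exact le_of_mul_le_mul_right h4 hmk
    have hc0 : 0 ≤ 2 * lam + e / μ.real (cell d k) := by positivity
    have hNm : MeasurableSet (N ∩ cell d k) := hN.inter (measurableSet_cell d k)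
    have h5 : ∫ x in N ∩ cell d k, g x ^ 2 ∂μ ≤ ∫ x in N ∩ cell d k,
        ((2 * lam + e / μ.real (cell d k)) * |g x| + M * |(|g x| - φ x)|) ∂μ := by
      refine setIntegral_mono_on hg2.integrableOn ((hgi.integrableOn.const_mul _).add
        (hdi.integrableOn.const_mul _)) hNm fun x hx => ?_
      have e1 := hφx x hx
      have e2 := le_abs_self (|g x| - φ x)
      have e3 := hgM x
      have e4 := abs_nonneg (g x)
      rw [← sq_abs]
      have e5 : |g x| * |g x| ≤ |g x| * (2 * lam + e / μ.real (cell d k) + |(|g x| - φ x)|) := by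
        apply mul_le_mul_of_nonneg_left _ e4
        linarith
      have e6 : |g x| * |(|g x| - φ x)| ≤ M * |(|g x| - φ x)| :=
        mul_le_mul_of_nonneg_right e3 (abs_nonneg _)
      nlinarith
    have h6 : ∫ x in N ∩ cell d k,
        ((2 * lam + e / μ.real (cell d k)) * |g x| + M * |(|g x| - φ x)|) ∂μ =
        (2 * lam + e / μ.real (cell d k)) * (∫ x in N ∩ cell d k, |g x| ∂μ) +
          M * ∫ x in N ∩ cell d k, |(|g x| - φ x)| ∂μ := by
      refine (integral_add (hgi.integrableOn.const_mul _) (hdi.integrableOn.const_mul _)).trans ?_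
      rw [integral_const_mul, integral_const_mul]
    have h7 : ∫ x in N ∩ cell d k, |(|g x| - φ x)| ∂μ ≤ e := by
      rw [he]
      exact setIntegral_mono_set hdi.integrableOn (ae_of_all _ fun _ => abs_nonneg _)
        (ae_of_all _ Set.inter_subset_right)
    have h8 : ∫ x in N ∩ cell d k, |g x| ∂μ ≤ M * μ.real (cell d k) := by
      calc _ ≤ ∫ x in cell d k, |g x| ∂μ := setIntegral_mono_set hgi.integrableOn
              (ae_of_all _ fun _ => abs_nonneg _) (ae_of_all _ Set.inter_subset_right)
        _ ≤ ∫ x in cell d k, M ∂μ := by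
            exact setIntegral_mono_on hgi.integrableOn (integrableOn_const (hfin d hpos k).ne)
              (measurableSet_cell d k) fun x _ => hgM x
        _ = _ := by rw [setIntegral_const, smul_eq_mul, mul_comm]
    have h9 : e / μ.real (cell d k) * (∫ x in N ∩ cell d k, |g x| ∂μ) ≤ M * e := by
      calc _ ≤ e / μ.real (cell d k) * (M * μ.real (cell d k)) := by gcongr
        _ = _ := by field_simp
    rw [h6, add_mul] at h5
    nlinarith [mul_le_mul_of_nonneg_left h7 hM]
  have hU : ⋃ k, cell d k = (Set.univ : Set (Eu n)) :=
    Set.eq_univ_of_forall fun x => Set.mem_iUnion.2 ⟨lab d x, rfl⟩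
  have hdisj : Pairwise (Function.onFun Disjoint fun k => (cell d k : Set (Eu n))) :=
    fun k k' hkk' => Set.disjoint_left.2 fun x hx hx' =>
      hkk' ((mem_cell.1 hx).symm.trans (mem_cell.1 hx'))
  have hdisjN : Pairwise (Function.onFun Disjoint fun k => N ∩ (cell d k : Set (Eu n))) :=
    fun k k' hkk' => (hdisj hkk').mono Set.inter_subset_right Set.inter_subset_right
  have hUN : ⋃ k, N ∩ cell d k = N := by rw [← Set.inter_iUnion, hU, Set.inter_univ]
  have s1 := hasSum_integral_iUnion (fun k => hN.inter (measurableSet_cell d k)) hdisjN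
    (hg2.integrableOn (s := ⋃ k, N ∩ cell d k))
  have s2 := hasSum_integral_iUnion (fun k => hN.inter (measurableSet_cell d k)) hdisjN
    (hgi.integrableOn (s := ⋃ k, N ∩ cell d k))
  have s3 := hasSum_integral_iUnion (fun k => measurableSet_cell d k) hdisj
    (hdi.integrableOn (s := ⋃ k, cell d k))
  rw [hUN] at s1 s2
  rw [hU, setIntegral_univ] at s3
  have h10 := hasSum_le hpw s1 ((s2.mul_left (2 * lam)).add (s3.mul_left (2 * M)))
  have h11 : ∫ x in N, |g x| ∂μ ≤ I := by
    rw [hIe]; exact setIntegral_le_integral hgi (ae_of_all _ fun _ => abs_nonneg _)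
  have h12 : 2 * M * ∫ x, |(|g x| - φ x)| ∂μ ≤ lam * I := by
    calc _ ≤ 2 * M * (lam * I / (2 * (M + 1))) := by
          gcongr
          exact hφ1
      _ = M / (M + 1) * (lam * I) := by field_simp
      _ ≤ 1 * (lam * I) := by
          gcongr
          rw [div_le_one (by positivity)]; linarith
      _ = _ := one_mul _
  nlinarith [mul_le_mul_of_nonneg_left h11 hlam.le]

end Horiuchi

namespace Horiuchi

variable {n : ℕ} {g : Eu n → ℝ}

lemma exists_large_side (ln : Fin n) {b : ℝ} (hb : 0 < b) {lam I : ℝ} (hlam : 0 < lam) :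
    ∃ h > 0, ∀ x : Eu n, 0 < x ln →
      I ≤ lam * (mub n ln b).real (cell h (lab h x)) := by
  have hv0 : 0 < (volume : Measure (Eu n)).real (Metric.ball (0 : Eu n) 1) :=
    ENNReal.toReal_pos (Metric.measure_ball_pos _ _ one_pos).ne' measure_ball_lt_top.ne
  obtain ⟨v, hv⟩ : ∃ v, v = (volume : Measure (Eu n)).real (Metric.ball (0 : Eu n) 1) := ⟨_, rfl⟩
  rw [← hv] at hv0
  obtain ⟨L, hL⟩ : ∃ L : ℝ, L = max 1 (I / (lam * v)) := ⟨_, rfl⟩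
  have hL1 : 1 ≤ L := hL ▸ le_max_left _ _
  have hL2 : I ≤ lam * (L * v) := by
    have : I / (lam * v) ≤ L := hL ▸ le_max_right _ _
    rw [div_le_iff₀ (by positivity)] at this
    linarith
  refine ⟨4 * L, by positivity, fun x hx => hL2.trans ?_⟩
  gcongr
  have h1 := le_mub_cell ln hb hx (show 0 < 4 * L by positivity)
  have h2 := ENNReal.toReal_mono (mub_cell_lt_top ln hb (by positivity) _).ne h1
  rw [ENNReal.toReal_mul, ENNReal.toReal_ofReal (by positivity)] at h2
  refine le_trans ?_ h2
  change L * v ≤ _ * (volume : Measure (Eu n)).real (Metric.ball (0 : Eu n) 1)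
  rw [← hv]
  gcongr
  have e1 : 1 ≤ ((x ln + 4 * L) / 4) ^ b := Real.one_le_rpow (by linarith) hb.le
  have e2 : L ≤ (4 * L / 4) ^ n := by
    rw [mul_div_cancel_left₀ _ (by norm_num)]
    exact le_self_pow₀ hL1 (Fin.pos ln).ne'
  nlinarith

/-- Calderón–Zygmund decomposition of a bounded function of bounded support. -/
lemma exists_calderon_zygmund (n : ℕ) {b : ℝ} (hb : 0 < b) : ∃ C > 0, ∀ (ln : Fin n)
    (g : Eu n → ℝ) (lam : ℝ), BddSupp g → 0 < lam → 0 < ∫ x, |g x| ∂(mub n ln b) →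
    ∃ (F : Finset (ℕ × (Fin n → ℤ))) (G : Eu n → ℝ) (B : ℕ × (Fin n → ℤ) → Eu n → ℝ)
      (y : ℕ × (Fin n → ℤ) → Eu n) (r : ℕ × (Fin n → ℤ) → ℝ),
      BddSupp G ∧ (∀ x, g x = G x + ∑ q ∈ F, B q x) ∧
      ∫ x, G x ^ 2 ∂(mub n ln b) ≤ C * lam * ∫ x, |g x| ∂(mub n ln b) ∧
      (∀ q ∈ F, 0 < y q ln ∧ 0 < r q ∧ BddSupp (B q) ∧ (∀ z, B q z ≠ 0 → ‖y q - z‖ ≤ r q) ∧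
        ∫ x, B q x ∂(mub n ln b) = 0) ∧
      ∑ q ∈ F, ∫ x, |B q x| ∂(mub n ln b) ≤ C * ∫ x, |g x| ∂(mub n ln b) ∧
      ∑ q ∈ F, mub n ln b (Metric.closedBall (y q) (4 * r q)) ≤
        ENNReal.ofReal (C * lam⁻¹ * ∫ x, |g x| ∂(mub n ln b)) := by
  classical
  obtain ⟨D, hD0, hD⟩ := exists_mub_closedBall_le_cell n hb (2 * n)
  obtain ⟨E, hE0, hE⟩ := exists_mub_closedBall_le_cell n hb (4 * n)
  refine ⟨3 + D + E, by positivity, fun ln g lam hg hlam hI => ?_⟩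
  have hgi := hg.integrable ln hb
  obtain ⟨h, hh, hside⟩ := exists_large_side ln hb hlam
  obtain ⟨m, hm⟩ := exists_level hg ln hb hh hlam hI
  have h0 : ∀ k, ∫ x in cell h k, |g x| ∂(mub n ln b) ≤ lam * (mub n ln b).real (cell h k) := by
    intro k
    by_contra! hlt
    obtain ⟨x, hx, hx0, -⟩ := nonempty_of_lt_setIntegral ln (by positivity)
      (measurableSet_cell h k) hlt
    have := hside x hx0
    rw [mem_cell.1 hx] at this
    have h2 : ∫ x in cell h k, |g x| ∂(mub n ln b) ≤ ∫ x, |g x| ∂(mub n ln b) :=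
      setIntegral_le_integral hgi.abs (ae_of_all _ fun _ => abs_nonneg _)
    linarith
  obtain ⟨F, hF1, hF2, hF3⟩ := exists_selection hg ln hb hh hlam
    (fun x r => hD ln x r) hD0 h0 m
  have hpt : ∀ q, ∃ x, q ∈ F → x ∈ dcell h q ∧ 0 < x ln := fun q => by
    by_cases hq : q ∈ F
    · obtain ⟨x, hx, hx0, -⟩ := nonempty_of_lt_setIntegral ln (by positivity)
        (measurableSet_dcell h q) (hF2 q hq).1
      exact ⟨x, fun _ => ⟨hx, hx0⟩⟩
    · exact ⟨0, fun h => absurd h hq⟩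
  choose y hy using hpt
  have hfin : ∀ q, mub n ln b (dcell h q) ≠ ∞ := fun q =>
    (mub_cell_lt_top ln hb (by positivity) q.2).ne
  generalize hμ : mub n ln b = μ at *
  obtain ⟨I, hIe⟩ : ∃ I, I = ∫ x, |g x| ∂μ := ⟨_, rfl⟩
  rw [← hIe] at hI ⊢
  simp only [← hIe] at hm
  obtain ⟨avg, havg⟩ : ∃ avg : ℕ × (Fin n → ℤ) → ℝ, ∀ q, avg q =
    (∫ x in dcell h q, g x ∂μ) / μ.real (dcell h q) := ⟨_, fun _ => rfl⟩
  have hsumI : ∑ q ∈ F, ∫ x in dcell h q, |g x| ∂μ ≤ I := by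
    rw [hIe, ← integral_biUnion_finset F (fun q _ => measurableSet_dcell h q) hF1
      (fun q _ => hgi.abs.integrableOn)]
    exact setIntegral_le_integral hgi.abs (ae_of_all _ fun _ => abs_nonneg _)
  have havgμ : ∀ q, |avg q| * μ.real (dcell h q) ≤ ∫ x in dcell h q, |g x| ∂μ := fun q => by
    have hn : 0 ≤ ∫ x in dcell h q, |g x| ∂μ := integral_nonneg fun _ => abs_nonneg _
    rcases (measureReal_nonneg (μ := μ) (s := dcell h q)).eq_or_lt with e | e
    · rw [← e, mul_zero]; exact hn
    · rw [havg, abs_div, abs_of_pos e, div_mul_cancel₀ _ e.ne']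
      exact abs_integral_le_integral_abs
  have havgle : ∀ q ∈ F, |avg q| ≤ D * lam := fun q hq => by
    have hn : 0 ≤ ∫ x in dcell h q, |g x| ∂μ := integral_nonneg fun _ => abs_nonneg _
    rcases (measureReal_nonneg (μ := μ) (s := dcell h q)).eq_or_lt with e | e
    · rw [havg, ← e]; simp; positivity
    · exact le_of_mul_le_mul_right ((havgμ q).trans (hF2 q hq).2) e
  obtain ⟨B, hB⟩ : ∃ B : ℕ × (Fin n → ℤ) → Eu n → ℝ, ∀ q,
    B q = (dcell h q).indicator (fun x => g x - avg q) := ⟨_, fun _ => rfl⟩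
  have hcellsub : ∀ q ∈ F, ∀ z ∈ dcell h q, ‖y q - z‖ ≤ n * (h / 2 ^ q.1) := fun q hq z hz =>
    norm_sub_le_of_lab_eq (by positivity) ((mem_cell.1 (hy q hq).1).trans (mem_cell.1 hz).symm)
  have hBb : ∀ q ∈ F, BddSupp (B q) := fun q hq => by
    obtain ⟨M, hM, hgM⟩ := hg.bdd
    rw [hB]
    refine ⟨(hg.measurable.sub_const _).indicator (measurableSet_dcell h q), ⟨M + |avg q|,
      by positivity, fun x => ?_⟩, ‖y q‖ + n * (h / 2 ^ q.1), by positivity, fun x hx => ?_⟩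
    · rw [Set.indicator_apply]
      split_ifs
      · exact (abs_sub _ _).trans (by gcongr; exact hgM x)
      · rw [abs_zero]; positivity
    · have := hcellsub q hq x (Set.mem_of_indicator_ne_zero hx)
      have := norm_le_norm_add_norm_sub (y q) x
      linarith
  have hBint : ∀ q ∈ F, ∫ x, B q x ∂μ = 0 := fun q hq => by
    have hc : IntegrableOn (fun _ : Eu n => avg q) (dcell h q) μ := integrableOn_const (hfin q)
    rw [hB, integral_indicator (measurableSet_dcell h q)]
    refine (integral_sub hgi.integrableOn hc).trans ?_
    rw [setIntegral_const, smul_eq_mul, havg]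
    rcases (measureReal_nonneg (μ := μ) (s := dcell h q)).eq_or_lt with e | e
    · have h1 := (hF2 q hq).2
      have h2 := (hF2 q hq).1
      rw [← e] at h1 h2
      linarith
    · field_simp; ring
  have hBabs : ∀ q ∈ F, ∫ x, |B q x| ∂μ ≤ 2 * ∫ x in dcell h q, |g x| ∂μ := fun q hq => by
    have hc : IntegrableOn (fun _ : Eu n => |avg q|) (dcell h q) μ := integrableOn_const (hfin q)
    have e1 : (fun x => |B q x|) = (dcell h q).indicator (fun x => |g x - avg q|) := by
      funext x
      rw [hB, Set.indicator_apply, Set.indicator_apply]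
      split_ifs <;> simp
    rw [e1, integral_indicator (measurableSet_dcell h q)]
    have hc' : IntegrableOn (fun _ : Eu n => avg q) (dcell h q) μ := integrableOn_const (hfin q)
    calc _ ≤ ∫ x in dcell h q, (|g x| + |avg q|) ∂μ :=
          integral_mono (hgi.integrableOn.sub hc').abs (hgi.abs.integrableOn.add hc)
            fun x => abs_sub _ _
      _ = (∫ x in dcell h q, |g x| ∂μ) + |avg q| * μ.real (dcell h q) := by
          refine (integral_add hgi.abs.integrableOn hc).trans ?_
          rw [setIntegral_const, smul_eq_mul, mul_comm]
      _ ≤ _ := by linarith [havgμ q]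
  have hsumB : BddSupp (fun x => ∑ q ∈ F, B q x) := BddSupp.sum F hBb
  have hG : BddSupp (fun x => g x + (-1) * ∑ q ∈ F, B q x) :=
    hg.add (hsumB.mul_of_bounded (m := fun _ => -1) measurable_const (B := 1) (by simp))
  have hNm : MeasurableSet (⋃ q ∈ F, dcell h q)ᶜ :=
    (Finset.measurableSet_biUnion F fun q _ => measurableSet_dcell h q).compl
  have hGsq : ∀ x, (g x + (-1) * ∑ q ∈ F, B q x) ^ 2 ≤
      (⋃ q ∈ F, dcell h q)ᶜ.indicator (fun x => g x ^ 2) x +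
        ∑ q ∈ F, (dcell h q).indicator (fun _ => avg q ^ 2) x := by
    intro x
    have hnn : ∀ q ∈ F, 0 ≤ (dcell h q).indicator (fun _ => avg q ^ 2) x := fun q _ =>
      Set.indicator_nonneg (fun _ _ => sq_nonneg _) _
    by_cases hx : x ∈ ⋃ q ∈ F, dcell h q
    · rw [Set.indicator_of_notMem (by simpa using hx)]
      obtain ⟨q, hq, hxq⟩ := Set.mem_iUnion₂.1 hx
      have e1 : ∑ q' ∈ F, B q' x = B q x := by
        refine Finset.sum_eq_single q (fun q' hq' hne => ?_) fun h => absurd hq h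
        rw [hB, Set.indicator_of_notMem]
        exact fun hx' => Set.disjoint_left.1 (hF1 hq' hq hne) hx' hxq
      rw [e1, hB, Set.indicator_of_mem hxq, zero_add]
      refine le_trans (le_of_eq ?_) (Finset.single_le_sum hnn hq)
      rw [Set.indicator_of_mem hxq]; ring
    · rw [Set.indicator_of_mem (by simpa using hx)]
      have e1 : ∑ q' ∈ F, B q' x = 0 := Finset.sum_eq_zero fun q hq => by
        rw [hB, Set.indicator_of_notMem]
        exact fun hx' => hx (Set.mem_biUnion hq hx')
      rw [e1, mul_zero, add_zero]
      linarith [Finset.sum_nonneg hnn]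
  have hindi : ∀ q ∈ F, Integrable ((dcell h q).indicator (fun _ : Eu n => avg q ^ 2)) μ :=
    fun q _ => (integrable_indicator_iff (measurableSet_dcell h q)).2 (integrableOn_const (hfin q))
  have hg2i : Integrable (fun x => g x ^ 2) μ := hμ ▸ hg.sq.integrable ln hb
  have hG2i : Integrable (fun x => (g x + (-1) * ∑ q ∈ F, B q x) ^ 2) μ :=
    hμ ▸ hG.sq.integrable ln hb
  refine ⟨F, _, B, y, fun q => n * (h / 2 ^ q.1), hG, fun x => by ring, ?_, ?_, ?_, ?_⟩
  · have h1 : ∫ x, (g x + (-1) * ∑ q ∈ F, B q x) ^ 2 ∂μ ≤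
        ∫ x in (⋃ q ∈ F, dcell h q)ᶜ, g x ^ 2 ∂μ + ∑ q ∈ F, avg q ^ 2 * μ.real (dcell h q) := by
      refine (integral_mono hG2i ((hg2i.indicator hNm).add (integrable_finsetSum F hindi))
        (fun x => by simpa using hGsq x)).trans (le_of_eq ?_)
      refine (integral_add (hg2i.indicator hNm) (integrable_finsetSum F hindi)).trans ?_
      rw [integral_indicator hNm]
      congr 1
      rw [integral_finsetSum F hindi]
      refine Finset.sum_congr rfl fun q _ => ?_
      rw [integral_indicator (measurableSet_dcell h q), setIntegral_const, smul_eq_mul, mul_comm]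
    have h2 := hm _ hNm fun x hx => hF3 x hx
    have h3 : ∑ q ∈ F, avg q ^ 2 * μ.real (dcell h q) ≤ D * lam * I := by
      calc _ ≤ ∑ q ∈ F, D * lam * ∫ x in dcell h q, |g x| ∂μ := by
            refine Finset.sum_le_sum fun q hq => ?_
            rw [← sq_abs, pow_two, mul_assoc]
            have := havgle q hq
            have := havgμ q
            gcongr
        _ = D * lam * ∑ q ∈ F, ∫ x in dcell h q, |g x| ∂μ := by rw [Finset.mul_sum]
        _ ≤ _ := by gcongr
    have h4 : 0 ≤ E * lam * I := by positivity
    calc _ ≤ _ := h1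
      _ ≤ 3 * lam * I + D * lam * I := add_le_add h2 h3
      _ ≤ _ := by linarith
  · intro q hq
    have hn : (0 : ℝ) < n := by exact_mod_cast Fin.pos ln
    refine ⟨(hy q hq).2, by positivity, hBb q hq, fun z hz => ?_, hBint q hq⟩
    rw [hB] at hz
    exact hcellsub q hq z (Set.mem_of_indicator_ne_zero hz)
  · calc _ ≤ ∑ q ∈ F, 2 * ∫ x in dcell h q, |g x| ∂μ := Finset.sum_le_sum hBabs
      _ = 2 * ∑ q ∈ F, ∫ x in dcell h q, |g x| ∂μ := by rw [Finset.mul_sum]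
      _ ≤ 2 * I := by gcongr
      _ ≤ _ := by gcongr; linarith
  · calc _ ≤ ∑ q ∈ F, ENNReal.ofReal (E * lam⁻¹ * ∫ x in dcell h q, |g x| ∂μ) := by
          refine Finset.sum_le_sum fun q hq => ?_
          have h1 := hE ln (y q) (h / 2 ^ q.1) (hy q hq).2 (by positivity)
          rw [mem_cell.1 (hy q hq).1, hμ] at h1
          rw [show 4 * ((n : ℝ) * (h / 2 ^ q.1)) = 4 * n * (h / 2 ^ q.1) by ring]
          refine h1.trans ?_
          change ENNReal.ofReal E * μ (dcell h q) ≤ _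
          rw [← ENNReal.ofReal_toReal (hfin q), ← ENNReal.ofReal_mul hE0.le]
          apply ENNReal.ofReal_le_ofReal
          rw [mul_assoc]
          gcongr
          rw [inv_mul_eq_div, le_div_iff₀ hlam, mul_comm]
          exact (hF2 q hq).1.le
      _ = ENNReal.ofReal (∑ q ∈ F, E * lam⁻¹ * ∫ x in dcell h q, |g x| ∂μ) := by
          rw [ENNReal.ofReal_sum_of_nonneg]
          intro q _
          have : 0 ≤ ∫ x in dcell h q, |g x| ∂μ := integral_nonneg fun _ => abs_nonneg _
          positivity
      _ ≤ _ := by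
          apply ENNReal.ofReal_le_ofReal
          rw [← Finset.mul_sum]
          gcongr
          linarith

end Horiuchi

namespace Horiuchi

variable {n : ℕ} {g : Eu n → ℝ}

lemma integrable_ker_mul (hg : BddSupp g) (ln : Fin n) {b κ c s T : ℝ} (i j : Option (Fin n))
    (hb : 0 < b) (hs : 0 < s) {Y : Eu n → Eu n} (hY : Measurable Y) (x : Eu n) : Integrable
      (fun ω => ker ln b κ c i j x (Y ω.1.1) ω.1.2 ω.2 * g ω.1.1) (m3 ln b s T) := by
  have hm : Measurable fun ω : (Eu n × ℝ) × ℝ => ker ln b κ c i j x (Y ω.1.1) ω.1.2 ω.2 :=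
    (measurable_ker ln b κ c i j).comp (by fun_prop : Measurable fun ω : (Eu n × ℝ) × ℝ =>
      (((x, Y ω.1.1), ω.1.2), ω.2))
  have h1 := hg.integrable_m3 ln hb s T
  refine (h1.norm.const_mul (s ^ (-((n + b) / 2)) * ((4 * |κ| + |c|) / s))).mono'
    (hm.aestronglyMeasurable.mul h1.aestronglyMeasurable) ?_
  filter_upwards [m3_ae ln b s T] with ω hω
  obtain ⟨-, hτ, ht, -⟩ := hω
  rw [norm_mul, Real.norm_eq_abs]
  refine mul_le_mul_of_nonneg_right ((abs_ker_le ln b κ c i j x _ hτ.1.le hτ.2.le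
    (hs.trans ht)).trans ?_) (norm_nonneg _)
  have : (0 : ℝ) ≤ n := Nat.cast_nonneg n
  have ht0 : 0 < ω.2 := hs.trans ht
  have e1 : ω.2 ^ (-((n + b) / 2)) ≤ s ^ (-((n + b) / 2)) :=
    Real.rpow_le_rpow_of_nonpos hs ht.le (by linarith)
  gcongr

lemma integral_m3_mul_eq_zero (ln : Fin n) {b s T : ℝ} (hb : 0 < b)
    (hg0 : ∫ y, g y ∂(mub n ln b) = 0) {k : ℝ → ℝ → ℝ}
    (hk : Integrable (fun ω : (Eu n × ℝ) × ℝ => k ω.1.2 ω.2 * g ω.1.1) (m3 ln b s T)) :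
    ∫ ω, k ω.1.2 ω.2 * g ω.1.1 ∂(m3 ln b s T) = 0 := by
  have hP := isProbabilityMeasure_betaM hb
  rw [m3] at hk ⊢
  rw [integral_prod _ hk]
  simp only [integral_mul_const]
  have := integral_prod_mul (μ := mub n ln b) (ν := betaM b) g
    (fun τ => ∫ t in Set.Ioc s T, k τ t)
  rw [hg0, zero_mul] at this
  rw [← this]
  simp_rw [mul_comm]

lemma Sop_add_sum {ι : Type*} (F : Finset ι) {G : Eu n → ℝ} {B : ι → Eu n → ℝ} (hG : BddSupp G)
    (hB : ∀ q ∈ F, BddSupp (B q)) (hg : ∀ x, g x = G x + ∑ q ∈ F, B q x) (ln : Fin n)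
    {b κ c s T : ℝ} (i j : Option (Fin n)) (hb : 0 < b) (hs : 0 < s) (x : Eu n) :
    Sop ln b κ c i j s T g x = Sop ln b κ c i j s T G x +
      ∑ q ∈ F, Sop ln b κ c i j s T (B q) x := by
  have h1 := integrable_ker_mul hG ln (κ := κ) (c := c) (T := T) i j hb hs measurable_id x
  have h2 := fun q (hq : q ∈ F) =>
    integrable_ker_mul (hB q hq) ln (κ := κ) (c := c) (T := T) i j hb hs measurable_id x
  simp only [id] at h1 h2
  simp only [Sop]
  rw [← integral_finsetSum F h2, ← integral_add h1 (integrable_finsetSum F h2)]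
  refine integral_congr_ae (ae_of_all _ fun ω => ?_)
  simp only [hg, mul_add, Finset.mul_sum]

/-- The bound of a mean-zero function away from its support. -/
lemma exists_setLIntegral_Sop_le (n : ℕ) {b : ℝ} (hb : 0 < b) : ∃ C > 0, ∀ (κ c : ℝ)
    (i j : Option (Fin n)), Adm b κ c i j → ∀ (ln : Fin n) (g : Eu n → ℝ) (y : Eu n) (r : ℝ),
    BddSupp g → 0 < y ln → 0 < r → (∀ z, g z ≠ 0 → ‖y - z‖ ≤ r) →
    ∫ z, g z ∂(mub n ln b) = 0 → ∀ s T, 0 < s →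
    ∫⁻ x in {x | 2 * r ≤ ‖x - y‖}, ENNReal.ofReal |Sop ln b κ c i j s T g x| ∂(mub n ln b) ≤
      ENNReal.ofReal (C * ∫ z, |g z| ∂(mub n ln b)) := by
  suffices H : ∀ κ c : ℝ, ∃ C > 0, ∀ (i j : Option (Fin n)) (ln : Fin n) (g : Eu n → ℝ)
      (y : Eu n) (r : ℝ),
      BddSupp g → 0 < y ln → 0 < r → (∀ z, g z ≠ 0 → ‖y - z‖ ≤ r) →
      ∫ z, g z ∂(mub n ln b) = 0 → ∀ s T, 0 < s →
      ∫⁻ x in {x | 2 * r ≤ ‖x - y‖}, ENNReal.ofReal |Sop ln b κ c i j s T g x| ∂(mub n ln b) ≤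
        ENNReal.ofReal (C * ∫ z, |g z| ∂(mub n ln b)) by
    obtain ⟨C1, h1, H1⟩ := H (1 / 4) (-1 / 2)
    obtain ⟨C2, h2, H2⟩ := H (1 / 4) 0
    obtain ⟨C3, h3, H3⟩ := H (1 / (4 * b)) (-1 / 2)
    refine ⟨C1 + C2 + C3, by positivity, fun κ c i j hadm ln g y r a1 a2 a3 a4 a5 s T hs => ?_⟩
    have hI : 0 ≤ ∫ z, |g z| ∂(mub n ln b) := integral_nonneg fun _ => abs_nonneg _
    cases hadm with
    | deriv i j =>
      by_cases hij : i = j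
      · rw [if_pos hij]
        refine (H1 _ _ ln g y r a1 a2 a3 a4 a5 s T hs).trans (ENNReal.ofReal_le_ofReal ?_)
        gcongr; linarith
      · rw [if_neg hij]
        refine (H2 _ _ ln g y r a1 a2 a3 a4 a5 s T hs).trans (ENNReal.ofReal_le_ofReal ?_)
        gcongr; linarith
    | normal =>
      refine (H3 _ _ ln g y r a1 a2 a3 a4 a5 s T hs).trans (ENNReal.ofReal_le_ofReal ?_)
      gcongr; linarith
  intro κ c
  obtain ⟨C, hC, hH⟩ := exists_hormander n hb κ c
  have hP := isProbabilityMeasure_betaM hb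
  refine ⟨C, hC, fun i j ln g y r hg hy hr hsupp hg0 s T hs => ?_⟩
  obtain ⟨Δ, hΔ⟩ : ∃ Δ : Eu n → Eu n → ℝ → ℝ → ℝ≥0∞, Δ = fun x z τ t =>
    ENNReal.ofReal |ker ln b κ c i j x y τ t - ker ln b κ c i j x z τ t| := ⟨_, rfl⟩
  have hΔm : Measurable fun p : ((Eu n × Eu n) × ℝ) × ℝ => Δ p.1.1.1 p.1.1.2 p.1.2 p.2 := by
    rw [hΔ]
    have e1 := measurable_ker ln b κ c i j
    have e2 : Measurable fun p : ((Eu n × Eu n) × ℝ) × ℝ =>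
        ker ln b κ c i j p.1.1.1 y p.1.2 p.2 := e1.comp (by fun_prop :
      Measurable fun p : ((Eu n × Eu n) × ℝ) × ℝ => (((p.1.1.1, y), p.1.2), p.2))
    exact ENNReal.measurable_ofReal.comp (e2.sub e1).abs
  obtain ⟨k, hk⟩ : ∃ k : Eu n → ℝ≥0∞, k = fun z => ENNReal.ofReal |g z| := ⟨_, rfl⟩
  have hkm : Measurable k := by rw [hk]; have := hg.measurable; fun_prop
  have hpt : ∀ x, ENNReal.ofReal |Sop ln b κ c i j s T g x| ≤
      ∫⁻ ω, Δ x ω.1.1 ω.1.2 ω.2 * k ω.1.1 ∂(m3 ln b s T) := fun x => by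
    have h1 := integrable_ker_mul hg ln (κ := κ) (c := c) (T := T) i j hb hs measurable_id x
    have h2 := integrable_ker_mul hg ln (κ := κ) (c := c) (T := T) i j hb hs
      (measurable_const (a := y)) x
    simp only [id] at h1
    have h3 := integral_m3_mul_eq_zero ln (k := fun τ t => ker ln b κ c i j x y τ t) hb hg0 h2
    have h4 : Sop ln b κ c i j s T g x = -∫ ω, (ker ln b κ c i j x y ω.1.2 ω.2 -
        ker ln b κ c i j x ω.1.1 ω.1.2 ω.2) * g ω.1.1 ∂(m3 ln b s T) := by
      simp only [sub_mul]
      rw [integral_sub h2 h1, h3, zero_sub, neg_neg, Sop]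
    rw [h4, abs_neg, ← Real.enorm_eq_ofReal_abs]
    refine (enorm_integral_le_lintegral_enorm _).trans (lintegral_mono fun ω => ?_)
    rw [enorm_mul, Real.enorm_eq_ofReal_abs, Real.enorm_eq_ofReal_abs, hΔ, hk]
  obtain ⟨S, hS⟩ : ∃ S : Set (Eu n), S = {x | 2 * r ≤ ‖x - y‖} := ⟨_, rfl⟩
  rw [← hS]
  obtain ⟨ν, hν⟩ : ∃ ν, ν = (mub n ln b).restrict S := ⟨_, rfl⟩
  have hνs : SFinite ν := by rw [hν]; infer_instance
  rw [← hν]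
  have hHz : ∀ z, ‖y - z‖ ≤ r →
      ∫⁻ x, ∫⁻ τ, (∫⁻ t in Set.Ioi (0 : ℝ), Δ x z τ t) ∂(betaM b) ∂ν ≤ ENNReal.ofReal C := by
    intro z hz
    rw [hν, hS, hΔ]
    exact hH ln i j y z r hy hr hz
  refine (lintegral_mono hpt).trans ?_
  have hm3s : SFinite (m3 ln b s T) := by rw [m3]; infer_instance
  have hjm : Measurable fun p : Eu n × ((Eu n × ℝ) × ℝ) =>
      Δ p.1 p.2.1.1 p.2.1.2 p.2.2 * k p.2.1.1 :=
    (hΔm.comp (by fun_prop : Measurable fun p : Eu n × ((Eu n × ℝ) × ℝ) =>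
      (((p.1, p.2.1.1), p.2.1.2), p.2.2))).mul (hkm.comp (by fun_prop))
  have hΔ4 : Measurable fun p : Eu n × (Eu n × ℝ) =>
      ∫⁻ t in Set.Ioi (0 : ℝ), Δ p.1 p.2.1 p.2.2 t :=
    (hΔm.comp (by fun_prop : Measurable fun p : (Eu n × (Eu n × ℝ)) × ℝ =>
      (((p.1.1, p.1.2.1), p.1.2.2), p.2))).lintegral_prod_right'
  have hx : ∀ x, ∫⁻ ω, Δ x ω.1.1 ω.1.2 ω.2 * k ω.1.1 ∂(m3 ln b s T) ≤
      ∫⁻ z, (∫⁻ τ, (∫⁻ t in Set.Ioi (0 : ℝ), Δ x z τ t) ∂(betaM b)) * k z ∂(mub n ln b) := by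
    intro x
    have e0 : Measurable fun ω : (Eu n × ℝ) × ℝ => Δ x ω.1.1 ω.1.2 ω.2 * k ω.1.1 :=
      hjm.comp measurable_prodMk_left
    have e1 : Measurable fun p : Eu n × ℝ =>
        ∫⁻ t in Set.Ioi (0 : ℝ), Δ x p.1 p.2 t := hΔ4.comp measurable_prodMk_left
    have e2 : Measurable fun p : Eu n × ℝ =>
        (∫⁻ t in Set.Ioi (0 : ℝ), Δ x p.1 p.2 t) * k p.1 := e1.mul (hkm.comp measurable_fst)
    rw [m3, lintegral_prod _ e0.aemeasurable]
    calc _ ≤ ∫⁻ p, (∫⁻ t in Set.Ioi (0 : ℝ), Δ x p.1 p.2 t) * k p.1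
            ∂((mub n ln b).prod (betaM b)) := by
          refine lintegral_mono fun p => ?_
          dsimp only
          have e3 : Measurable fun t : ℝ => Δ x p.1 p.2 t :=
            hΔm.comp (by fun_prop : Measurable fun t : ℝ => (((x, p.1), p.2), t))
          rw [lintegral_mul_const _ e3]
          gcongr
          exact fun t ht => hs.trans ht.1
      _ = _ := by
          rw [lintegral_prod _ e2.aemeasurable]
          refine lintegral_congr fun z => ?_
          have e4 : Measurable fun τ => ∫⁻ t in Set.Ioi (0 : ℝ), Δ x z τ t :=
            e1.comp measurable_prodMk_left
          exact lintegral_mul_const (k z) e4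
  refine (lintegral_mono hx).trans ?_
  have hΔ5 : Measurable fun p : Eu n × Eu n =>
      ∫⁻ τ, (∫⁻ t in Set.Ioi (0 : ℝ), Δ p.1 p.2 τ t) ∂(betaM b) :=
    (hΔ4.comp (by fun_prop : Measurable fun p : (Eu n × Eu n) × ℝ =>
      (p.1.1, (p.1.2, p.2)))).lintegral_prod_right'
  rw [lintegral_lintegral_swap (hΔ5.mul (hkm.comp measurable_snd)).aemeasurable,
    ENNReal.ofReal_mul hC.le,
    ofReal_integral_eq_lintegral_ofReal (hg.integrable ln hb).abs (ae_of_all _ fun _ => abs_nonneg _),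
    ← lintegral_const_mul' _ _ ENNReal.ofReal_ne_top]
  refine lintegral_mono fun z => ?_
  have e6 : Measurable fun x =>
      ∫⁻ τ, (∫⁻ t in Set.Ioi (0 : ℝ), Δ x z τ t) ∂(betaM b) := hΔ5.comp measurable_prodMk_right
  rw [lintegral_mul_const _ e6]
  by_cases hz : g z = 0
  · rw [hk]; simp [hz]
  · rw [hk]
    exact mul_le_mul' (hHz z (hsupp z hz)) le_rfl

end Horiuchi

namespace Horiuchi

variable {n : ℕ} {g : Eu n → ℝ}

lemma lintegral_mub_add_le (ln : Fin n) {b : ℝ} (hb : 0 < b) {e : Eu n} (he : 0 ≤ e ln)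
    (φ : Eu n → ℝ≥0∞) : ∫⁻ x, φ (x + e) ∂(mub n ln b) ≤ ∫⁻ x, φ x ∂(mub n ln b) := by
  rw [lintegral_mub, lintegral_mub, ← lintegral_indicator (measurableSet_upper ln),
    ← lintegral_indicator (measurableSet_upper ln)]
  conv_rhs => rw [← lintegral_add_right_eq_self _ e]
  refine lintegral_mono fun x => ?_
  by_cases hx : x ∈ upper ln
  · have hx' : x + e ∈ upper ln := by
      have : 0 < x ln := hx
      change 0 < (x + e) ln
      simp only [PiLp.add_apply]; linarith
    rw [Set.indicator_of_mem hx, Set.indicator_of_mem hx']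
    gcongr
    · exact (show 0 < x ln from hx).le
    · simp [he]
  · rw [Set.indicator_of_notMem hx]
    exact zero_le

lemma lintegral_lintegral_add_smul_le (ln : Fin n) {b : ℝ} (hb : 0 < b) {e : Eu n}
    (he : 0 ≤ e ln) {φ : Eu n → ℝ≥0∞} (hφ : Measurable φ) :
    ∫⁻ x, (∫⁻ θ in Set.Ioc (0 : ℝ) 1, φ (x + θ • e)) ∂(mub n ln b) ≤
      ∫⁻ x, φ x ∂(mub n ln b) := by
  have hm : Measurable fun p : Eu n × ℝ => φ (p.1 + p.2 • e) := hφ.comp (by fun_prop)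
  rw [lintegral_lintegral_swap hm.aemeasurable]
  calc _ ≤ ∫⁻ θ in Set.Ioc (0 : ℝ) 1, (∫⁻ x, φ x ∂(mub n ln b)) := by
        refine setLIntegral_mono' measurableSet_Ioc fun θ hθ => ?_
        exact lintegral_mub_add_le ln hb (by simpa using mul_nonneg hθ.1.le he) φ
    _ = _ := by simp

lemma lintegral_average_sq_le (ln : Fin n) {b : ℝ} (hb : 0 < b) {e : Eu n}
    (he : 0 ≤ e ln) {Φ : Eu n → ℝ} (hΦ : Continuous Φ) :
    ∫⁻ x, ENNReal.ofReal ((∫ θ in (0 : ℝ)..1, Φ (x + θ • e)) ^ 2) ∂(mub n ln b) ≤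
      ∫⁻ x, ENNReal.ofReal (Φ x ^ 2) ∂(mub n ln b) := by
  refine le_trans (lintegral_mono fun x => ?_) (lintegral_lintegral_add_smul_le ln hb he
    (φ := fun x => ENNReal.ofReal (Φ x ^ 2)) (by have := hΦ.measurable; fun_prop))
  have e1 : ∀ z : ℝ, ENNReal.ofReal (z ^ 2) = ‖z‖ₑ ^ 2 := fun z => by
    rw [Real.enorm_eq_ofReal_abs, ← ENNReal.ofReal_pow (abs_nonneg _), sq_abs]
  simp only [e1]
  rw [intervalIntegral.integral_of_le zero_le_one]
  refine (pow_le_pow_left₀ zero_le (enorm_integral_le_lintegral_enorm _) 2).trans ?_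
  have := sq_lintegral_mul_le (volume.restrict (Set.Ioc (0 : ℝ) 1)) (h := fun _ => 1)
    (k := fun θ => ‖Φ (x + θ • e)‖ₑ) measurable_const
    (by have : Continuous fun θ : ℝ => Φ (x + θ • e) := by fun_prop
        exact this.measurable.enorm)
  simpa using this

lemma setLIntegral_average_le (ln : Fin n) {b : ℝ} (hb : 0 < b) {e : Eu n}
    (he : 0 ≤ e ln) {Φ : Eu n → ℝ} (hΦ : Continuous Φ) {D S : Set (Eu n)}
    (hD : MeasurableSet D) (hS : MeasurableSet S)
    (hDS : ∀ x ∈ D, ∀ θ ∈ Set.Ioc (0 : ℝ) 1, x + θ • e ∈ S) :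
    ∫⁻ x in D, ENNReal.ofReal |∫ θ in (0 : ℝ)..1, Φ (x + θ • e)| ∂(mub n ln b) ≤
      ∫⁻ x in S, ENNReal.ofReal |Φ x| ∂(mub n ln b) := by
  have hm : Measurable fun x => ENNReal.ofReal |Φ x| := by have := hΦ.measurable; fun_prop
  rw [← lintegral_indicator hS]
  refine le_trans ?_ (lintegral_lintegral_add_smul_le ln hb he (hm.indicator hS))
  refine le_trans (setLIntegral_mono' hD fun x hx => ?_) (setLIntegral_le_lintegral _ _)
  rw [intervalIntegral.integral_of_le zero_le_one, ← Real.enorm_eq_ofReal_abs]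
  refine (enorm_integral_le_lintegral_enorm _).trans
    (setLIntegral_mono' measurableSet_Ioc fun θ hθ => ?_)
  rw [Set.indicator_of_mem (hDS x hx θ hθ), Real.enorm_eq_ofReal_abs]

lemma exists_pos_le_of_finset {ι : Type*} (F : Finset ι) {r : ι → ℝ} (hr : ∀ q ∈ F, 0 < r q) :
    ∃ η > 0, ∀ q ∈ F, η ≤ r q := by
  classical
  induction F using Finset.induction_on with
  | empty => exact ⟨1, one_pos, by simp⟩
  | insert a s _ ih =>
    obtain ⟨η, h1, h2⟩ := ih fun q hq => hr q (Finset.mem_insert_of_mem hq)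
    refine ⟨min η (r a), lt_min h1 (hr a (Finset.mem_insert_self _ _)), fun q hq => ?_⟩
    rcases Finset.mem_insert.1 hq with rfl | h
    · exact min_le_right _ _
    · exact (min_le_left _ _).trans (h2 q h)

lemma Sop_eq_zero (ln : Fin n) {b κ c s T : ℝ} (i j : Option (Fin n)) (hb : 0 < b)
    (hg : g =ᵐ[mub n ln b] 0) (x : Eu n) : Sop ln b κ c i j s T g x = 0 := by
  have hP := isProbabilityMeasure_betaM hb
  rw [Sop]
  refine integral_eq_zero_of_ae ?_
  have h1 : ∀ᵐ p ∂((mub n ln b).prod (betaM b)), g p.1 = 0 :=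
    Measure.quasiMeasurePreserving_fst.ae hg
  have h2 : ∀ᵐ ω ∂(m3 ln b s T), g ω.1.1 = 0 := by
    rw [m3]
    exact Measure.quasiMeasurePreserving_fst.ae h1
  filter_upwards [h2] with ω hω
  simp [hω]

/-- The weak type bound, uniform in the truncation and in small translations. -/
lemma exists_weak_bound (n : ℕ) {b : ℝ} (hb : 0 < b) : ∃ C > 0, ∀ (κ c : ℝ)
    (i j : Option (Fin n)), Adm b κ c i j → ∀ (ln : Fin n) (g : Eu n → ℝ), BddSupp g →
    ∀ α > 0, ∃ η > 0, ∀ e : Eu n, ‖e‖ ≤ η → 0 ≤ e ln → ∀ s T, 0 < s → s ≤ T →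
    mub n ln b {x | α < |∫ θ in (0 : ℝ)..1, Sop ln b κ c i j s T g (x + θ • e)|} ≤
      ENNReal.ofReal (C * α⁻¹ * ∫ x, |g x| ∂(mub n ln b)) := by
  obtain ⟨C1, hC1, H1⟩ := exists_calderon_zygmund n hb
  obtain ⟨C2, hC2, H2⟩ := exists_lintegral_Sop_sq_le n hb
  obtain ⟨C3, hC3, H3⟩ := exists_setLIntegral_Sop_le n hb
  refine ⟨4 * C2 * C1 + C1 + 2 * C3 * C1, by positivity, fun κ c i j hadm ln g hg α hα => ?_⟩
  obtain ⟨I, hI⟩ : ∃ I, I = ∫ x, |g x| ∂(mub n ln b) := ⟨_, rfl⟩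
  have hI0 : 0 ≤ I := hI ▸ integral_nonneg fun _ => abs_nonneg _
  rw [← hI]
  rcases hI0.eq_or_lt with h0 | hpos
  · refine ⟨1, one_pos, fun e _ _ s T _ _ => ?_⟩
    have hz : g =ᵐ[mub n ln b] 0 := by
      rw [← h0] at hI
      have := (integral_eq_zero_iff_of_nonneg (fun x => abs_nonneg (g x))
        (hg.integrable ln hb).abs).1 hI.symm
      filter_upwards [this] with x hx
      simpa using hx
    simp [Sop_eq_zero ln i j hb hz, hα.le.not_gt]
  rw [hI] at hpos
  obtain ⟨F, G, B, y, r, hG, hsum, hG2, hB, hB1, hΩ⟩ := H1 ln g α hg hα hpos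
  rw [← hI] at hpos hG2 hB1 hΩ
  obtain ⟨η, hη, hηr⟩ := exists_pos_le_of_finset F fun q hq => (hB q hq).2.1
  refine ⟨η, hη, fun e heη he s T hs hsT => ?_⟩
  have hcG := hadm.continuous_Sop hG ln hb hs hsT
  have hcB := fun q (hq : q ∈ F) => hadm.continuous_Sop (hB q hq).2.2.1 ln hb hs hsT
  have hcA : ∀ {Φ : Eu n → ℝ}, Continuous Φ →
      Continuous fun x => ∫ θ in (0 : ℝ)..1, Φ (x + θ • e) := fun {Φ} hΦ =>
    intervalIntegral.continuous_parametric_intervalIntegral_of_continuous'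
      (f := fun x θ => Φ (x + θ • e)) (by fun_prop) _ _
  obtain ⟨aG, haG⟩ : ∃ a : Eu n → ℝ, a = fun x =>
    ∫ θ in (0 : ℝ)..1, Sop ln b κ c i j s T G (x + θ • e) := ⟨_, rfl⟩
  obtain ⟨aB, haB⟩ : ∃ a : ℕ × (Fin n → ℤ) → Eu n → ℝ, a = fun q x =>
    ∫ θ in (0 : ℝ)..1, Sop ln b κ c i j s T (B q) (x + θ • e) := ⟨_, rfl⟩
  have haGm : Measurable aG := by rw [haG]; exact (hcA hcG).measurable
  have haBm : ∀ q ∈ F, Measurable (aB q) := fun q hq => by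
    rw [haB]; exact (hcA (hcB q hq)).measurable
  have hdec : ∀ x, ∫ θ in (0 : ℝ)..1, Sop ln b κ c i j s T g (x + θ • e) =
      aG x + ∑ q ∈ F, aB q x := fun x => by
    simp only [Sop_add_sum F hG (fun q hq => (hB q hq).2.2.1) hsum ln i j hb hs, haG, haB]
    have i1 : ∀ {Φ : Eu n → ℝ}, Continuous Φ →
        IntervalIntegrable (fun θ : ℝ => Φ (x + θ • e)) volume 0 1 := fun {Φ} hΦ =>
      (show Continuous fun θ : ℝ => Φ (x + θ • e) by fun_prop).intervalIntegrable _ _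
    rw [← intervalIntegral.integral_finsetSum fun q hq => i1 (hcB q hq),
      ← intervalIntegral.integral_add (i1 hcG)]
    exact i1 (Φ := fun z => ∑ q ∈ F, Sop ln b κ c i j s T (B q) z)
      (continuous_finsetSum F fun q hq => hcB q hq)
  obtain ⟨Ω, hΩd⟩ : ∃ Ω : Set (Eu n), Ω = ⋃ q ∈ F, Metric.closedBall (y q) (4 * r q) := ⟨_, rfl⟩
  have hΩm : MeasurableSet Ω := by
    rw [hΩd]; exact F.measurableSet_biUnion fun q _ => Metric.isClosed_closedBall.measurableSet
  obtain ⟨μ, hμ⟩ : ∃ μ, μ = mub n ln b := ⟨_, rfl⟩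
  have m1 : μ {x | ENNReal.ofReal ((α / 2) ^ 2) ≤ ENNReal.ofReal (aG x ^ 2)} ≤
      ENNReal.ofReal (4 * C2 * C1 * α⁻¹ * I) := by
    refine (meas_ge_le_lintegral_div (by fun_prop) (ENNReal.ofReal_pos.2 (by positivity)).ne'
      ENNReal.ofReal_ne_top).trans ?_
    have : ∫⁻ x, ENNReal.ofReal (aG x ^ 2) ∂μ ≤ ENNReal.ofReal (C2 * (C1 * α * I)) := by
      rw [haG, hμ]
      refine (lintegral_average_sq_le ln hb he hcG).trans
        ((H2 κ c i j hadm ln G hG s T hs hsT).trans (ENNReal.ofReal_le_ofReal ?_))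
      gcongr
    refine (ENNReal.div_le_div_right this _).trans ?_
    rw [← ENNReal.ofReal_div_of_pos (by positivity)]
    refine ENNReal.ofReal_le_ofReal (le_of_eq ?_)
    field_simp
    ring
  have m2 : μ Ω ≤ ENNReal.ofReal (C1 * α⁻¹ * I) := by
    rw [hΩd, hμ]
    exact (measure_biUnion_finset_le F _).trans hΩ
  have m3' : (μ.restrict Ωᶜ) {x | ENNReal.ofReal (α / 2) ≤ ∑ q ∈ F, ENNReal.ofReal |aB q x|} ≤
      ENNReal.ofReal (2 * C3 * C1 * α⁻¹ * I) := by
    have q1 : ∀ q ∈ F, Measurable fun x => ENNReal.ofReal |aB q x| := fun q hq => by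
      have := haBm q hq; fun_prop
    refine (meas_ge_le_lintegral_div (Finset.measurable_fun_sum F q1).aemeasurable
      (ENNReal.ofReal_pos.2 (by positivity)).ne' ENNReal.ofReal_ne_top).trans ?_
    have : ∫⁻ x, ∑ q ∈ F, ENNReal.ofReal |aB q x| ∂(μ.restrict Ωᶜ) ≤
        ENNReal.ofReal (C3 * (C1 * I)) := by
      rw [lintegral_finsetSum' F fun q hq => (q1 q hq).aemeasurable]
      calc _ ≤ ∑ q ∈ F, ENNReal.ofReal (C3 * ∫ x, |B q x| ∂μ) := by
            refine Finset.sum_le_sum fun q hq => ?_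
            obtain ⟨b1, b2, b3, b4, b5⟩ := hB q hq
            rw [haB, hμ]
            refine (setLIntegral_average_le ln hb he (hcB q hq) hΩm.compl
              (S := {x | 2 * r q ≤ ‖x - y q‖})
              (isClosed_le continuous_const (by fun_prop)).measurableSet ?_).trans
              (H3 κ c i j hadm ln (B q) (y q) (r q) b3 b1 b2 b4 b5 s T hs)
            intro x hx θ hθ
            have hx' : 4 * r q < ‖x - y q‖ := by
              rw [hΩd] at hx
              simp only [Set.mem_compl_iff, Set.mem_iUnion, not_exists, Metric.mem_closedBall,
                not_le, dist_eq_norm] at hx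
              exact hx q hq
            have h5 : ‖θ • e‖ ≤ r q := by
              rw [norm_smul, Real.norm_eq_abs, abs_of_pos hθ.1]
              have := hηr q hq
              nlinarith [norm_nonneg e, hθ.1, hθ.2]
            have h6 : ‖x - y q‖ ≤ ‖x + θ • e - y q‖ + ‖θ • e‖ := by
              have := norm_sub_le (x + θ • e - y q) (θ • e)
              rwa [show x + θ • e - y q - θ • e = x - y q by abel] at this
            change 2 * r q ≤ ‖x + θ • e - y q‖
            linarith
        _ = ENNReal.ofReal (∑ q ∈ F, C3 * ∫ x, |B q x| ∂μ) := by
            rw [ENNReal.ofReal_sum_of_nonneg]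
            exact fun q _ => mul_nonneg hC3.le (integral_nonneg fun _ => abs_nonneg _)
        _ ≤ _ := by
            rw [← Finset.mul_sum]
            rw [← hμ] at hB1
            refine ENNReal.ofReal_le_ofReal ?_
            gcongr
    refine (ENNReal.div_le_div_right this _).trans ?_
    rw [← ENNReal.ofReal_div_of_pos (by positivity)]
    refine ENNReal.ofReal_le_ofReal (le_of_eq ?_)
    field_simp
  have hsub : {x | α < |∫ θ in (0 : ℝ)..1, Sop ln b κ c i j s T g (x + θ • e)|} ⊆
      {x | ENNReal.ofReal ((α / 2) ^ 2) ≤ ENNReal.ofReal (aG x ^ 2)} ∪ Ω ∪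
      ({x | ENNReal.ofReal (α / 2) ≤ ∑ q ∈ F, ENNReal.ofReal |aB q x|} ∩ Ωᶜ) := by
    intro x hx
    rw [Set.mem_ofPred_eq, hdec] at hx
    by_cases h1 : α / 2 ≤ |aG x|
    · refine Or.inl (Or.inl (ENNReal.ofReal_le_ofReal ?_))
      rw [← sq_abs (aG x)]
      gcongr
    by_cases h2 : x ∈ Ω
    · exact Or.inl (Or.inr h2)
    refine Or.inr ⟨?_, h2⟩
    rw [Set.mem_ofPred_eq, ← ENNReal.ofReal_sum_of_nonneg fun _ _ => abs_nonneg _]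
    refine ENNReal.ofReal_le_ofReal ?_
    have h3 := Finset.abs_sum_le_sum_abs (fun q => aB q x) F
    have h4 := abs_add_le (aG x) (∑ q ∈ F, aB q x)
    linarith
  rw [← hμ]
  refine (measure_mono hsub).trans ?_
  refine (measure_union_le _ _).trans ?_
  rw [← Measure.restrict_apply' hΩm.compl]
  refine (add_le_add ((measure_union_le _ _).trans (add_le_add m1 m2)) m3').trans ?_
  rw [← ENNReal.ofReal_add (by positivity) (by positivity),
    ← ENNReal.ofReal_add (by positivity) (by positivity)]
  exact ENNReal.ofReal_le_ofReal (le_of_eq (by ring))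

end Horiuchi

namespace Horiuchi

variable {n : ℕ} {g : Eu n → ℝ}

open Filter Topology in
/-- Uniform convergence of time-truncated integrals under a uniform majorant. -/
lemma tendstoUniformlyOn_truncation {X β : Type*} [MeasurableSpace β] (ν : Measure β) [SFinite ν]
    {S : Set X} {F : X → β × ℝ → ℝ} (hF : ∀ x ∈ S, Measurable (F x)) {h : ℝ → ℝ≥0∞}
    (hh : Measurable h) (hfin : ∫⁻ t in Set.Ioi (0 : ℝ), h t ≠ ∞)
    (hle : ∀ x ∈ S, ∀ t > 0, ∫⁻ p, ‖F x (p, t)‖ₑ ∂ν ≤ h t) :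
    (∀ x ∈ S, Integrable (F x) (ν.prod (volume.restrict (Set.Ioi (0 : ℝ))))) ∧
    TendstoUniformlyOn (fun (k : ℕ) x => ∫ ω, F x ω
        ∂(ν.prod (volume.restrict (Set.Ioc (1 / ((k : ℝ) + 1)) ((k : ℝ) + 1)))))
      (fun x => ∫ ω, F x ω ∂(ν.prod (volume.restrict (Set.Ioi (0 : ℝ))))) atTop S := by
  obtain ⟨ρ, hρ⟩ : ∃ ρ, ρ = (volume : Measure ℝ).restrict (Set.Ioi (0 : ℝ)) := ⟨_, rfl⟩
  have hρs : SFinite ρ := by rw [hρ]; infer_instance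
  obtain ⟨I, hI⟩ : ∃ I : ℕ → Set ℝ, I = fun k : ℕ =>
    Set.Ioc (1 / ((k : ℝ) + 1)) ((k : ℝ) + 1) := ⟨_, rfl⟩
  have hIm : ∀ k, MeasurableSet (I k) := fun k => by rw [hI]; exact measurableSet_Ioc
  have hI0 : ∀ k, I k ⊆ Set.Ioi 0 := fun k t ht => by
    rw [hI] at ht
    exact lt_trans (by positivity) ht.1
  have hle' : ∀ x ∈ S, ∀ᵐ t ∂ρ, ∫⁻ p, ‖F x (p, t)‖ₑ ∂ν ≤ h t := fun x hx => by
    rw [hρ]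
    filter_upwards [ae_restrict_mem measurableSet_Ioi] with t ht using hle x hx t ht
  have key : ∀ x ∈ S, ∀ A : Set ℝ, MeasurableSet A →
      ∫⁻ ω in Set.univ ×ˢ A, ‖F x ω‖ₑ ∂(ν.prod ρ) ≤ ∫⁻ t in A, h t ∂ρ := by
    intro x hx A hA
    rw [← Measure.prod_restrict, Measure.restrict_univ,
      lintegral_prod_symm _ (hF x hx).enorm.aemeasurable]
    exact lintegral_mono_ae (ae_restrict_of_ae (hle' x hx))
  rw [← hρ] at hfin ⊢
  have hInt : ∀ x ∈ S, Integrable (F x) (ν.prod ρ) := fun x hx => by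
    refine ⟨(hF x hx).aestronglyMeasurable, ?_⟩
    have := key x hx Set.univ MeasurableSet.univ
    simp only [Set.univ_prod_univ, Measure.restrict_univ] at this
    exact this.trans_lt hfin.lt_top
  refine ⟨hInt, ?_⟩
  have htail : Tendsto (fun k => ∫⁻ t in (I k)ᶜ, h t ∂ρ) atTop (𝓝 0) := by
    simp_rw [← lintegral_indicator (hIm _).compl]
    rw [show (0 : ℝ≥0∞) = ∫⁻ t, 0 ∂ρ by simp]
    refine tendsto_lintegral_of_dominated_convergence h (fun k => hh.indicator (hIm k).compl)
      (fun k => ae_of_all _ fun t => Set.indicator_le_self _ _ _) hfin ?_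
    rw [hρ]
    filter_upwards [ae_restrict_mem measurableSet_Ioi] with t ht
    have e1 : ∀ᶠ k : ℕ in atTop, 1 / ((k : ℝ) + 1) < t :=
      tendsto_one_div_add_atTop_nhds_zero_nat.eventually_lt_const ht
    have e2 : ∀ᶠ k : ℕ in atTop, t ≤ k := tendsto_natCast_atTop_atTop.eventually_ge_atTop t
    refine tendsto_const_nhds.congr' ?_
    filter_upwards [e1, e2] with k h1 h2
    rw [Set.indicator_of_notMem]
    rw [hI]
    exact fun hc => hc ⟨h1, by linarith⟩
  rw [Metric.tendstoUniformlyOn_iff]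
  intro ε hε
  filter_upwards [htail.eventually_lt_const (ENNReal.ofReal_pos.2 hε)] with k hk x hx
  have hmk : ν.prod (volume.restrict (Set.Ioc (1 / ((k : ℝ) + 1)) ((k : ℝ) + 1))) =
      (ν.prod ρ).restrict (Set.univ ×ˢ I k) := by
    rw [← Measure.prod_restrict, Measure.restrict_univ, hρ, Measure.restrict_restrict (hIm k),
      Set.inter_eq_self_of_subset_left (hI0 k), hI]
  have hmeas : MeasurableSet (Set.univ ×ˢ I k : Set (β × ℝ)) := MeasurableSet.univ.prod (hIm k)
  have hc : (Set.univ ×ˢ I k : Set (β × ℝ))ᶜ = Set.univ ×ˢ (I k)ᶜ := by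
    ext ω; simp
  rw [hmk, Real.dist_eq, ← integral_add_compl hmeas (hInt x hx), add_sub_cancel_left, hc,
    ← Real.norm_eq_abs]
  have h1 := enorm_integral_le_lintegral_enorm (μ := (ν.prod ρ).restrict (Set.univ ×ˢ (I k)ᶜ))
    (F x)
  have h2 := (h1.trans (key x hx _ (hIm k).compl)).trans_lt hk
  rw [← ofReal_norm] at h2
  exact (ENNReal.ofReal_lt_ofReal_iff hε).1 h2

lemma lintegral_min_majorant {β p : ℝ} (hβ : β < 1) (hp : 1 < p) (K : ℝ) :
    ∫⁻ t in Set.Ioi (0 : ℝ), ENNReal.ofReal (K * if t ≤ 1 then t ^ (-β) else t ^ (-p)) ≠ ∞ := by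
  have h1 : IntegrableOn (fun t : ℝ => if t ≤ 1 then t ^ (-β) else t ^ (-p)) (Set.Ioc 0 1) := by
    have := (intervalIntegral.intervalIntegrable_rpow' (a := 0) (b := 1) (r := -β)
      (by linarith)).1
    refine this.congr_fun (fun t ht => ?_) measurableSet_Ioc
    simp [ht.2]
  have h2 : IntegrableOn (fun t : ℝ => if t ≤ 1 then t ^ (-β) else t ^ (-p)) (Set.Ioi 1) := by
    refine (integrableOn_Ioi_rpow_of_lt (a := -p) (by linarith) one_pos).congr_fun
      (fun t ht => ?_) measurableSet_Ioi
    have : ¬ t ≤ 1 := not_le.2 ht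
    simp [this]
  have h3 := h1.union h2
  rw [Set.Ioc_union_Ioi_eq_Ioi zero_le_one] at h3
  exact (h3.const_mul K).lintegral_lt_top.ne

lemma exists_lintegral_gk_mul_le (hg : BddSupp g) (ln : Fin n) {b c : ℝ} (hb : 0 < b)
    (hc : 0 < c) : ∃ K ≥ 0, ∀ x ∈ upper ln, ∀ t > 0,
      ∫⁻ p, ENNReal.ofReal (gk ln b c x p.1 p.2 t * |g p.1|) ∂((mub n ln b).prod (betaM b)) ≤
        ENNReal.ofReal (K * if t ≤ 1 then 1 else t ^ (-((n + b) / 2))) := by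
  have hP := isProbabilityMeasure_betaM hb
  obtain ⟨C, hC, H⟩ := exists_lintegral_gk_le n hb hc
  obtain ⟨M, hM, hM'⟩ := hg.bdd
  obtain ⟨I, hI⟩ : ∃ I, I = ∫ y, |g y| ∂(mub n ln b) := ⟨_, rfl⟩
  have hI0 : 0 ≤ I := hI ▸ integral_nonneg fun _ => abs_nonneg _
  refine ⟨C * M + I, by positivity, fun x hx t ht => ?_⟩
  have hm : Measurable fun p : Eu n × ℝ => gk ln b c x p.1 p.2 t :=
    (measurable_gk ln b c).comp (by fun_prop : Measurable fun p : Eu n × ℝ =>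
      (((x, p.1), p.2), t))
  have hgm := hg.measurable
  split_ifs with h1
  · calc _ ≤ ∫⁻ p, ENNReal.ofReal (gk ln b c x p.1 p.2 t) * ENNReal.ofReal M
          ∂((mub n ln b).prod (betaM b)) := by
          refine lintegral_mono fun p => ?_
          have := gk_nonneg ln b c x p.1 p.2 ht.le
          rw [← ENNReal.ofReal_mul this]
          refine ENNReal.ofReal_le_ofReal ?_
          have := hM' p.1
          gcongr
      _ ≤ ENNReal.ofReal C * ENNReal.ofReal M := by
          rw [lintegral_mul_const _ hm.ennreal_ofReal, lintegral_prod _ hm.ennreal_ofReal.aemeasurable]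
          exact mul_le_mul' (H ln x t hx ht) le_rfl
      _ ≤ _ := by
          rw [← ENNReal.ofReal_mul hC.le]
          exact ENNReal.ofReal_le_ofReal (by linarith)
  · have hpos : (0 : ℝ) ≤ t ^ (-((n + b) / 2)) := Real.rpow_nonneg ht.le _
    calc _ ≤ ∫⁻ p, ENNReal.ofReal (t ^ (-((n + b) / 2))) * ENNReal.ofReal |g p.1|
          ∂((mub n ln b).prod (betaM b)) := by
          have a1 : ∀ᵐ p ∂((mub n ln b).prod (betaM b)), p.1 ∈ upper ln :=
            Measure.quasiMeasurePreserving_fst.ae (mub_ae_upper ln b)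
          have a2 : ∀ᵐ p ∂((mub n ln b).prod (betaM b)), 0 < p.2 ∧ p.2 < 1 :=
            Measure.quasiMeasurePreserving_snd.ae (betaM_ae b)
          refine lintegral_mono_ae ?_
          filter_upwards [a1, a2] with p h2 h3
          rw [← ENNReal.ofReal_mul hpos]
          refine ENNReal.ofReal_le_ofReal (mul_le_mul_of_nonneg_right ?_ (abs_nonneg _))
          exact gk_le ln hc.le (show 0 < x ln from hx).le (show 0 < p.1 ln from h2).le h3.1.le ht
      _ = ENNReal.ofReal (t ^ (-((n + b) / 2))) * ENNReal.ofReal I := by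
          have e1 : Measurable fun y => ENNReal.ofReal |g y| := by fun_prop
          have e2 : Measurable fun p : Eu n × ℝ => ENNReal.ofReal |g p.1| := e1.comp measurable_fst
          rw [lintegral_const_mul _ e2, lintegral_prod _ e2.aemeasurable, hI,
            ofReal_integral_eq_lintegral_ofReal (hg.integrable ln hb).abs
              (ae_of_all _ fun _ => abs_nonneg _)]
          simp
      _ ≤ _ := by
          rw [← ENNReal.ofReal_mul hpos]
          refine ENNReal.ofReal_le_ofReal ?_
          have : 0 ≤ C * M * t ^ (-((n + b) / 2)) := by positivity
          linarith

/-- The product of the space, angle and full time measures. -/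
def mInf (ln : Fin n) (b : ℝ) : Measure ((Eu n × ℝ) × ℝ) :=
  ((mub n ln b).prod (betaM b)).prod (volume.restrict (Set.Ioi 0))

/-- The full potential. -/
def PotInf (ln : Fin n) (b : ℝ) (g : Eu n → ℝ) (x : Eu n) : ℝ :=
  ∫ ω, gk ln b (1 / 4) x ω.1.1 ω.1.2 ω.2 * g ω.1.1 ∂(mInf ln b)

/-- The full gradient potential. -/
def gradInf (ln : Fin n) (b : ℝ) (g : Eu n → ℝ) (j : Fin n) (x : Eu n) : ℝ :=
  ∫ ω, -(disp ln x ω.1.1 ω.1.2 (some j) / (2 * ω.2)) *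
    (gk ln b (1 / 4) x ω.1.1 ω.1.2 ω.2 * g ω.1.1) ∂(mInf ln b)

open Filter Topology in
lemma tendstoUniformlyOn_of_gk_bound (hg : BddSupp g) (ln : Fin n) {b c β K0 : ℝ}
    (hb : 0 < b) (hn : 2 ≤ n) (hc : 0 < c) (hβ0 : 0 ≤ β) (hβ : β < 1) (hK : 0 ≤ K0)
    {F : Eu n → (Eu n × ℝ) × ℝ → ℝ} (hF : ∀ x, Measurable (F x))
    (hle : ∀ x ∈ upper ln, ∀ y ∈ upper ln, ∀ τ, 0 < τ → τ < 1 → ∀ t > 0,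
      |F x ((y, τ), t)| ≤ K0 * t ^ (-β) * (gk ln b c x y τ t * |g y|)) :
    (∀ x ∈ upper ln, Integrable (F x) (mInf ln b)) ∧
    TendstoUniformlyOn (fun (k : ℕ) x => ∫ ω, F x ω
        ∂(m3 ln b (1 / ((k : ℝ) + 1)) ((k : ℝ) + 1)))
      (fun x => ∫ ω, F x ω ∂(mInf ln b)) atTop (upper ln) := by
  have hP := isProbabilityMeasure_betaM hb
  obtain ⟨K, hK', H⟩ := exists_lintegral_gk_mul_le hg ln hb hc
  have hn' : (2 : ℝ) ≤ n := by exact_mod_cast hn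
  refine tendstoUniformlyOn_truncation ((mub n ln b).prod (betaM b)) (fun x _ => hF x)
    (h := fun t => ENNReal.ofReal (K0 * K * if t ≤ 1 then t ^ (-β) else
      t ^ (-(β + (n + b) / 2)))) ?_
    (lintegral_min_majorant hβ (by linarith) _) fun x hx t ht => ?_
  · have : Measurable fun t : ℝ => if t ≤ 1 then t ^ (-β) else t ^ (-(β + (n + b) / 2)) :=
      Measurable.ite measurableSet_Iic (by fun_prop) (by fun_prop)
    fun_prop
  have a1 : ∀ᵐ p ∂((mub n ln b).prod (betaM b)), p.1 ∈ upper ln :=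
    Measure.quasiMeasurePreserving_fst.ae (mub_ae_upper ln b)
  have a2 : ∀ᵐ p ∂((mub n ln b).prod (betaM b)), 0 < p.2 ∧ p.2 < 1 :=
    Measure.quasiMeasurePreserving_snd.ae (betaM_ae b)
  have hpos : 0 ≤ K0 * t ^ (-β) := mul_nonneg hK (Real.rpow_nonneg ht.le _)
  calc _ ≤ ∫⁻ p, ENNReal.ofReal (K0 * t ^ (-β)) *
        ENNReal.ofReal (gk ln b c x p.1 p.2 t * |g p.1|) ∂((mub n ln b).prod (betaM b)) := by
        refine lintegral_mono_ae ?_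
        filter_upwards [a1, a2] with p h2 h3
        rw [← ENNReal.ofReal_mul hpos, Real.enorm_eq_ofReal_abs]
        exact ENNReal.ofReal_le_ofReal (hle x hx p.1 h2 p.2 h3.1 h3.2 t ht)
    _ ≤ ENNReal.ofReal (K0 * t ^ (-β)) *
        ENNReal.ofReal (K * if t ≤ 1 then 1 else t ^ (-((n + b) / 2))) := by
        rw [lintegral_const_mul' _ _ ENNReal.ofReal_ne_top]
        exact mul_le_mul' le_rfl (H x hx t ht)
    _ ≤ _ := by
        rw [← ENNReal.ofReal_mul hpos]
        refine ENNReal.ofReal_le_ofReal (le_of_eq ?_)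
        split_ifs
        · ring
        · rw [neg_add, Real.rpow_add ht]; ring

open Filter Topology in
lemma tendstoUniformlyOn_Pot (hg : BddSupp g) (ln : Fin n) {b : ℝ} (hb : 0 < b) (hn : 2 ≤ n) :
    (∀ x ∈ upper ln, Integrable (fun ω => gk ln b (1 / 4) x ω.1.1 ω.1.2 ω.2 * g ω.1.1)
      (mInf ln b)) ∧
    TendstoUniformlyOn (fun (k : ℕ) x => Pot ln b (1 / ((k : ℝ) + 1)) ((k : ℝ) + 1) g x)
      (PotInf ln b g) atTop (upper ln) := by
  have hgm := hg.measurable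
  refine tendstoUniformlyOn_of_gk_bound hg ln (c := 1 / 4) (β := 0) (K0 := 1) hb hn
    (by norm_num) le_rfl one_pos zero_le_one
    (F := fun x ω => gk ln b (1 / 4) x ω.1.1 ω.1.2 ω.2 * g ω.1.1) (fun x => ?_) ?_
  · exact ((measurable_gk ln b (1 / 4)).comp (by fun_prop : Measurable fun ω : (Eu n × ℝ) × ℝ =>
      (((x, ω.1.1), ω.1.2), ω.2))).mul (by fun_prop)
  · intro x _ y _ τ _ _ t ht
    rw [abs_mul, abs_of_nonneg (gk_nonneg ln b _ _ _ _ ht.le)]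
    simp

open Filter Topology in
lemma tendstoUniformlyOn_pd_Pot (hg : BddSupp g) (ln : Fin n) {b : ℝ} (hb : 0 < b) (hn : 2 ≤ n)
    (j : Fin n) :
    TendstoUniformlyOn (fun (k : ℕ) => pd (Pot ln b (1 / ((k : ℝ) + 1)) ((k : ℝ) + 1) g) j)
      (gradInf ln b g j) atTop (upper ln) := by
  have hgm := hg.measurable
  have key := (tendstoUniformlyOn_of_gk_bound hg ln (c := 1 / 8) (β := 1 / 2)
    (K0 := (1 / 2) * ((1 / 2) / (1 / 8)) ^ (1 / 2 : ℝ)) hb hn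
    (by norm_num) (by norm_num) (by norm_num) (by positivity)
    (F := fun x ω => -(disp ln x ω.1.1 ω.1.2 (some j) / (2 * ω.2)) *
      (gk ln b (1 / 4) x ω.1.1 ω.1.2 ω.2 * g ω.1.1)) (fun x => ?_) ?_).2
  · refine key.congr (Eventually.of_forall fun k x _ => ?_)
    have hk : (0 : ℝ) < (k : ℝ) + 1 := by positivity
    have hk1 : (1 : ℝ) ≤ (k : ℝ) + 1 := by linarith [(Nat.cast_nonneg k : (0 : ℝ) ≤ k)]
    exact (pd_Pot hg ln hb (by positivity)
      (((div_le_one hk).2 hk1).trans hk1) j x).symm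
  · have e1 : Measurable fun ω : (Eu n × ℝ) × ℝ => gk ln b (1 / 4) x ω.1.1 ω.1.2 ω.2 :=
      (measurable_gk ln b (1 / 4)).comp (by fun_prop : Measurable fun ω : (Eu n × ℝ) × ℝ =>
        (((x, ω.1.1), ω.1.2), ω.2))
    have e2 : Measurable fun ω : (Eu n × ℝ) × ℝ => disp ln x ω.1.1 ω.1.2 (some j) := by
      simp only [disp, Option.elim]
      split_ifs <;> fun_prop
    fun_prop
  · intro x hx y hy τ h0 h1 t ht
    have hA := norm_disp_sq ln x y h0.le h1.le
    have hd := abs_disp_le ln x y τ (some j)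
    obtain ⟨A, hA'⟩ : ∃ A, A = ‖disp ln x y τ‖ := ⟨_, rfl⟩
    have hA0 : 0 ≤ A := hA' ▸ norm_nonneg _
    rw [← hA'] at hA hd
    have e1 := rpow_mul_exp_neg_le (p := 1 / 2) (c := 1 / 8) (z := A ^ 2 / t) (by norm_num)
      (by norm_num) (by positivity)
    have e2 : (A ^ 2 / t) ^ (1 / 2 : ℝ) = A * t ^ (-(1 / 2) : ℝ) := by
      rw [Real.div_rpow (by positivity) ht.le, ← Real.sqrt_eq_rpow, Real.sqrt_sq hA0,
        Real.rpow_neg ht.le, div_eq_mul_inv]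
    have e3 : t⁻¹ = t ^ (-(1 / 2) : ℝ) * t ^ (-(1 / 2) : ℝ) := by
      rw [← Real.rpow_add ht, ← Real.rpow_neg_one]; norm_num
    have hq : 0 ≤ t ^ (-(1 / 2) : ℝ) := Real.rpow_nonneg ht.le _
    have hq2 : 0 ≤ t ^ (-((n + b) / 2)) := Real.rpow_nonneg ht.le _
    rw [e2] at e1
    simp only [abs_mul, abs_neg, abs_div]
    rw [abs_of_nonneg (gk_nonneg ln b _ _ _ _ ht.le), abs_of_pos ht, abs_two, ← mul_assoc,
      ← mul_assoc]
    refine mul_le_mul_of_nonneg_right ?_ (abs_nonneg _)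
    have e4 : gk ln b (1 / 4) x y τ t = t ^ (-((n + b) / 2)) *
        (Real.exp (-(1 / 8 * (A ^ 2 / t))) * Real.exp (-(1 / 8 * (A ^ 2 / t)))) := by
      rw [gk, ← hA, ← Real.exp_add]; congr 2; ring
    have e5 : gk ln b (1 / 8) x y τ t = t ^ (-((n + b) / 2)) *
        Real.exp (-(1 / 8 * (A ^ 2 / t))) := by
      rw [gk, ← hA]; congr 2; ring
    rw [e4, e5]
    obtain ⟨E, hE⟩ : ∃ E, E = Real.exp (-(1 / 8 * (A ^ 2 / t))) := ⟨_, rfl⟩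
    have hE0 : 0 ≤ E := hE ▸ (Real.exp_pos _).le
    rw [← hE] at e1 ⊢
    calc _ ≤ A / (2 * t) * (t ^ (-((n + b) / 2)) * (E * E)) := by gcongr
      _ = 1 / 2 * t ^ (-(1 / 2) : ℝ) * (A * t ^ (-(1 / 2) : ℝ) * E) *
          (t ^ (-((n + b) / 2)) * E) := by
          rw [show A / (2 * t) = 1 / 2 * A * t⁻¹ by field_simp, e3]; ring
      _ ≤ 1 / 2 * t ^ (-(1 / 2) : ℝ) * (1 / 2 / (1 / 8)) ^ (1 / 2 : ℝ) *
          (t ^ (-((n + b) / 2)) * E) := by gcongr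
      _ = _ := by ring

end Horiuchi

namespace Horiuchi

variable {n : ℕ} {g : Eu n → ℝ}

lemma integral_rpow_mul_exp_neg_div {κ a : ℝ} (hκ : 0 < κ) (ha : 0 < a) :
    ∫ t in Set.Ioi (0 : ℝ), t ^ (-(κ + 1)) * Real.exp (-(a / t)) =
      a ^ (-κ) * Real.Gamma κ := by
  have h1 := integral_comp_rpow_Ioi (fun t => t ^ (κ - 1) * Real.exp (-(a * t)))
    (show (-1 : ℝ) ≠ 0 by norm_num)
  rw [Real.integral_rpow_mul_exp_neg_mul_Ioi hκ ha] at h1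
  rw [Real.rpow_neg ha.le, ← Real.inv_rpow ha.le, ← one_div, ← h1]
  refine setIntegral_congr_fun measurableSet_Ioi fun t ht => ?_
  have ht : 0 < t := ht
  simp only [abs_neg, abs_one, one_mul, smul_eq_mul]
  rw [← mul_assoc, ← Real.rpow_mul ht.le, ← Real.rpow_add ht, Real.rpow_neg_one,
    ← div_eq_mul_inv]
  congr 2
  ring

lemma Aq_pos (ln : Fin n) {x y : Eu n} (hx : 0 < x ln) (hy : 0 < y ln) {τ : ℝ} (hτ : 0 < τ) :
    0 < Aq ln x y τ := by
  unfold Aq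
  positivity

lemma norm_sub_reflLn_sq (ln : Fin n) (x y : Eu n) :
    ‖x - reflLn ln y‖ ^ 2 = ‖x - y‖ ^ 2 + 4 * (x ln * y ln) := by
  rw [EuclideanSpace.real_norm_sq_eq, EuclideanSpace.real_norm_sq_eq, ← sub_eq_iff_eq_add',
    ← Finset.sum_sub_distrib, Finset.sum_eq_single ln]
  · simp [reflLn]; ring
  · intro i _ hi
    simp [reflLn, hi]
  · simp

/-- The constant relating the Green function to the heat kernels. -/
def greenConst (n : ℕ) (b : ℝ) : ℝ :=
  Db n b * ProbabilityTheory.beta (b / 2) (b / 2) /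
    ((1 / 4) ^ (-((n + b) / 2 - 1)) * Real.Gamma ((n + b) / 2 - 1))

lemma greenConst_pos (hn : 2 ≤ n) {b : ℝ} (hb : 0 < b) : 0 < greenConst n b := by
  have hn' : (2 : ℝ) ≤ n := by exact_mod_cast hn
  have h1 := ProbabilityTheory.beta_pos (half_pos hb) (half_pos hb)
  have h2 : 0 < Real.Gamma ((n + b) / 2 - 1) := Real.Gamma_pos_of_pos (by linarith)
  have h3 : 0 < Real.Gamma (((n : ℝ) + b - 2) / 2) := Real.Gamma_pos_of_pos (by linarith)
  have h4 : 0 < Real.Gamma (b / 2) := Real.Gamma_pos_of_pos (half_pos hb)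
  have h5 := Real.pi_pos
  unfold greenConst Db
  positivity

lemma Kb_eq (hn : 2 ≤ n) (ln : Fin n) {b : ℝ} (hb : 0 < b) {x y : Eu n} (hx : 0 < x ln)
    (hy : 0 < y ln) : Kb n ln b x y = greenConst n b *
      ∫ τ, (∫ t in Set.Ioi (0 : ℝ), gk ln b (1 / 4) x y τ t) ∂(betaM b) := by
  have hn' : (2 : ℝ) ≤ n := by exact_mod_cast hn
  obtain ⟨κ, hκ⟩ : ∃ κ : ℝ, κ = (n + b) / 2 - 1 := ⟨_, rfl⟩
  have hκ0 : 0 < κ := by linarith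
  have h1 : ∫ τ, (∫ t in Set.Ioi (0 : ℝ), gk ln b (1 / 4) x y τ t) ∂(betaM b) =
      ∫ τ, ((1 / 4) ^ (-κ) * Real.Gamma κ) * Aq ln x y τ ^ (-κ) ∂(betaM b) := by
    refine integral_congr_ae ?_
    filter_upwards [betaM_ae b] with τ hτ
    have hA := Aq_pos ln hx hy hτ.1
    have h2 := integral_rpow_mul_exp_neg_div hκ0 (show 0 < 1 / 4 * Aq ln x y τ by positivity)
    rw [show -(κ + 1) = -((n + b) / 2) by rw [hκ]; ring] at h2
    simp only [gk]
    rw [h2, Real.mul_rpow (by norm_num) hA.le]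
    ring
  have h2 := ProbabilityTheory.beta_pos (half_pos hb) (half_pos hb)
  have h3 : 0 < Real.Gamma κ := Real.Gamma_pos_of_pos hκ0
  rw [h1, integral_const_mul, integral_betaM b hb, greenConst, ← hκ, Kb]
  have h4 : ∀ τ : ℝ, ‖x - y‖ ^ 2 * (1 - τ) + ‖x - reflLn ln y‖ ^ 2 * τ = Aq ln x y τ := fun τ => by
    rw [norm_sub_reflLn_sq, Aq]; ring
  simp only [h4]
  rw [show -(((n : ℝ) - 2 + b) / 2) = -κ by rw [hκ]; ring]
  field_simp

lemma Tb_eq (hg : BddSupp g) (hn : 2 ≤ n) (ln : Fin n) {b : ℝ} (hb : 0 < b) {x : Eu n}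
    (hx : x ∈ upper ln) : Tb n ln b g x = greenConst n b * PotInf ln b g x := by
  have hP := isProbabilityMeasure_betaM hb
  have hi := (tendstoUniformlyOn_Pot hg ln hb hn).1 x hx
  have h1 : Tb n ln b g x = ∫ y, Kb n ln b x y * g y ∂(mub n ln b) := by
    rw [integral_mub, Tb]
    refine setIntegral_congr_fun (measurableSet_upper ln) fun y _ => ?_
    ring
  rw [h1, PotInf, mInf]
  rw [mInf] at hi
  rw [integral_prod _ hi, integral_prod _ hi.integral_prod_left, ← integral_const_mul]
  refine integral_congr_ae ?_
  filter_upwards [mub_ae_upper ln b] with y hy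
  rw [Kb_eq hn ln hb hx hy]
  simp only [integral_mul_const]
  ring

lemma differentiable_Pot (hg : BddSupp g) (ln : Fin n) {b s T : ℝ} (hb : 0 < b) (hs : 0 < s)
    (hsT : s ≤ T) : Differentiable ℝ (Pot ln b s T g) := by
  rw [Pot_eq]
  exact (Nice.base _ (amplitude_heatAmp hg ln hb hs hsT)).differentiable measurable_heatRate
    (measurable_heatShift ln)

lemma differentiable_pd_Pot (hg : BddSupp g) (ln : Fin n) {b s T : ℝ} (hb : 0 < b) (hs : 0 < s)
    (hsT : s ≤ T) (j : Fin n) : Differentiable ℝ (pd (Pot ln b s T g) j) := by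
  rw [Pot_eq]
  exact ((Nice.base _ (amplitude_heatAmp hg ln hb hs hsT)).pd measurable_heatRate
    (measurable_heatShift ln) j).differentiable measurable_heatRate (measurable_heatShift ln)

open Filter Topology in
lemma hasFDerivAt_PotInf (hg : BddSupp g) (ln : Fin n) {b : ℝ} (hb : 0 < b) (hn : 2 ≤ n)
    {x : Eu n} (hx : x ∈ upper ln) : HasFDerivAt (PotInf ln b g)
      (∑ j, gradInf ln b g j x • (EuclideanSpace.proj (𝕜 := ℝ) j : Eu n →L[ℝ] ℝ)) x := by
  have hk : ∀ k : ℕ, 0 < 1 / ((k : ℝ) + 1) ∧ 1 / ((k : ℝ) + 1) ≤ (k : ℝ) + 1 := fun k => by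
    have h1 : (0 : ℝ) < (k : ℝ) + 1 := by positivity
    have h2 : (1 : ℝ) ≤ (k : ℝ) + 1 := by linarith [(Nat.cast_nonneg k : (0 : ℝ) ≤ k)]
    exact ⟨by positivity, ((div_le_one h1).2 h2).trans h2⟩
  refine hasFDerivAt_of_tendstoUniformlyOn (l := atTop) (isOpen_upper ln)
    (f := fun (k : ℕ) => Pot ln b (1 / ((k : ℝ) + 1)) ((k : ℝ) + 1) g)
    (f' := fun (k : ℕ) x => fderiv ℝ (Pot ln b (1 / ((k : ℝ) + 1)) ((k : ℝ) + 1) g) x)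
    (g' := fun x => ∑ j, gradInf ln b g j x • (EuclideanSpace.proj (𝕜 := ℝ) j : Eu n →L[ℝ] ℝ))
    ?_ (fun k x _ => (differentiable_Pot hg ln hb (hk k).1 (hk k).2 x).hasFDerivAt)
    (fun x hx => (tendstoUniformlyOn_Pot hg ln hb hn).2.tendsto_at hx) hx
  rw [Metric.tendstoUniformlyOn_iff]
  intro ε hε
  obtain ⟨D, hD⟩ : ∃ D : ℝ, D = ∑ j : Fin n,
    ‖(EuclideanSpace.proj (𝕜 := ℝ) j : Eu n →L[ℝ] ℝ)‖ := ⟨_, rfl⟩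
  have hD0 : 0 ≤ D := hD ▸ Finset.sum_nonneg fun _ _ => norm_nonneg _
  have h1 : ∀ j : Fin n, ∀ᶠ k : ℕ in atTop, ∀ x ∈ upper ln, |gradInf ln b g j x -
      pd (Pot ln b (1 / ((k : ℝ) + 1)) ((k : ℝ) + 1) g) j x| < ε / (D + 1) := fun j =>
    (Metric.tendstoUniformlyOn_iff.1 (tendstoUniformlyOn_pd_Pot hg ln hb hn j)) _ (by positivity)
  filter_upwards [eventually_all.2 h1] with k hk x hx
  rw [fderiv_eq_sum_pd, dist_eq_norm, ← Finset.sum_sub_distrib]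
  calc _ ≤ ∑ j : Fin n, ε / (D + 1) * ‖(EuclideanSpace.proj (𝕜 := ℝ) j : Eu n →L[ℝ] ℝ)‖ := by
        refine norm_sum_le_of_le _ fun j _ => ?_
        rw [← sub_smul, norm_smul, Real.norm_eq_abs]
        exact mul_le_mul_of_nonneg_right (hk j x hx).le (norm_nonneg _)
    _ = ε * (D / (D + 1)) := by rw [← Finset.mul_sum, ← hD]; ring
    _ < ε * 1 := by
        gcongr
        rw [div_lt_one (by positivity)]; linarith
    _ = ε := mul_one _

lemma pd_Tb (hg : BddSupp g) (hn : 2 ≤ n) (ln : Fin n) {b : ℝ} (hb : 0 < b) (j : Fin n)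
    {x : Eu n} (hx : x ∈ upper ln) :
    pd (Tb n ln b g) j x = greenConst n b * gradInf ln b g j x := by
  have h1 : Tb n ln b g =ᶠ[nhds x] fun x => greenConst n b * PotInf ln b g x := by
    filter_upwards [(isOpen_upper ln).mem_nhds hx] with z hz using Tb_eq hg hn ln hb hz
  rw [pd, h1.fderiv_eq, ((hasFDerivAt_PotInf hg ln hb hn hx).const_mul _).fderiv]
  simp [PiLp.single_apply]

lemma measure_le_of_subset_eventually {X : Type*} [MeasurableSpace X] (μ : Measure X)
    {S : Set X} {s : ℕ → Set X} {c : ℝ≥0∞} (hs : ∀ k, μ (s k) ≤ c)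
    (hS : ∀ x ∈ S, ∀ᶠ k in Filter.atTop, x ∈ s k) : μ S ≤ c := by
  have h1 : S ⊆ ⋃ K : ℕ, ⋂ k ≥ K, s k := fun x hx => by
    obtain ⟨K, hK⟩ := Filter.eventually_atTop.1 (hS x hx)
    exact Set.mem_iUnion.2 ⟨K, Set.mem_iInter₂.2 hK⟩
  have h2 : Monotone fun K : ℕ => ⋂ k ≥ K, s k := fun K L hKL =>
    Set.biInter_subset_biInter_left fun k hk => le_trans hKL hk
  refine (measure_mono h1).trans ?_
  rw [h2.measure_iUnion]
  exact iSup_le fun K => (measure_mono (Set.iInter₂_subset K le_rfl)).trans (hs K)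

open Filter Topology in
lemma exists_weak_bound_normal (hn : 2 ≤ n) {b : ℝ} (hb : 0 < b) : ∃ C > 0, ∀ (ln : Fin n)
    (g : Eu n → ℝ), BddSupp g → ∀ α > 0,
    mub n ln b {x | α < |pd (Tb n ln b g) ln x / x ln|} ≤
      ENNReal.ofReal (C * α⁻¹ * ∫ x, |g x| ∂(mub n ln b)) := by
  obtain ⟨C, hC, H⟩ := exists_weak_bound n hb
  have hG := greenConst_pos hn hb
  refine ⟨C * greenConst n b, by positivity, fun ln g hg α hα => ?_⟩
  obtain ⟨η, hη, Hη⟩ := H _ _ _ _ (Adm.normal (n := n)) ln g hg (α / greenConst n b)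
    (by positivity)
  have hk : ∀ k : ℕ, 0 < 1 / ((k : ℝ) + 1) ∧ 1 / ((k : ℝ) + 1) ≤ (k : ℝ) + 1 := fun k => by
    have h1 : (0 : ℝ) < (k : ℝ) + 1 := by positivity
    have h2 : (1 : ℝ) ≤ (k : ℝ) + 1 := by linarith [(Nat.cast_nonneg k : (0 : ℝ) ≤ k)]
    exact ⟨by positivity, ((div_le_one h1).2 h2).trans h2⟩
  have hc : C * greenConst n b * α⁻¹ = C * (α / greenConst n b)⁻¹ := by field_simp
  rw [hc]
  have hae : {x | α < |pd (Tb n ln b g) ln x / x ln|} ≤ᵐ[mub n ln b]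
      {x | 0 < x ln ∧ α < |pd (Tb n ln b g) ln x / x ln|} := by
    filter_upwards [mub_ae_upper ln b] with x hx h using ⟨hx, h⟩
  refine (measure_mono_ae hae).trans ?_
  refine measure_le_of_subset_eventually _
    (fun k => Hη 0 (by simpa using hη.le) le_rfl _ _ (hk k).1 (hk k).2) fun x hx => ?_
  obtain ⟨hx0, hxα⟩ := hx
  have hlim := (tendstoUniformlyOn_pd_Pot hg ln hb hn ln).tendsto_at (x := x) hx0
  rw [pd_Tb hg hn ln hb ln hx0, mul_div_assoc, abs_mul, abs_of_pos hG, ← div_lt_iff₀' hG] at hxα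
  filter_upwards [(hlim.div_const (x ln)).abs.eventually_const_lt hxα] with k h1
  rw [pd_Pot_normal hg ln hb (hk k).1 (hk k).2, mul_div_cancel_left₀ _ hx0.ne'] at h1
  simpa using h1

lemma sub_eq_integral_pd {φ : Eu n → ℝ} (h : Differentiable ℝ φ) (i : Fin n)
    (hc : Continuous (pd φ i)) (x : Eu n) (a : ℝ) :
    φ (x + a • EuclideanSpace.single i 1) - φ x =
      a * ∫ θ in (0 : ℝ)..1, pd φ i (x + θ • (a • EuclideanSpace.single i 1)) := by
  have h1 : ∀ θ : ℝ, HasDerivAt (fun θ : ℝ => φ (x + θ • (a • EuclideanSpace.single i 1)))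
      (a * pd φ i (x + θ • (a • EuclideanSpace.single i 1))) θ := fun θ => by
    have e1 : HasDerivAt (fun θ : ℝ => x + θ • (a • (EuclideanSpace.single i 1 : Eu n)))
        (a • EuclideanSpace.single i 1) θ := by
      simpa using ((hasDerivAt_id θ).smul_const (a • (EuclideanSpace.single i 1 : Eu n))).const_add x
    have e2 := (h (x + θ • (a • EuclideanSpace.single i 1))).hasFDerivAt.comp_hasDerivAt θ e1
    rw [map_smul, smul_eq_mul] at e2
    exact e2
  rw [← intervalIntegral.integral_const_mul,
    intervalIntegral.integral_eq_sub_of_hasDerivAt (fun θ _ => h1 θ)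
      (by apply Continuous.intervalIntegrable; fun_prop)]
  simp

open Filter Topology in
lemma exists_weak_bound_pd2 (hn : 2 ≤ n) {b : ℝ} (hb : 0 < b) : ∃ C > 0, ∀ (ln : Fin n)
    (g : Eu n → ℝ), BddSupp g → ∀ α > 0, ∀ i j : Fin n,
    mub n ln b {x | α < |pd2 (Tb n ln b g) i j x|} ≤
      ENNReal.ofReal (C * α⁻¹ * ∫ x, |g x| ∂(mub n ln b)) := by
  obtain ⟨C, hC, H⟩ := exists_weak_bound n hb
  have hG := greenConst_pos hn hb
  refine ⟨C * greenConst n b, by positivity, fun ln g hg α hα i j => ?_⟩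
  obtain ⟨η, hη, Hη⟩ := H _ _ _ _ (Adm.deriv i j) ln g hg (α / greenConst n b)
    (by positivity)
  have hk : ∀ k : ℕ, 0 < 1 / ((k : ℝ) + 1) ∧ 1 / ((k : ℝ) + 1) ≤ (k : ℝ) + 1 := fun k => by
    have h1 : (0 : ℝ) < (k : ℝ) + 1 := by positivity
    have h2 : (1 : ℝ) ≤ (k : ℝ) + 1 := by linarith [(Nat.cast_nonneg k : (0 : ℝ) ≤ k)]
    exact ⟨by positivity, ((div_le_one h1).2 h2).trans h2⟩
  have hc : C * greenConst n b * α⁻¹ = C * (α / greenConst n b)⁻¹ := by field_simp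
  rw [hc]
  obtain ⟨v, hv⟩ : ∃ v : Eu n → ℝ, v = pd (Tb n ln b g) j := ⟨_, rfl⟩
  obtain ⟨e, he⟩ : ∃ e : Eu n, e = EuclideanSpace.single i 1 := ⟨_, rfl⟩
  have hen : ‖e‖ = 1 := by rw [he]; simp
  have hel : 0 ≤ e ln := by
    rw [he, PiLp.single_apply]; split_ifs <;> norm_num
  have hae : {x | α < |pd2 (Tb n ln b g) i j x|} ≤ᵐ[mub n ln b]
      {x | 0 < x ln ∧ α < |pd2 (Tb n ln b g) i j x|} := by
    filter_upwards [mub_ae_upper ln b] with x hx h using ⟨hx, h⟩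
  refine (measure_mono_ae hae).trans ?_
  have hp : ∀ p : ℕ, 0 < η * (1 / ((p : ℝ) + 1)) ∧ η * (1 / ((p : ℝ) + 1)) ≤ η := fun p => by
    have h1 : (0 : ℝ) < (p : ℝ) + 1 := by positivity
    have h2 : (1 : ℝ) ≤ (p : ℝ) + 1 := by linarith [(Nat.cast_nonneg p : (0 : ℝ) ≤ p)]
    exact ⟨by positivity, mul_le_of_le_one_right hη.le ((div_le_one h1).2 h2)⟩
  have inner : ∀ a : ℝ, 0 < a → a ≤ η →
      mub n ln b {x | 0 < x ln ∧ α < |a⁻¹ * (v (x + a • e) - v x)|} ≤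
        ENNReal.ofReal (C * (α / greenConst n b)⁻¹ * ∫ x, |g x| ∂(mub n ln b)) := by
    intro a ha haη
    have hael : 0 ≤ (a • e) ln := by
      simpa using mul_nonneg ha.le hel
    refine measure_le_of_subset_eventually _
      (fun k => Hη (a • e) (by rwa [norm_smul, hen, mul_one, Real.norm_eq_abs, abs_of_pos ha])
        hael _ _ (hk k).1 (hk k).2) fun x hx => ?_
    obtain ⟨hx0, hxα⟩ := hx
    have hxa : x + a • e ∈ upper ln := by
      change 0 < (x + a • e) ln
      rw [PiLp.add_apply]; linarith
    have hu := tendstoUniformlyOn_pd_Pot hg ln hb hn j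
    have hlim := (((hu.tendsto_at hxa).sub (hu.tendsto_at (x := x) hx0)).const_mul a⁻¹).abs
    rw [hv, pd_Tb hg hn ln hb j hxa, pd_Tb hg hn ln hb j hx0, ← mul_sub, mul_left_comm, abs_mul,
      abs_of_pos hG, ← div_lt_iff₀' hG] at hxα
    filter_upwards [hlim.eventually_const_lt hxα] with k h1
    have hpp := pd_pd_Pot hg ln hb (hk k).1 (hk k).2 i j
    rw [he, sub_eq_integral_pd (differentiable_pd_Pot hg ln hb (hk k).1 (hk k).2 j) i
      (by rw [hpp]; exact (Adm.deriv i j).continuous_Sop hg ln hb (hk k).1 (hk k).2), hpp,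
      inv_mul_cancel_left₀ ha.ne', ← he] at h1
    exact h1
  refine measure_le_of_subset_eventually _ (fun p => inner _ (hp p).1 (hp p).2) fun x hx => ?_
  obtain ⟨hx0, hxα⟩ := hx
  rw [pd2, ← hv, pd, ← he] at hxα
  have hd : DifferentiableAt ℝ v x := by
    by_contra hcon
    rw [fderiv_zero_of_not_differentiableAt hcon] at hxα
    simp at hxα
    linarith
  have h0 : Tendsto (fun p : ℕ => η * (1 / ((p : ℝ) + 1))) atTop (𝓝[>] 0) := by
    refine tendsto_nhdsWithin_iff.2 ⟨?_, Eventually.of_forall fun p => (hp p).1⟩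
    simpa using tendsto_one_div_add_atTop_nhds_zero_nat.const_mul η
  have h1 := (hd.hasFDerivAt.hasLineDerivAt e).tendsto_slope_zero_right.comp h0
  filter_upwards [h1.abs.eventually_const_lt hxα] with p h2
  exact ⟨hx0, h2⟩

end Horiuchi

theorem stmt15 (n : ℕ) (hn : 2 ≤ n) (ln : Fin n) (hln : (ln : ℕ) = n - 1)
    (b : ℝ) (hb : 0 < b) :
    ∃ C : ℝ, 0 < C ∧
      ∀ f : Eu n → ℝ, Measurable f → (∃ M : ℝ, ∀ y, |f y| ≤ M) →
        (∀ y : Eu n, f y ≠ 0 → y ∈ Metric.ball (0 : Eu n) 1) →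
        ∀ α : ℝ, 0 < α →
          -- weak (1,1) bound for the second derivatives ∂ᵢⱼ(T_b f) …
          (∀ i j : Fin n,
            mub n ln b {x : Eu n | α < |pd2 (Tb n ln b f) i j x|} ≤
              ENNReal.ofReal (C * α⁻¹ * ∫ y, |f y| ∂(mub n ln b))) ∧
          -- … and for ∂ₙ(T_b f)/xₙ
          mub n ln b {x : Eu n | α < |pd (Tb n ln b f) ln x / x ln|} ≤
            ENNReal.ofReal (C * α⁻¹ * ∫ y, |f y| ∂(mub n ln b)) := by
  obtain ⟨C₁, hC₁, h₁⟩ := Horiuchi.exists_weak_bound_pd2 hn hb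
  obtain ⟨C₂, hC₂, h₂⟩ := Horiuchi.exists_weak_bound_normal hn hb
  refine ⟨C₁ + C₂, by positivity, fun f hf hbdd hsupp α hα => ?_⟩
  have hg : Horiuchi.BddSupp f := by
    obtain ⟨M, hM⟩ := hbdd
    exact ⟨hf, ⟨M, (abs_nonneg _).trans (hM 0), hM⟩, 1, zero_le_one,
      fun y hy => (mem_ball_zero_iff.1 (hsupp y hy)).le⟩
  have hI : 0 ≤ ∫ y, |f y| ∂(mub n ln b) := integral_nonneg fun y => abs_nonneg _
  refine ⟨fun i j => (h₁ ln f hg α hα i j).trans (ENNReal.ofReal_le_ofReal ?_),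
    (h₂ ln f hg α hα).trans (ENNReal.ofReal_le_ofReal ?_)⟩ <;>
  · gcongr
    linarith
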